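/- Let c₁, c₂ > 0. Assume n ≥ 4·v_{G₀}², σ > 0, 0 ≤ t ≤ c₁·n²·p^{e_{G₀}}·√q/√Ψ_min, and t²·s(t) ≤ c₂, where s(t) := (1 + t/min{√Ψ_min, 1})·(q·Ψ_min)^{−1/2}·exp(5·D·t/σ). Then |ℙ(W > t)/(1 − Φ(t)) − 1| ≤ C_{c₁,c₂,G₀}·(1 + t³)/√(q·Ψ_min), where C_{c₁,c₂,G₀} := 100·(1 + c₁)·c_{G₀}·e^{5·c₁·ĉ_{G₀} + c₂·c_{G₀}}, with c_{G₀} := 2^{9/2 + (15/2)·e_{G₀}} · (v_{G₀}!)⁴ · e_{G₀} / aut(G₀)^{3/2} and ĉ_{G₀} := √2 · √(v_{G₀}!) · v_{G₀}² · e_{G₀} / √aut(G₀). -/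

import Mathlib

open MeasureTheory ProbabilityTheory
open scoped Classical

/-- Standard normal distribution function Φ. -/
noncomputable def stdNormalCDF (z : ℝ) : ℝ :=
  ∫ x in Set.Iic z, Real.exp (-x ^ 2 / 2) / Real.sqrt (2 * Real.pi)

/-- `Γ ⊆ E(K_n)` is a copy of `G₀` if it is the image of the edge set of `G₀` under an
injection of the vertices. -/
noncomputable def copyFinset {V₀ : Type*} [Fintype V₀] [DecidableEq V₀]
    (G₀ : SimpleGraph V₀) [DecidableRel G₀.Adj] (n : ℕ) :
    Finset (Finset (Sym2 (Fin n))) :=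
  Finset.univ.filter (fun Γ => ∃ f : V₀ ↪ Fin n, Γ = G₀.edgeFinset.image (Sym2.map ⇑f))

/-- The product `B_Γ = ∏_{k∈Γ} B_k` of edge indicators. -/
noncomputable def prodB {Ω : Type*} {n : ℕ} (B : Sym2 (Fin n) → Ω → ℝ)
    (Γ : Finset (Sym2 (Fin n))) (ω : Ω) : ℝ :=
  ∏ k ∈ Γ, B k ω

/-- `σ = √Var(∑_{Γ∈𝓜} B_Γ)`. -/
noncomputable def subgraphSigma {V₀ : Type*} [Fintype V₀] [DecidableEq V₀]
    (G₀ : SimpleGraph V₀) [DecidableRel G₀.Adj] (n : ℕ)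
    {Ω : Type*} [MeasurableSpace Ω] (μ : Measure Ω) (B : Sym2 (Fin n) → Ω → ℝ) : ℝ :=
  Real.sqrt ((∫ ω, (∑ Γ ∈ copyFinset G₀ n, prodB B Γ ω) ^ 2 ∂μ) -
    (∫ ω, ∑ Γ ∈ copyFinset G₀ n, prodB B Γ ω ∂μ) ^ 2)

/-- The standardized subgraph count `W = σ^{−1} ∑_{Γ∈𝓜} B_Γ^c`. -/
noncomputable def subgraphW {V₀ : Type*} [Fintype V₀] [DecidableEq V₀]
    (G₀ : SimpleGraph V₀) [DecidableRel G₀.Adj] (n : ℕ)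
    {Ω : Type*} [MeasurableSpace Ω] (μ : Measure Ω) (B : Sym2 (Fin n) → Ω → ℝ)
    (ω : Ω) : ℝ :=
  (subgraphSigma G₀ n μ B)⁻¹ *
    ∑ Γ ∈ copyFinset G₀ n, (prodB B Γ ω - ∫ ω', prodB B Γ ω' ∂μ)

/-- `Ψ_min = min{ n^{v_H} p^{e_H} : H ⊆ G₀ a subgraph with at least one edge }. -/
noncomputable def PsiMin {V₀ : Type*} [Fintype V₀] [DecidableEq V₀]
    (G₀ : SimpleGraph V₀) [DecidableRel G₀.Adj] (n : ℕ) (p : ℝ) : ℝ :=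
  sInf {x : ℝ | ∃ S ⊆ G₀.edgeFinset, S.Nonempty ∧
    x = (n : ℝ) ^ (Finset.univ.filter (fun v : V₀ => ∃ e ∈ S, v ∈ e)).card * p ^ S.card}

/-- `s(t) = (1 + t/min{√Ψ_min, 1})·(q·Ψ_min)^{−1/2}·exp(5Dt/σ)`. -/
noncomputable def sFun (Ψ σ q : ℝ) (D : ℕ) (t : ℝ) : ℝ :=
  (1 + t / min (Real.sqrt Ψ) 1) * (1 / Real.sqrt (q * Ψ)) *
    Real.exp (5 * (D : ℝ) * t / σ)

/-- `c_{G₀} = 2^{9/2 + (15/2)e_{G₀}} · (v_{G₀}!)⁴ · e_{G₀} / aut(G₀)^{3/2}`. -/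
noncomputable def cConst {V₀ : Type*} [Fintype V₀] [DecidableEq V₀]
    (G₀ : SimpleGraph V₀) [DecidableRel G₀.Adj] : ℝ :=
  (2 : ℝ) ^ ((9 : ℝ) / 2 + 15 / 2 * (G₀.edgeFinset.card : ℝ)) *
    ((Fintype.card V₀).factorial : ℝ) ^ 4 * (G₀.edgeFinset.card : ℝ) /
    (Nat.card (G₀ ≃g G₀) : ℝ) ^ ((3 : ℝ) / 2)

/-- `ĉ_{G₀} = √2 · √(v_{G₀}!) · v_{G₀}² · e_{G₀} / √aut(G₀)`. -/
noncomputable def cHatConst {V₀ : Type*} [Fintype V₀] [DecidableEq V₀]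
    (G₀ : SimpleGraph V₀) [DecidableRel G₀.Adj] : ℝ :=
  Real.sqrt 2 * Real.sqrt ((Fintype.card V₀).factorial : ℝ) *
    ((Fintype.card V₀ : ℝ)) ^ 2 * (G₀.edgeFinset.card : ℝ) /
    Real.sqrt (Nat.card (G₀ ≃g G₀) : ℝ)


set_option linter.unusedSectionVars false
set_option linter.unusedSimpArgs false
set_option linter.unusedVariables false

open MeasureTheory ProbabilityTheory
open scoped Classical

set_option linter.unusedSectionVars false
set_option linter.unusedSimpArgs false
set_option linter.unusedVariables false

namespace CMD

section FiniteModel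
variable {E : Type*} [Fintype E] [DecidableEq E]

/-- Expectation over a random subset of `E` (each element kept with probability `p`). -/
noncomputable def Ex (p : ℝ) (F : Finset E → ℝ) : ℝ :=
  ∑ S : Finset E, p ^ S.card * (1 - p) ^ (Sᶜ.card) * F S

/-- Indicator that all elements of `A` are present. -/
noncomputable def BB (A S : Finset E) : ℝ := if A ⊆ S then 1 else 0

lemma Ex_add (p : ℝ) (F G : Finset E → ℝ) : Ex p (fun S => F S + G S) = Ex p F + Ex p G := by
  simp only [Ex, mul_add, Finset.sum_add_distrib]

lemma Ex_sub (p : ℝ) (F G : Finset E → ℝ) : Ex p (fun S => F S - G S) = Ex p F - Ex p G := by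
  simp only [Ex, mul_sub, Finset.sum_sub_distrib]

lemma Ex_mul (p c : ℝ) (F : Finset E → ℝ) : Ex p (fun S => c * F S) = c * Ex p F := by
  simp only [Ex, Finset.mul_sum]
  exact Finset.sum_congr rfl fun _ _ => by ring

lemma Ex_sum {ι : Type*} (p : ℝ) (s : Finset ι) (F : ι → Finset E → ℝ) :
    Ex p (fun S => ∑ i ∈ s, F i S) = ∑ i ∈ s, Ex p (F i) := by
  simp only [Ex, Finset.mul_sum]
  rw [Finset.sum_comm]

lemma Ex_mono {p : ℝ} (hp : 0 ≤ p) (hp1 : p ≤ 1) {F G : Finset E → ℝ} (h : ∀ S, F S ≤ G S) :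
    Ex p F ≤ Ex p G := by
  unfold Ex
  refine Finset.sum_le_sum fun S _ => ?_
  have : 0 ≤ 1 - p := by linarith
  exact mul_le_mul_of_nonneg_left (h S) (by positivity)

lemma Ex_zero (p : ℝ) : Ex p (fun _ : Finset E => (0 : ℝ)) = 0 := by simp [Ex]

lemma Ex_nonneg {p : ℝ} (hp : 0 ≤ p) (hp1 : p ≤ 1) {F : Finset E → ℝ} (h : ∀ S, 0 ≤ F S) :
    0 ≤ Ex p F := by
  rw [← Ex_zero (E := E) p]
  exact Ex_mono hp hp1 h

lemma Ex_const (p c : ℝ) : Ex p (fun _ : Finset E => c) = c := by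
  unfold Ex
  have h := Finset.sum_pow_mul_eq_add_pow p (1 - p) (Finset.univ : Finset E)
  rw [← Finset.sum_mul]
  rw [Finset.powerset_univ] at h
  have h2 : ∀ S : Finset E, Sᶜ.card = (Finset.univ : Finset E).card - S.card := fun S => by
    rw [Finset.card_compl]; rfl
  simp only [h2]
  rw [h]; simp

lemma Ex_abs_le {p : ℝ} (hp : 0 ≤ p) (hp1 : p ≤ 1) (F : Finset E → ℝ) :
    |Ex p F| ≤ Ex p (fun S => |F S|) := by
  rw [abs_le]
  constructor
  · have := Ex_mono hp hp1 (F := fun S => (-1) * |F S|) (G := F)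
      (fun S => by have := neg_abs_le (F S); linarith)
    rw [Ex_mul] at this; linarith
  · exact Ex_mono hp hp1 fun S => le_abs_self _

lemma Ex_step (p : ℝ) (F : Finset E → ℝ) (k : E) :
    Ex p F = Ex p (fun S => p * F (insert k S) + (1 - p) * F (S.erase k)) := by
  unfold Ex
  have hu : (Finset.univ : Finset (Finset E)) = (insert k (Finset.univ.erase k)).powerset := by
    rw [Finset.insert_erase (Finset.mem_univ k), Finset.powerset_univ]
  rw [hu, Finset.sum_powerset_insert (by simp), Finset.sum_powerset_insert (by simp),
    ← Finset.sum_add_distrib, ← Finset.sum_add_distrib]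
  refine Finset.sum_congr rfl fun T hT => ?_
  have hk : k ∉ T := fun h => by
    have := Finset.mem_powerset.1 hT h
    simp at this
  have h1 : (insert k T).card = T.card + 1 := Finset.card_insert_of_notMem hk
  have h2 : Tᶜ.card = (insert k T)ᶜ.card + 1 := by
    have a := Finset.card_add_card_compl T
    have b := Finset.card_add_card_compl (insert k T)
    omega
  simp only []
  rw [Finset.erase_eq_of_notMem hk, Finset.insert_idem, Finset.erase_insert hk, h1, h2]
  ring

lemma Ex_indep (p : ℝ) (A : Finset E) : ∀ (F G : Finset E → ℝ)
    (_ : ∀ S T, S ∩ A = T ∩ A → F S = F T) (_ : ∀ S T, S \ A = T \ A → G S = G T),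
    Ex p (fun S => F S * G S) = Ex p F * Ex p G := by
  induction A using Finset.induction_on with
  | empty =>
    intro F G hF _
    have : ∀ S, F S = F ∅ := fun S => hF _ _ (by simp)
    have h2 : Ex p F = F ∅ := by
      rw [show F = fun _ => F ∅ from funext this, Ex_const]
    rw [h2, ← Ex_mul]
    simp only [this]
  | insert a A ha ih =>
    intro F G hF hG
    have hG2 : ∀ S T, S \ A = T \ A → G S = G T := by
      intro S T h
      apply hG
      ext x
      have := Finset.ext_iff.1 h x
      simp only [Finset.mem_sdiff, Finset.mem_insert] at this ⊢
      tauto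
    have hF2 : ∀ S T, S ∩ A = T ∩ A →
        p * F (insert a S) + (1 - p) * F (S.erase a) =
        p * F (insert a T) + (1 - p) * F (T.erase a) := by
      intro S T h
      have e1 : F (insert a S) = F (insert a T) := by
        apply hF
        ext x
        have := Finset.ext_iff.1 h x
        simp only [Finset.mem_inter, Finset.mem_insert] at this ⊢
        tauto
      have e2 : F (S.erase a) = F (T.erase a) := by
        apply hF
        ext x
        have := Finset.ext_iff.1 h x
        simp only [Finset.mem_inter, Finset.mem_insert, Finset.mem_erase] at this ⊢
        tauto
      rw [e1, e2]
    rw [Ex_step p _ a, Ex_step p F a, ← ih _ G hF2 hG2]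
    congr 1
    ext S
    have e1 : G (insert a S) = G S := by
      apply hG
      ext x
      simp only [Finset.mem_sdiff, Finset.mem_insert]
      tauto
    have e2 : G (S.erase a) = G S := by
      apply hG
      ext x
      simp only [Finset.mem_sdiff, Finset.mem_insert, Finset.mem_erase]
      tauto
    rw [e1, e2]; ring

lemma BB_nonneg (A S : Finset E) : 0 ≤ BB A S := by unfold BB; split_ifs <;> norm_num

lemma BB_le_one (A S : Finset E) : BB A S ≤ 1 := by unfold BB; split_ifs <;> norm_num

lemma BB_mono (A : Finset E) {S T : Finset E} (h : S ⊆ T) : BB A S ≤ BB A T := by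
  unfold BB
  split_ifs with h1 h2
  · exact le_rfl
  · exact absurd (h1.trans h) h2
  · norm_num
  · exact le_rfl

lemma BB_mul (A A' S : Finset E) : BB A S * BB A' S = BB (A ∪ A') S := by
  unfold BB
  by_cases h1 : A ⊆ S <;> by_cases h2 : A' ⊆ S <;> simp [h1, h2, Finset.union_subset_iff]

lemma BB_dep (A C : Finset E) (h : A ⊆ C) (S T : Finset E) (hST : S ∩ C = T ∩ C) :
    BB A S = BB A T := by
  have : A ⊆ S ↔ A ⊆ T := by
    constructor
    · intro hS x hx
      have : x ∈ S ∩ C := Finset.mem_inter.2 ⟨hS hx, h hx⟩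
      rw [hST] at this; exact (Finset.mem_inter.1 this).1
    · intro hS x hx
      have : x ∈ T ∩ C := Finset.mem_inter.2 ⟨hS hx, h hx⟩
      rw [← hST] at this; exact (Finset.mem_inter.1 this).1
  unfold BB; simp [this]

lemma Ex_BB (p : ℝ) (A : Finset E) : Ex p (BB A) = p ^ A.card := by
  induction A using Finset.induction_on with
  | empty =>
    have : (BB (∅ : Finset E)) = fun _ => (1 : ℝ) := by ext S; simp [BB]
    rw [this, Ex_const]; simp
  | insert a A ha ih =>
    rw [Ex_step p _ a, Finset.card_insert_of_notMem ha, pow_succ, ← ih, mul_comm, ← Ex_mul]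
    have : ∀ _ : Finset E, Ex p (fun S => p * BB (insert a A) (insert a S) +
        (1 - p) * BB (insert a A) (S.erase a)) = Ex p (fun S => p * BB A S) := by
      intro _
      rw [Ex_step p (fun S => p * BB A S) a]
      congr 1
      ext S
      have e1 : BB (insert a A) (insert a S) = BB A S := by
        unfold BB
        have : insert a A ⊆ insert a S ↔ A ⊆ S := by
          constructor
          · intro h x hx
            have := h (Finset.mem_insert_of_mem hx)
            rcases Finset.mem_insert.1 this with rfl | h
            · exact absurd hx ha
            · exact h
          · intro h; exact Finset.insert_subset_insert a h
        simp [this]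
      have e2 : BB (insert a A) (S.erase a) = 0 := by
        unfold BB
        rw [if_neg]
        intro h
        have := h (Finset.mem_insert_self a A)
        simp at this
      have e3 : BB A (insert a S) = BB A S := by
        apply BB_dep A A subset_rfl
        ext x; simp only [Finset.mem_inter, Finset.mem_insert]
        constructor
        · rintro ⟨rfl | h, h2⟩
          · exact absurd h2 ha
          · exact ⟨h, h2⟩
        · tauto
      have e4 : BB A (S.erase a) = BB A S := by
        apply BB_dep A A subset_rfl
        ext x; simp only [Finset.mem_inter, Finset.mem_erase]
        constructor
        · tauto
        · rintro ⟨h, h2⟩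
          refine ⟨⟨?_, h⟩, h2⟩
          rintro rfl; exact ha h2
      rw [e1, e2, e3, e4]; ring
    exact this ∅

/-- Centred single-element integration by parts. -/
lemma Ex_ibp (p : ℝ) (k : E) (R F : Finset E → ℝ)
    (hR : ∀ S, R (insert k S) = R S ∧ R (S.erase k) = R S) :
    Ex p (fun S => (BB {k} S - p) * R S * F S) =
      p * (1 - p) * Ex p (fun S => R S * (F (insert k S) - F (S.erase k))) := by
  rw [Ex_step p _ k, ← Ex_mul]
  congr 1
  ext S
  have e1 : BB {k} (insert k S) = 1 := by simp [BB]
  have e2 : BB {k} (S.erase k) = 0 := by simp [BB]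
  rw [e1, e2, (hR S).1, (hR S).2]; ring

lemma Ex_CS {p : ℝ} (hp : 0 ≤ p) (hp1 : p ≤ 1) (F G : Finset E → ℝ) :
    (Ex p (fun S => F S * G S)) ^ 2 ≤ Ex p (fun S => F S ^ 2) * Ex p (fun S => G S ^ 2) := by
  have hw : ∀ S : Finset E, 0 ≤ p ^ S.card * (1 - p) ^ (Sᶜ.card) := fun S => by
    have : 0 ≤ 1 - p := by linarith
    positivity
  have := Finset.sum_mul_sq_le_sq_mul_sq (Finset.univ : Finset (Finset E))
    (fun S => Real.sqrt (p ^ S.card * (1 - p) ^ (Sᶜ.card)) * F S)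
    (fun S => Real.sqrt (p ^ S.card * (1 - p) ^ (Sᶜ.card)) * G S)
  unfold Ex
  have a1 : ∀ S : Finset E, (Real.sqrt (p ^ S.card * (1 - p) ^ (Sᶜ.card)) * F S) *
      (Real.sqrt (p ^ S.card * (1 - p) ^ (Sᶜ.card)) * G S) =
      p ^ S.card * (1 - p) ^ (Sᶜ.card) * (F S * G S) := fun S => by
    have := Real.mul_self_sqrt (hw S)
    calc _ = (Real.sqrt (p ^ S.card * (1 - p) ^ (Sᶜ.card)) *
      Real.sqrt (p ^ S.card * (1 - p) ^ (Sᶜ.card))) * (F S * G S) := by ring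
      _ = _ := by rw [this]
  have a2 : ∀ (H : Finset E → ℝ) (S : Finset E),
      (Real.sqrt (p ^ S.card * (1 - p) ^ (Sᶜ.card)) * H S) ^ 2 =
      p ^ S.card * (1 - p) ^ (Sᶜ.card) * (H S ^ 2) := fun H S => by
    rw [mul_pow, Real.sq_sqrt (hw S)]
  simp only [a1, a2 F, a2 G] at this
  exact this

end FiniteModel
end CMD

open MeasureTheory ProbabilityTheory
open scoped Classical
set_option linter.unusedVariables false

namespace CMD
section Gauss

/-- Gaussian density. -/
noncomputable def phi (x : ℝ) : ℝ := Real.exp (-x ^ 2 / 2) / Real.sqrt (2 * Real.pi)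

/-- Gaussian upper tail. -/
noncomputable def QQ (x : ℝ) : ℝ := 1 - stdNormalCDF x

lemma sqrt2pi_pos : 0 < Real.sqrt (2 * Real.pi) := by positivity

lemma phi_pos (x : ℝ) : 0 < phi x := by unfold phi; positivity

lemma phi_eq (x : ℝ) : phi x = gaussianPDFReal 0 1 x := by
  unfold phi gaussianPDFReal
  simp
  rw [div_eq_inv_mul]
  ring

lemma cdf_eq (x : ℝ) : stdNormalCDF x = cdf (gaussianReal 0 1) x := by
  rw [cdf_eq_real, Measure.real, gaussianReal_apply_eq_integral _ (by norm_num)]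
  rw [ENNReal.toReal_ofReal (by
    apply integral_nonneg
    intro y; exact gaussianPDFReal_nonneg _ _ _)]
  unfold stdNormalCDF
  congr 1
  ext y
  exact phi_eq y

lemma phi_integrable : Integrable phi := by
  have : phi = gaussianPDFReal 0 1 := funext phi_eq
  rw [this]; exact integrable_gaussianPDFReal 0 1

lemma phi_cont : Continuous phi := by unfold phi; fun_prop

lemma cdf_nonneg' (x : ℝ) : 0 ≤ stdNormalCDF x := by
  rw [cdf_eq]; exact cdf_nonneg _ _

lemma cdf_le_one' (x : ℝ) : stdNormalCDF x ≤ 1 := by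
  rw [cdf_eq]; exact cdf_le_one _ _

lemma QQ_tendsto : Filter.Tendsto QQ Filter.atTop (nhds 0) := by
  have h := tendsto_cdf_atTop (gaussianReal 0 1)
  have h2 : QQ = fun x => 1 - cdf (gaussianReal 0 1) x := by
    ext x; unfold QQ; rw [cdf_eq]
  rw [h2]
  have := (tendsto_const_nhds (x := (1 : ℝ))).sub h
  simpa using this

lemma hasDerivAt_cdf (x : ℝ) : HasDerivAt stdNormalCDF (phi x) x := by
  have h : stdNormalCDF = fun y => (∫ u in (0:ℝ)..y, phi u) + stdNormalCDF 0 := by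
    ext y
    have := intervalIntegral.integral_Iic_sub_Iic (f := phi) (μ := volume) (a := 0) (b := y)
      phi_integrable.integrableOn phi_integrable.integrableOn
    rw [← this]
    show stdNormalCDF y = stdNormalCDF y - stdNormalCDF 0 + stdNormalCDF 0
    ring
  rw [h]
  have := (intervalIntegral.integral_hasDerivAt_right (phi_cont.intervalIntegrable 0 x)
    (phi_cont.stronglyMeasurableAtFilter _ _) phi_cont.continuousAt)
  exact this.add_const _

lemma hasDerivAt_QQ (x : ℝ) : HasDerivAt QQ (-phi x) x := by
  unfold QQ
  exact (hasDerivAt_cdf x).const_sub 1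

lemma hasDerivAt_phi (x : ℝ) : HasDerivAt phi (-x * phi x) x := by
  unfold phi
  have h : HasDerivAt (fun x : ℝ => -x ^ 2 / 2) (-x) x := by
    have := ((hasDerivAt_pow 2 x).neg).div_const 2
    refine HasDerivAt.congr_deriv this ?_
    simp
    ring
  have := (h.exp).div_const (Real.sqrt (2 * Real.pi))
  refine HasDerivAt.congr_deriv this ?_
  ring

lemma phi_even (x : ℝ) : phi (-x) = phi x := by unfold phi; simp

lemma cdf_neg (x : ℝ) : stdNormalCDF (-x) = QQ x := by
  have h1 : stdNormalCDF (-x) = ∫ u in Set.Ioi x, phi u := by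
    have := integral_comp_neg_Iic (-x) phi
    rw [neg_neg] at this
    rw [← this]
    unfold stdNormalCDF
    congr 1
    ext u
    rw [phi_even]; rfl
  have h2 : stdNormalCDF x + ∫ u in Set.Ioi x, phi u = 1 := by
    have e := intervalIntegral.integral_Iic_add_Ioi (f := phi) (μ := volume) (b := x)
      phi_integrable.integrableOn phi_integrable.integrableOn
    have e2 : ∫ u, phi u = 1 := by
      rw [show phi = gaussianPDFReal 0 1 from funext phi_eq]
      exact integral_gaussianPDFReal_eq_one 0 (by norm_num)
    rw [e2] at e
    exact e
  unfold QQ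
  linarith

lemma phi_tendsto : Filter.Tendsto phi Filter.atTop (nhds 0) := by
  have h : Filter.Tendsto (fun x : ℝ => -x ^ 2 / 2) Filter.atTop Filter.atBot := by
    have : Filter.Tendsto (fun x : ℝ => x ^ 2 / 2) Filter.atTop Filter.atTop :=
      (Filter.tendsto_pow_atTop (by norm_num)).atTop_div_const (by norm_num)
    have h2 := Filter.tendsto_neg_atTop_atBot.comp this
    refine h2.congr fun x => ?_
    simp only [Function.comp]
    ring
  have := (Real.tendsto_exp_atBot.comp h).div_const (Real.sqrt (2 * Real.pi))
  rw [zero_div] at this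
  exact this

/-- A function with nonpositive derivative on `(a,∞)` and limit zero is nonnegative. -/
lemma nonneg_of_deriv (G G' : ℝ → ℝ) (a : ℝ) (hd : ∀ x, a ≤ x → HasDerivAt G (G' x) x)
    (hn : ∀ x, a ≤ x → G' x ≤ 0) (hl : Filter.Tendsto G Filter.atTop (nhds 0)) : 0 ≤ G a := by
  have hanti : AntitoneOn G (Set.Ici a) := by
    apply antitoneOn_of_deriv_nonpos (convex_Ici a)
    · intro x hx; exact (hd x hx).continuousAt.continuousWithinAt
    · intro x hx
      rw [interior_Ici] at hx
      exact (hd x (le_of_lt hx)).differentiableAt.differentiableWithinAt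
    · intro x hx
      rw [interior_Ici] at hx
      rw [(hd x (le_of_lt hx)).deriv]
      exact hn x (le_of_lt hx)
  refine le_of_tendsto hl ?_
  filter_upwards [Filter.eventually_ge_atTop a] with x hx
  exact hanti (Set.mem_Ici.2 le_rfl) hx hx

lemma QQ_lower (w : ℝ) : w * phi w ≤ (1 + w ^ 2) * QQ w := by
  have key : 0 ≤ QQ w - w / (1 + w ^ 2) * phi w := by
    apply nonneg_of_deriv (fun x => QQ x - x / (1 + x ^ 2) * phi x)
      (fun x => -(2 * phi x / (1 + x ^ 2) ^ 2)) w
    · intro x _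
      have hx : (1 + x ^ 2) ≠ 0 := by positivity
      have h1 : HasDerivAt (fun x : ℝ => 1 + x ^ 2) (2 * x) x := by
        have := (hasDerivAt_pow 2 x).const_add 1
        simpa using this
      have h2 := (hasDerivAt_id x).div h1 hx
      have h3 := (hasDerivAt_QQ x).sub (h2.mul (hasDerivAt_phi x))
      refine HasDerivAt.congr_deriv h3 ?_
      simp only [id, Pi.div_apply]
      field_simp
      ring
    · intro x _
      have := phi_pos x
      have : 0 ≤ 2 * phi x / (1 + x ^ 2) ^ 2 := by positivity
      linarith
    · have h1 : Filter.Tendsto (fun x : ℝ => x / (1 + x ^ 2) * phi x) Filter.atTop (nhds 0) := by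
        refine squeeze_zero_norm (a := phi) (fun x => ?_) phi_tendsto
        rw [Real.norm_eq_abs, abs_mul, abs_of_pos (phi_pos x)]
        have : |x / (1 + x ^ 2)| ≤ 1 := by
          rw [abs_div, abs_of_pos (show (0:ℝ) < 1 + x ^ 2 by positivity), div_le_one (by positivity)]
          rw [abs_le]; constructor <;> nlinarith
        have := phi_pos x
        nlinarith
      have := QQ_tendsto.sub h1
      simpa using this
  have h : 0 < 1 + w ^ 2 := by positivity
  have := mul_nonneg h.le key
  have e : (1 + w ^ 2) * (QQ w - w / (1 + w ^ 2) * phi w) = (1 + w ^ 2) * QQ w - w * phi w := by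
    field_simp
  linarith

lemma QQ_upper {w : ℝ} (hw : 0 < w) : w * QQ w ≤ phi w := by
  have key : 0 ≤ phi w / w - QQ w := by
    apply nonneg_of_deriv (fun x => phi x / x - QQ x) (fun x => -(phi x / x ^ 2)) w
    · intro x hx
      have hx0 : x ≠ 0 := by linarith
      have h3 := ((hasDerivAt_phi x).div (hasDerivAt_id x) hx0).sub (hasDerivAt_QQ x)
      refine HasDerivAt.congr_deriv h3 ?_
      simp only [id]
      field_simp
      ring
    · intro x _
      have := phi_pos x
      have : 0 ≤ phi x / x ^ 2 := by positivity
      linarith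
    · have h1 : Filter.Tendsto (fun x : ℝ => phi x / x) Filter.atTop (nhds 0) :=
        phi_tendsto.div_atTop Filter.tendsto_id
      have := h1.sub QQ_tendsto
      simpa using this
  rw [sub_nonneg, le_div_iff₀ hw] at key
  linarith

lemma QQ_lower2 {w : ℝ} (hw : 0 ≤ w) : phi w ≤ (1 + w) * QQ w := by
  have key : 0 ≤ QQ w - phi w / (1 + w) := by
    apply nonneg_of_deriv (fun x => QQ x - phi x / (1 + x)) (fun x => -(x * phi x / (1 + x) ^ 2)) w
    · intro x hx
      have hx0 : 1 + x ≠ 0 := by linarith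
      have h3 := (hasDerivAt_QQ x).sub ((hasDerivAt_phi x).div ((hasDerivAt_id x).const_add 1) hx0)
      refine HasDerivAt.congr_deriv h3 ?_
      simp only [id]
      field_simp
      ring
    · intro x hx
      have h0 : 0 ≤ x := by linarith
      have := phi_pos x
      have : 0 ≤ x * phi x / (1 + x) ^ 2 := by positivity
      linarith
    · have h1 : Filter.Tendsto (fun x : ℝ => phi x / (1 + x)) Filter.atTop (nhds 0) :=
        phi_tendsto.div_atTop (Filter.tendsto_atTop_add_const_left _ _ Filter.tendsto_id)
      have := QQ_tendsto.sub h1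
      simpa using this
  rw [sub_nonneg, div_le_iff₀ (by linarith)] at key
  linarith

lemma QQ_pos {t : ℝ} (ht : 0 ≤ t) : 0 < QQ t := by
  have h1 := QQ_lower2 ht
  have h2 := phi_pos t
  by_contra h
  push Not at h
  nlinarith

lemma QQ_nonneg (t : ℝ) : 0 ≤ QQ t := by unfold QQ; linarith [cdf_le_one' t]

/-- Left branch factor `√(2π) e^{w²/2} Φ(w)`. -/
noncomputable def psiL (w : ℝ) : ℝ := stdNormalCDF w / phi w
/-- Right branch factor. -/
noncomputable def psiR (w : ℝ) : ℝ := QQ w / phi w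

lemma psiL_nonneg (w : ℝ) : 0 ≤ psiL w := div_nonneg (cdf_nonneg' w) (phi_pos w).le
lemma psiR_nonneg (w : ℝ) : 0 ≤ psiR w := div_nonneg (QQ_nonneg w) (phi_pos w).le

lemma hasDerivAt_psiL (w : ℝ) : HasDerivAt psiL (w * psiL w + 1) w := by
  have h := (hasDerivAt_cdf w).div (hasDerivAt_phi w) (phi_pos w).ne'
  have h0 := (phi_pos w).ne'
  refine HasDerivAt.congr_deriv h ?_
  unfold psiL; field_simp; ring

lemma hasDerivAt_psiR (w : ℝ) : HasDerivAt psiR (w * psiR w - 1) w := by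
  have h := (hasDerivAt_QQ w).div (hasDerivAt_phi w) (phi_pos w).ne'
  have h0 := (phi_pos w).ne'
  refine HasDerivAt.congr_deriv h ?_
  unfold psiR; field_simp; ring

lemma mono_wpsiL : Monotone (fun w => w * psiL w) := by
  apply monotone_of_deriv_nonneg
  · intro w; exact ((hasDerivAt_id w).mul (hasDerivAt_psiL w)).differentiableAt
  · intro w
    have := ((hasDerivAt_id w).mul (hasDerivAt_psiL w)).deriv
    change deriv (fun w => w * psiL w) w = _ at this
    rw [this]
    simp only [id]
    have h1 := QQ_lower (-w)
    rw [← cdf_neg, neg_neg, phi_even] at h1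
    have h0 := phi_pos w
    have : 1 * psiL w + w * (w * psiL w + 1) = ((1 + (-w)^2) * stdNormalCDF w - (-w) * phi w) / phi w := by
      unfold psiL; field_simp; ring
    rw [this]
    apply div_nonneg _ h0.le; linarith

lemma mono_wpsiR : Monotone (fun w => w * psiR w) := by
  apply monotone_of_deriv_nonneg
  · intro w; exact ((hasDerivAt_id w).mul (hasDerivAt_psiR w)).differentiableAt
  · intro w
    have := ((hasDerivAt_id w).mul (hasDerivAt_psiR w)).deriv
    change deriv (fun w => w * psiR w) w = _ at this
    rw [this]
    simp only [id]
    have h1 := QQ_lower w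
    have h0 := phi_pos w
    have : 1 * psiR w + w * (w * psiR w - 1) = ((1 + w^2) * QQ w - w * phi w) / phi w := by
      unfold psiR; field_simp; ring
    rw [this]
    apply div_nonneg _ h0.le; linarith

/-- Stein solution. -/
noncomputable def fS (t w : ℝ) : ℝ := if w ≤ t then psiL w * QQ t else psiR w * stdNormalCDF t

/-- The antitone part of the derivative. -/
noncomputable def jS (t w : ℝ) : ℝ := (if w ≤ t then 1 else 0) - stdNormalCDF t

lemma fS_left {t w : ℝ} (h : w ≤ t) : fS t w = psiL w * QQ t := by simp [fS, h]

lemma fS_right {t w : ℝ} (h : t ≤ w) : fS t w = psiR w * stdNormalCDF t := by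
  rcases h.eq_or_lt with rfl | h
  · rw [fS_left le_rfl]; unfold psiL psiR; ring
  · simp [fS, not_le.2 h]

lemma hS_mono (t : ℝ) : Monotone (fun w => w * fS t w) := by
  apply MonotoneOn.Iic_union_Ici (a := t)
  · intro a ha b hb hab
    simp only [Set.mem_Iic] at ha hb
    simp only [fS_left ha, fS_left hb, ← mul_assoc]
    exact mul_le_mul_of_nonneg_right (mono_wpsiL hab) (QQ_nonneg t)
  · intro a ha b hb hab
    simp only [Set.mem_Ici] at ha hb
    simp only [fS_right ha, fS_right hb, ← mul_assoc]
    exact mul_le_mul_of_nonneg_right (mono_wpsiR hab) (cdf_nonneg' t)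

lemma jS_anti (t : ℝ) : Antitone (jS t) := by
  intro a b hab
  unfold jS
  split_ifs with h1 h2
  · exact le_rfl
  · exact absurd (hab.trans h1) h2
  · linarith
  · exact le_rfl

lemma fS_mvtL {t a b : ℝ} (hab : a ≤ b) (hb : b ≤ t) :
    (b - a) * (a * fS t a + QQ t) ≤ fS t b - fS t a ∧
    fS t b - fS t a ≤ (b - a) * (b * fS t b + QQ t) := by
  rcases hab.eq_or_lt with rfl | hab
  · simp
  obtain ⟨c, hc, he⟩ := exists_hasDerivAt_eq_slope (fun w => psiL w * QQ t)
    (fun w => (w * psiL w + 1) * QQ t) hab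
    (fun w _ => ((hasDerivAt_psiL w).mul_const (QQ t)).continuousAt.continuousWithinAt)
    (fun w _ => (hasDerivAt_psiL w).mul_const (QQ t))
  have hba : 0 < b - a := sub_pos.2 hab
  rw [eq_div_iff hba.ne'] at he
  rw [fS_left hb, fS_left (hab.le.trans hb), ← he]
  have m1 := mul_le_mul_of_nonneg_right (mono_wpsiL hc.1.le) (QQ_nonneg t)
  have m2 := mul_le_mul_of_nonneg_right (mono_wpsiL hc.2.le) (QQ_nonneg t)
  simp only at m1 m2
  constructor <;> nlinarith

lemma fS_mvtR {t a b : ℝ} (hab : a ≤ b) (ha : t ≤ a) :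
    (b - a) * (a * fS t a - stdNormalCDF t) ≤ fS t b - fS t a ∧
    fS t b - fS t a ≤ (b - a) * (b * fS t b - stdNormalCDF t) := by
  rcases hab.eq_or_lt with rfl | hab
  · simp
  obtain ⟨c, hc, he⟩ := exists_hasDerivAt_eq_slope (fun w => psiR w * stdNormalCDF t)
    (fun w => (w * psiR w - 1) * stdNormalCDF t) hab
    (fun w _ => ((hasDerivAt_psiR w).mul_const (stdNormalCDF t)).continuousAt.continuousWithinAt)
    (fun w _ => (hasDerivAt_psiR w).mul_const (stdNormalCDF t))
  have hba : 0 < b - a := sub_pos.2 hab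
  rw [eq_div_iff hba.ne'] at he
  rw [fS_right ha, fS_right (ha.trans hab.le), ← he]
  have m1 := mul_le_mul_of_nonneg_right (mono_wpsiR hc.1.le) (cdf_nonneg' t)
  have m2 := mul_le_mul_of_nonneg_right (mono_wpsiR hc.2.le) (cdf_nonneg' t)
  simp only at m1 m2
  constructor <;> nlinarith

lemma fS_mvt (t : ℝ) {a b : ℝ} (hab : a ≤ b) :
    (b - a) * (a * fS t a + jS t b) ≤ fS t b - fS t a ∧
    fS t b - fS t a ≤ (b - a) * (b * fS t b + jS t a) := by
  by_cases hb : b ≤ t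
  · have h := fS_mvtL hab hb
    have e1 : jS t b = QQ t := by unfold jS QQ; simp [hb]
    have e2 : jS t a = QQ t := by unfold jS QQ; simp [hab.trans hb]
    rw [e1, e2]; exact h
  · push Not at hb
    have e1 : jS t b = -stdNormalCDF t := by unfold jS; simp [not_le.2 hb]
    by_cases ha : a ≤ t
    · have e2 : jS t a = QQ t := by unfold jS QQ; simp [ha]
      have h1 := fS_mvtL ha le_rfl
      have h2 := fS_mvtR hb.le le_rfl
      have m1 := hS_mono t ha
      have m2 := hS_mono t hb.le
      simp only at m1 m2
      have hq : QQ t = 1 - stdNormalCDF t := rfl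
      rw [e1, e2]
      have ta : 0 ≤ t - a := sub_nonneg.2 ha
      have tb : 0 ≤ b - t := sub_nonneg.2 hb.le
      have q1 := mul_le_mul_of_nonneg_left m1 tb
      have q2 := mul_le_mul_of_nonneg_left m2 ta
      constructor <;> nlinarith
    · push Not at ha
      have e2 : jS t a = -stdNormalCDF t := by unfold jS; simp [not_le.2 ha]
      have h := fS_mvtR hab ha.le
      rw [e1, e2]; exact h

/-- The exponential majorant. -/
noncomputable def HS (t w : ℝ) : ℝ :=
  2 + 2 * Real.sqrt (2 * Real.pi) * (1 + t) * Real.exp (t * w - t ^ 2 / 2) +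
    Real.sqrt (2 * Real.pi) * Real.exp (1 / 2) * t *
      ∑ j ∈ Finset.range (⌊t⌋₊ + 1), Real.exp (j * w - (j : ℝ) ^ 2 / 2)

lemma inv_phi (w : ℝ) : 1 / phi w = Real.sqrt (2 * Real.pi) * Real.exp (w ^ 2 / 2) := by
  unfold phi
  rw [show -w ^ 2 / 2 = -(w ^ 2 / 2) by ring, Real.exp_neg]
  field_simp

lemma hS_bound {t : ℝ} (ht : 0 ≤ t) (w : ℝ) :
    |w * fS t w| + |jS t w| ≤ QQ t * HS t w := by
  have hq := QQ_pos ht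
  have hpi := sqrt2pi_pos
  have hsum : 0 ≤ ∑ j ∈ Finset.range (⌊t⌋₊ + 1), Real.exp (j * w - (j : ℝ) ^ 2 / 2) :=
    Finset.sum_nonneg fun _ _ => (Real.exp_pos _).le
  have hA : 0 ≤ 2 * Real.sqrt (2 * Real.pi) * (1 + t) * Real.exp (t * w - t ^ 2 / 2) := by
    positivity
  have hB : 0 ≤ Real.sqrt (2 * Real.pi) * Real.exp (1 / 2) * t *
      ∑ j ∈ Finset.range (⌊t⌋₊ + 1), Real.exp (j * w - (j : ℝ) ^ 2 / 2) := by positivity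
  by_cases hwt : w ≤ t
  · have ej : |jS t w| = QQ t := by
      have : jS t w = QQ t := by unfold jS QQ; simp [hwt]
      rw [this, abs_of_pos hq]
    rw [ej, fS_left hwt]
    by_cases hw0 : w < 0
    · have h1 : |w * (psiL w * QQ t)| ≤ QQ t := by
        rw [← mul_assoc, abs_mul, abs_of_pos hq, abs_mul, abs_of_neg hw0,
          abs_of_nonneg (psiL_nonneg w)]
        have := QQ_upper (neg_pos.2 hw0)
        rw [← cdf_neg, neg_neg, phi_even] at this
        have h2 : -w * psiL w ≤ 1 := by
          unfold psiL
          rw [← mul_div_assoc, div_le_one (phi_pos w)]; exact this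
        nlinarith
      unfold HS; nlinarith
    · push Not at hw0
      have h1 : |w * (psiL w * QQ t)| ≤ QQ t * (Real.sqrt (2 * Real.pi) * Real.exp (1 / 2) * t *
          ∑ j ∈ Finset.range (⌊t⌋₊ + 1), Real.exp (j * w - (j : ℝ) ^ 2 / 2)) := by
        rw [abs_of_nonneg (mul_nonneg hw0 (mul_nonneg (psiL_nonneg w) hq.le))]
        have hpsi : psiL w ≤ Real.sqrt (2 * Real.pi) * Real.exp (w ^ 2 / 2) := by
          rw [← inv_phi]; unfold psiL
          exact div_le_div_of_nonneg_right (cdf_le_one' w) (phi_pos w).le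
        have hj : Real.exp (w ^ 2 / 2) ≤ Real.exp (1 / 2) *
            ∑ j ∈ Finset.range (⌊t⌋₊ + 1), Real.exp (j * w - (j : ℝ) ^ 2 / 2) := by
          have hmem : ⌊w⌋₊ ∈ Finset.range (⌊t⌋₊ + 1) := by
            rw [Finset.mem_range]
            have := Nat.floor_le_floor hwt
            omega
          have h2 := Finset.single_le_sum (f := fun j : ℕ => Real.exp (j * w - (j : ℝ) ^ 2 / 2))
            (fun _ _ => (Real.exp_pos _).le) hmem
          refine le_trans ?_ (mul_le_mul_of_nonneg_left h2 (Real.exp_pos _).le)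
          rw [← Real.exp_add]
          apply Real.exp_le_exp.2
          have f1 := Nat.floor_le hw0
          have f2 := Nat.lt_floor_add_one w
          nlinarith
        calc w * (psiL w * QQ t) ≤ t * ((Real.sqrt (2 * Real.pi) * (Real.exp (1 / 2) *
            ∑ j ∈ Finset.range (⌊t⌋₊ + 1), Real.exp (j * w - (j : ℝ) ^ 2 / 2))) * QQ t) := by
              apply mul_le_mul hwt _ (mul_nonneg (psiL_nonneg w) hq.le) ht
              apply mul_le_mul_of_nonneg_right _ hq.le
              exact hpsi.trans (mul_le_mul_of_nonneg_left hj hpi.le)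
          _ = _ := by ring
      unfold HS; nlinarith
  · push Not at hwt
    have ej : |jS t w| ≤ 1 := by
      have : jS t w = -stdNormalCDF t := by unfold jS; simp [not_le.2 hwt]
      rw [this, abs_neg, abs_of_nonneg (cdf_nonneg' t)]; exact cdf_le_one' t
    have hw0 : 0 < w := lt_of_le_of_lt ht hwt
    have eh : |w * fS t w| ≤ 1 := by
      rw [fS_right hwt.le, ← mul_assoc, abs_mul, abs_of_nonneg (cdf_nonneg' t),
        abs_of_nonneg (mul_nonneg hw0.le (psiR_nonneg w))]
      have h2 : w * psiR w ≤ 1 := by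
        unfold psiR
        rw [← mul_div_assoc, div_le_one (phi_pos w)]; exact QQ_upper hw0
      have := cdf_le_one' t
      have := cdf_nonneg' t
      have := mul_nonneg hw0.le (psiR_nonneg w)
      nlinarith
    have h1 : 1 ≤ QQ t * (Real.sqrt (2 * Real.pi) * (1 + t) * Real.exp (t * w - t ^ 2 / 2)) := by
      have h2 := QQ_lower2 ht
      have h3 := inv_phi t
      have h4 : 1 ≤ (1 + t) * QQ t * (Real.sqrt (2 * Real.pi) * Real.exp (t ^ 2 / 2)) := by
        rw [← h3, mul_one_div, le_div_iff₀ (phi_pos t)]; linarith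
      have h5 : Real.exp (t ^ 2 / 2) ≤ Real.exp (t * w - t ^ 2 / 2) := by
        apply Real.exp_le_exp.2; nlinarith
      calc (1:ℝ) ≤ _ := h4
        _ ≤ (1 + t) * QQ t * (Real.sqrt (2 * Real.pi) * Real.exp (t * w - t ^ 2 / 2)) := by gcongr
        _ = _ := by ring
    unfold HS; nlinarith

end Gauss
end CMD

open MeasureTheory ProbabilityTheory
open scoped Classical
set_option linter.unusedSectionVars false
set_option linter.unusedSimpArgs false
set_option linter.unusedVariables false

namespace CMD
section SteinAbstract
variable {E : Type*} [Fintype E] [DecidableEq E]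

lemma tele (Γ : Finset E) : ∃ J K : E → Finset E, (∀ k ∈ Γ, J k ∪ K k = Γ.erase k) ∧
    ∀ (p : ℝ) (S : Finset E), BB Γ S - p ^ Γ.card =
      ∑ k ∈ Γ, (BB {k} S - p) * (p ^ (J k).card * BB (K k) S) := by
  induction Γ using Finset.induction_on with
  | empty => exact ⟨fun _ => ∅, fun _ => ∅, by simp, by simp [BB]⟩
  | insert a s ha ih =>
    obtain ⟨J, K, hJK, hs⟩ := ih
    refine ⟨fun k => if k = a then s else J k, fun k => if k = a then ∅ else insert a (K k), ?_, ?_⟩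
    · intro k hk
      by_cases hka : k = a
      · subst hka; simp [ha]
      · have hks : k ∈ s := by
          rcases Finset.mem_insert.1 hk with h | h
          · exact absurd h hka
          · exact h
        simp only [hka, if_false]
        rw [Finset.union_insert, hJK k hks, Finset.erase_insert_of_ne (Ne.symm hka)]
    · intro p S
      rw [Finset.sum_insert ha]
      simp only [if_true]
      have e1 : ∑ k ∈ s, (BB {k} S - p) * (p ^ (if k = a then s else J k).card *
          BB (if k = a then ∅ else insert a (K k)) S) = BB {a} S * (BB s S - p ^ s.card) := by
        rw [hs p S, Finset.mul_sum]
        refine Finset.sum_congr rfl fun k hk => ?_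
        have hka : k ≠ a := fun h => ha (h ▸ hk)
        simp only [hka, if_false]
        rw [Finset.insert_eq, ← BB_mul]; ring
      rw [e1, Finset.card_insert_of_notMem ha, Finset.insert_eq, ← BB_mul]
      have : BB (∅ : Finset E) S = 1 := by simp [BB]
      rw [this]; ring

/-- Deterministic part of the telescoping coefficient. -/
noncomputable def Jf (Γ : Finset E) : E → Finset E := (tele Γ).choose
/-- Random part of the telescoping coefficient. -/
noncomputable def Kf (Γ : Finset E) : E → Finset E := (tele Γ).choose_spec.choose

lemma JK_union (Γ : Finset E) {k : E} (hk : k ∈ Γ) : Jf Γ k ∪ Kf Γ k = Γ.erase k :=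
  (tele Γ).choose_spec.choose_spec.1 k hk

lemma tele_eq (Γ : Finset E) (p : ℝ) (S : Finset E) : BB Γ S - p ^ Γ.card =
      ∑ k ∈ Γ, (BB {k} S - p) * (p ^ (Jf Γ k).card * BB (Kf Γ k) S) :=
  (tele Γ).choose_spec.choose_spec.2 p S

/-- Standardized count. -/
noncomputable def Wf (M : Finset (Finset E)) (p σ : ℝ) (S : Finset E) : ℝ :=
  σ⁻¹ * ∑ Γ ∈ M, (BB Γ S - p ^ Γ.card)

/-- Coefficient `R_k`. -/
noncomputable def Rf (M : Finset (Finset E)) (p σ : ℝ) (k : E) (S : Finset E) : ℝ :=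
  σ⁻¹ * ∑ Γ ∈ M with k ∈ Γ, p ^ (Jf Γ k).card * BB (Kf Γ k) S

/-- Discrete derivative `Δ_k`. -/
noncomputable def Df (M : Finset (Finset E)) (σ : ℝ) (k : E) (S : Finset E) : ℝ :=
  σ⁻¹ * ∑ Γ ∈ M with k ∈ Γ, BB (Γ.erase k) S

lemma BB_insert_erase {A : Finset E} {k : E} (h : k ∉ A) (S : Finset E) :
    BB A (insert k S) = BB A S ∧ BB A (S.erase k) = BB A S := by
  constructor
  · apply BB_dep A A subset_rfl
    ext x; simp only [Finset.mem_inter, Finset.mem_insert]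
    constructor
    · rintro ⟨rfl | h1, h2⟩
      · exact absurd h2 h
      · exact ⟨h1, h2⟩
    · tauto
  · apply BB_dep A A subset_rfl
    ext x; simp only [Finset.mem_inter, Finset.mem_erase]
    constructor
    · tauto
    · rintro ⟨h1, h2⟩
      refine ⟨⟨?_, h1⟩, h2⟩
      rintro rfl; exact h h2

lemma notMem_Kf {Γ : Finset E} {k : E} (hk : k ∈ Γ) : k ∉ Kf Γ k := fun h => by
  have : k ∈ Jf Γ k ∪ Kf Γ k := Finset.mem_union_right _ h
  rw [JK_union Γ hk] at this
  simp at this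

lemma notMem_Jf {Γ : Finset E} {k : E} (hk : k ∈ Γ) : k ∉ Jf Γ k := fun h => by
  have : k ∈ Jf Γ k ∪ Kf Γ k := Finset.mem_union_left _ h
  rw [JK_union Γ hk] at this
  simp at this

lemma Rf_inv (M : Finset (Finset E)) (p σ : ℝ) (k : E) (S : Finset E) :
    Rf M p σ k (insert k S) = Rf M p σ k S ∧ Rf M p σ k (S.erase k) = Rf M p σ k S := by
  unfold Rf
  constructor
  · congr 1
    refine Finset.sum_congr rfl fun Γ hΓ => ?_
    rw [(BB_insert_erase (notMem_Kf (Finset.mem_filter.1 hΓ).2) S).1]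
  · congr 1
    refine Finset.sum_congr rfl fun Γ hΓ => ?_
    rw [(BB_insert_erase (notMem_Kf (Finset.mem_filter.1 hΓ).2) S).2]

lemma Df_inv (M : Finset (Finset E)) (σ : ℝ) (k : E) (S : Finset E) :
    Df M σ k (insert k S) = Df M σ k S ∧ Df M σ k (S.erase k) = Df M σ k S := by
  unfold Df
  constructor
  · congr 1
    refine Finset.sum_congr rfl fun Γ hΓ => ?_
    rw [(BB_insert_erase (Finset.notMem_erase k Γ) S).1]
  · congr 1
    refine Finset.sum_congr rfl fun Γ hΓ => ?_
    rw [(BB_insert_erase (Finset.notMem_erase k Γ) S).2]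

lemma Wf_eq (M : Finset (Finset E)) (p σ : ℝ) (S : Finset E) :
    Wf M p σ S = ∑ k : E, (BB {k} S - p) * Rf M p σ k S := by
  unfold Wf Rf
  have : ∀ Γ : Finset E, BB Γ S - p ^ Γ.card = ∑ k : E, if k ∈ Γ then
      (BB {k} S - p) * (p ^ (Jf Γ k).card * BB (Kf Γ k) S) else 0 := by
    intro Γ
    rw [tele_eq, ← Finset.sum_filter]
    simp
  simp only [this]
  rw [Finset.sum_comm, Finset.mul_sum]
  refine Finset.sum_congr rfl fun k _ => ?_
  rw [← Finset.sum_filter, ← Finset.mul_sum]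
  ring

lemma Wf_diff (M : Finset (Finset E)) (p σ : ℝ) (k : E) (S : Finset E) :
    Wf M p σ (insert k S) - Wf M p σ (S.erase k) = Df M σ k S := by
  unfold Wf Df
  rw [← mul_sub, ← Finset.sum_sub_distrib, Finset.sum_filter]
  congr 1
  refine Finset.sum_congr rfl fun Γ _ => ?_
  by_cases h : k ∈ Γ
  · rw [if_pos h]
    have e1 : BB Γ (insert k S) = BB (Γ.erase k) S := by
      have : BB Γ (insert k S) = BB {k} (insert k S) * BB (Γ.erase k) (insert k S) := by
        rw [BB_mul, ← Finset.insert_eq, Finset.insert_erase h]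
      rw [this, (BB_insert_erase (Finset.notMem_erase k Γ) S).1]
      simp [BB]
    have e2 : BB Γ (S.erase k) = 0 := by
      unfold BB
      rw [if_neg]
      intro hs; have := hs h; simp at this
    rw [e1, e2]; ring
  · rw [if_neg h, (BB_insert_erase h S).1, (BB_insert_erase h S).2]; ring

lemma Rf_nonneg (M : Finset (Finset E)) {p σ : ℝ} (hp : 0 ≤ p) (hσ : 0 < σ) (k : E)
    (S : Finset E) : 0 ≤ Rf M p σ k S := by
  unfold Rf
  refine mul_nonneg (inv_pos.2 hσ).le (Finset.sum_nonneg fun Γ _ => ?_)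
  exact mul_nonneg (pow_nonneg hp _) (BB_nonneg _ _)

lemma Df_nonneg (M : Finset (Finset E)) {σ : ℝ} (hσ : 0 < σ) (k : E)
    (S : Finset E) : 0 ≤ Df M σ k S := by
  unfold Df
  exact mul_nonneg (inv_pos.2 hσ).le (Finset.sum_nonneg fun Γ _ => BB_nonneg _ _)

/-- Antisymmetric remainder. -/
noncomputable def Yf (M : Finset (Finset E)) (p σ : ℝ) (S : Finset E) : ℝ :=
  ∑ k : E, (BB {k} S - p) * (Rf M p σ k S * Df M σ k S)

/-- Total Stein kernel mass. -/
noncomputable def Zf (M : Finset (Finset E)) (p σ : ℝ) (S : Finset E) : ℝ :=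
  ∑ k : E, p * (1 - p) * (Rf M p σ k S * Df M σ k S)

lemma stein_id (M : Finset (Finset E)) (p σ : ℝ) (f : ℝ → ℝ) :
    Ex p (fun S => Wf M p σ S * f (Wf M p σ S)) =
    ∑ k : E, p * (1 - p) * Ex p (fun S => Rf M p σ k S *
      (f (Wf M p σ (insert k S)) - f (Wf M p σ (S.erase k)))) := by
  have : ∀ S, Wf M p σ S * f (Wf M p σ S) =
      ∑ k : E, (BB {k} S - p) * Rf M p σ k S * f (Wf M p σ S) := fun S => by
    conv_lhs => rw [Wf_eq M p σ S]
    rw [Finset.sum_mul, ← Wf_eq]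
  simp only [this]
  rw [Ex_sum]
  refine Finset.sum_congr rfl fun k _ => ?_
  exact Ex_ibp p k _ (fun S => f (Wf M p σ S)) (Rf_inv M p σ k)

lemma Y_id (M : Finset (Finset E)) (p σ : ℝ) (f : ℝ → ℝ) :
    Ex p (fun S => Yf M p σ S * f (Wf M p σ S)) =
    ∑ k : E, p * (1 - p) * Ex p (fun S => Rf M p σ k S * Df M σ k S *
      (f (Wf M p σ (insert k S)) - f (Wf M p σ (S.erase k)))) := by
  simp only [Yf, Finset.sum_mul]
  rw [Ex_sum]
  refine Finset.sum_congr rfl fun k _ => ?_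
  refine Ex_ibp p k _ (fun S => f (Wf M p σ S)) (fun S => ?_)
  rw [(Rf_inv M p σ k S).1, (Rf_inv M p σ k S).2, (Df_inv M σ k S).1, (Df_inv M σ k S).2]
  exact ⟨rfl, rfl⟩

lemma Z_id (M : Finset (Finset E)) (p σ : ℝ) (f : ℝ → ℝ) :
    Ex p (fun S => Zf M p σ S * f (Wf M p σ S)) =
    ∑ k : E, p * (1 - p) * Ex p (fun S => Rf M p σ k S * Df M σ k S *
      (p * f (Wf M p σ (insert k S)) + (1 - p) * f (Wf M p σ (S.erase k)))) := by
  simp only [Zf, Finset.sum_mul]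
  rw [Ex_sum]
  refine Finset.sum_congr rfl fun k _ => ?_
  rw [← Ex_mul, Ex_step p _ k]
  congr 1
  ext S
  rw [(Rf_inv M p σ k S).1, (Rf_inv M p σ k S).2, (Df_inv M σ k S).1, (Df_inv M σ k S).2]
  ring

lemma stein_upper (M : Finset (Finset E)) {p σ : ℝ} (hp : 0 < p) (hp1 : p < 1) (hσ : 0 < σ)
    (f h j : ℝ → ℝ) (hh : Monotone h) (hj : Antitone j)
    (hf : ∀ a b, a ≤ b → f b - f a ≤ (b - a) * (h b + j a)) :
    Ex p (fun S => Wf M p σ S * f (Wf M p σ S)) ≤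
      Ex p (fun S => Zf M p σ S * (h (Wf M p σ S) + j (Wf M p σ S))) +
      Ex p (fun S => Yf M p σ S * (h (Wf M p σ S) - j (Wf M p σ S))) := by
  rw [stein_id, Z_id M p σ (fun w => h w + j w), Y_id M p σ (fun w => h w - j w),
    ← Finset.sum_add_distrib]
  refine Finset.sum_le_sum fun k _ => ?_
  rw [← mul_add, ← Ex_add]
  refine mul_le_mul_of_nonneg_left (Ex_mono hp.le hp1.le fun S => ?_)
    (mul_nonneg hp.le (by linarith))
  have hR := Rf_nonneg M hp.le hσ k S
  have hD := Df_nonneg M hσ k S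
  have hd := Wf_diff M p σ k S
  have hle : Wf M p σ (S.erase k) ≤ Wf M p σ (insert k S) := by linarith
  have h1 := hf _ _ hle
  have h2 := hh hle
  have h3 := hj hle
  rw [hd] at h1
  generalize Wf M p σ (insert k S) = a at *
  generalize Wf M p σ (S.erase k) = b at *
  rw [mul_assoc, mul_assoc, ← mul_add, ← mul_add]
  refine mul_le_mul_of_nonneg_left (h1.trans (mul_le_mul_of_nonneg_left ?_ hD)) hR
  nlinarith

lemma stein_lower (M : Finset (Finset E)) {p σ : ℝ} (hp : 0 < p) (hp1 : p < 1) (hσ : 0 < σ)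
    (f h j : ℝ → ℝ) (hh : Monotone h) (hj : Antitone j)
    (hf : ∀ a b, a ≤ b → (b - a) * (h a + j b) ≤ f b - f a) :
      Ex p (fun S => Zf M p σ S * (h (Wf M p σ S) + j (Wf M p σ S))) -
      Ex p (fun S => Yf M p σ S * (h (Wf M p σ S) - j (Wf M p σ S))) ≤
    Ex p (fun S => Wf M p σ S * f (Wf M p σ S)) := by
  rw [stein_id, Z_id M p σ (fun w => h w + j w), Y_id M p σ (fun w => h w - j w),
    ← Finset.sum_sub_distrib]
  refine Finset.sum_le_sum fun k _ => ?_
  rw [← mul_sub, ← Ex_sub]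
  refine mul_le_mul_of_nonneg_left (Ex_mono hp.le hp1.le fun S => ?_)
    (mul_nonneg hp.le (by linarith))
  have hR := Rf_nonneg M hp.le hσ k S
  have hD := Df_nonneg M hσ k S
  have hd := Wf_diff M p σ k S
  have hle : Wf M p σ (S.erase k) ≤ Wf M p σ (insert k S) := by linarith
  have h1 := hf _ _ hle
  have h2 := hh hle
  have h3 := hj hle
  rw [hd] at h1
  generalize Wf M p σ (insert k S) = a at *
  generalize Wf M p σ (S.erase k) = b at *
  rw [mul_assoc, mul_assoc, ← mul_sub, ← mul_sub]
  refine mul_le_mul_of_nonneg_left ((mul_le_mul_of_nonneg_left ?_ hD).trans h1) hR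
  nlinarith

/-- Moment generating function. -/
noncomputable def Mg (M : Finset (Finset E)) (p σ u : ℝ) : ℝ :=
  Ex p (fun S => Real.exp (u * Wf M p σ S))

lemma Mg_pos (M : Finset (Finset E)) {p : ℝ} (σ u : ℝ) (hp : 0 < p) (hp1 : p < 1) :
    0 < Mg M p σ u := by
  unfold Mg Ex
  have : 0 < 1 - p := by linarith
  refine Finset.sum_pos (fun S _ => by positivity) ⟨∅, Finset.mem_univ _⟩

lemma Mg_deriv (M : Finset (Finset E)) (p σ u : ℝ) :
    HasDerivAt (Mg M p σ) (Ex p (fun S => Wf M p σ S * Real.exp (u * Wf M p σ S))) u := by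
  unfold Mg Ex
  apply HasDerivAt.fun_sum
  intro S _
  have h := ((hasDerivAt_id u).mul_const (Wf M p σ S)).exp.const_mul
    (p ^ S.card * (1 - p) ^ (Sᶜ.card))
  refine HasDerivAt.congr_deriv h ?_
  simp only [id]; ring

lemma Mg_deriv_le (M : Finset (Finset E)) {p σ u θ : ℝ} (hp : 0 < p) (hp1 : p < 1) (hσ : 0 < σ)
    (hu : 0 ≤ u)
    (hθ : Ex p (fun S => (|Yf M p σ S| + |Zf M p σ S - 1|) * Real.exp (u * Wf M p σ S)) ≤
      θ * Mg M p σ u) :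
    Ex p (fun S => Wf M p σ S * Real.exp (u * Wf M p σ S)) ≤ u * (1 + θ) * Mg M p σ u := by
  have h := stein_upper M hp hp1 hσ (fun w => Real.exp (u * w)) (fun w => u * Real.exp (u * w))
    (fun _ => 0) (fun a b hab => mul_le_mul_of_nonneg_left
      (Real.exp_le_exp.2 (mul_le_mul_of_nonneg_left hab hu)) hu) (fun _ _ _ => le_rfl)
    (by
      intro a b hab
      have h1 := Real.add_one_le_exp (u * a - u * b)
      have h2 : Real.exp (u * a) = Real.exp (u * b) * Real.exp (u * a - u * b) := by
        rw [← Real.exp_add]; ring_nf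
      have h3 := Real.exp_pos (u * b)
      rw [h2]
      nlinarith)
  refine h.trans ?_
  rw [← Ex_add]
  have h2 : Ex p (fun S => Zf M p σ S * (u * Real.exp (u * Wf M p σ S) + 0) +
      Yf M p σ S * (u * Real.exp (u * Wf M p σ S) - 0)) ≤
      Ex p (fun S => u * (Real.exp (u * Wf M p σ S) +
        (|Yf M p σ S| + |Zf M p σ S - 1|) * Real.exp (u * Wf M p σ S))) := by
    apply Ex_mono hp.le hp1.le
    intro S
    have e := Real.exp_pos (u * Wf M p σ S)
    have a1 := le_abs_self (Yf M p σ S)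
    have a2 := le_abs_self (Zf M p σ S - 1)
    have : Zf M p σ S * (u * Real.exp (u * Wf M p σ S) + 0) +
      Yf M p σ S * (u * Real.exp (u * Wf M p σ S) - 0) =
      u * ((1 + (Yf M p σ S + (Zf M p σ S - 1))) * Real.exp (u * Wf M p σ S)) := by ring
    rw [this]
    refine mul_le_mul_of_nonneg_left ?_ hu
    rw [show Real.exp (u * Wf M p σ S) + (|Yf M p σ S| + |Zf M p σ S - 1|) * Real.exp (u * Wf M p σ S)
      = (1 + (|Yf M p σ S| + |Zf M p σ S - 1|)) * Real.exp (u * Wf M p σ S) by ring]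
    refine mul_le_mul_of_nonneg_right ?_ e.le
    linarith
  refine h2.trans ?_
  rw [Ex_mul, Ex_add]
  have : Ex p (fun S => Real.exp (u * Wf M p σ S)) = Mg M p σ u := rfl
  rw [this]
  rw [mul_assoc]
  refine mul_le_mul_of_nonneg_left ?_ hu
  linarith

lemma Mg_bound (M : Finset (Finset E)) {p σ t θ : ℝ} (hp : 0 < p) (hp1 : p < 1) (hσ : 0 < σ)
    (hθ : ∀ u, 0 ≤ u → u ≤ t →
      Ex p (fun S => (|Yf M p σ S| + |Zf M p σ S - 1|) * Real.exp (u * Wf M p σ S)) ≤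
      θ * Mg M p σ u) {u : ℝ} (hu : 0 ≤ u) (hut : u ≤ t) :
    Mg M p σ u ≤ Real.exp ((1 + θ) * u ^ 2 / 2) := by
  have hd : ∀ x, HasDerivAt (fun x => Mg M p σ x * Real.exp (-((1 + θ) * x ^ 2 / 2)))
      (Ex p (fun S => Wf M p σ S * Real.exp (x * Wf M p σ S)) * Real.exp (-((1 + θ) * x ^ 2 / 2)) +
        Mg M p σ x * (Real.exp (-((1 + θ) * x ^ 2 / 2)) * (-((1 + θ) * x)))) x := by
    intro x
    refine (Mg_deriv M p σ x).mul ?_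
    apply HasDerivAt.exp
    have := (((hasDerivAt_pow 2 x).const_mul (1 + θ)).div_const 2).neg
    refine HasDerivAt.congr_deriv this ?_
    simp
    ring
  have hanti : AntitoneOn (fun x => Mg M p σ x * Real.exp (-((1 + θ) * x ^ 2 / 2)))
      (Set.Icc 0 t) := by
    apply antitoneOn_of_deriv_nonpos (convex_Icc 0 t)
    · intro x _; exact (hd x).continuousAt.continuousWithinAt
    · intro x _; exact (hd x).differentiableAt.differentiableWithinAt
    · intro x hx
      rw [interior_Icc] at hx
      rw [(hd x).deriv]
      have h1 := Mg_deriv_le M hp hp1 hσ hx.1.le (hθ x hx.1.le hx.2.le)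
      have e := Real.exp_pos (-((1 + θ) * x ^ 2 / 2))
      nlinarith
  have h := hanti (Set.mem_Icc.2 ⟨le_rfl, hu.trans hut⟩) (Set.mem_Icc.2 ⟨hu, hut⟩) hu
  simp only at h
  have h0 : Mg M p σ 0 = 1 := by unfold Mg; simp [Ex_const]
  rw [h0, Real.exp_neg] at h
  simp at h
  rw [← div_eq_mul_inv, div_le_one (Real.exp_pos _)] at h
  exact h

theorem cmd_abstract (M : Finset (Finset E)) {p σ t θ : ℝ} (hp : 0 < p) (hp1 : p < 1) (hσ : 0 < σ)
    (ht : 0 ≤ t) (hθ0 : 0 ≤ θ)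
    (hθ : ∀ u, 0 ≤ u → u ≤ t →
      Ex p (fun S => (|Yf M p σ S| + |Zf M p σ S - 1|) * Real.exp (u * Wf M p σ S)) ≤
      θ * Mg M p σ u) :
    |Ex p (fun S => if Wf M p σ S ≤ t then 1 else 0) - stdNormalCDF t| ≤
      QQ t * (θ * Real.exp (t ^ 2 * θ / 2) * (2 + 2 * Real.sqrt (2 * Real.pi) * (1 + t) +
        Real.sqrt (2 * Real.pi) * Real.exp (1 / 2) * t * (t + 1))) := by
  set W := Wf M p σ with hW
  set Y := Yf M p σ with hY
  set Z := Zf M p σ with hZ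
  have hup := stein_upper M hp hp1 hσ (fS t) (fun w => w * fS t w) (jS t) (hS_mono t) (jS_anti t)
    (fun a b hab => (fS_mvt t hab).2)
  have hlo := stein_lower M hp hp1 hσ (fS t) (fun w => w * fS t w) (jS t) (hS_mono t) (jS_anti t)
    (fun a b hab => (fS_mvt t hab).1)
  simp only [← hW, ← hY, ← hZ] at hup hlo
  have e1 : Ex p (fun S => if W S ≤ t then 1 else 0) - stdNormalCDF t =
      Ex p (fun S => W S * fS t (W S) + jS t (W S)) - Ex p (fun S => W S * fS t (W S)) := by
    rw [← Ex_sub]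
    conv_lhs => rw [← Ex_const (E := E) p (stdNormalCDF t), ← Ex_sub]
    congr 1; ext S; unfold jS; ring
  have e2 : Ex p (fun S => Z S * (W S * fS t (W S) + jS t (W S))) =
      Ex p (fun S => W S * fS t (W S) + jS t (W S)) +
      Ex p (fun S => (Z S - 1) * (W S * fS t (W S) + jS t (W S))) := by
    rw [← Ex_add]; congr 1; ext S; ring
  have b1 : |Ex p (fun S => if W S ≤ t then 1 else 0) - stdNormalCDF t| ≤
      |Ex p (fun S => (Z S - 1) * (W S * fS t (W S) + jS t (W S)))| +
      |Ex p (fun S => Y S * (W S * fS t (W S) - jS t (W S)))| := by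
    rw [e1]
    have x1 := abs_le.1 (le_refl |Ex p (fun S => (Z S - 1) * (W S * fS t (W S) + jS t (W S)))|)
    have x2 := abs_le.1 (le_refl |Ex p (fun S => Y S * (W S * fS t (W S) - jS t (W S)))|)
    rw [abs_le]
    constructor <;> linarith [x1.1, x1.2, x2.1, x2.2]
  refine b1.trans ?_
  refine (add_le_add (Ex_abs_le hp.le hp1.le _) (Ex_abs_le hp.le hp1.le _)).trans ?_
  rw [← Ex_add]
  have b2 : Ex p (fun S => |(Z S - 1) * (W S * fS t (W S) + jS t (W S))| +
      |Y S * (W S * fS t (W S) - jS t (W S))|) ≤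
      Ex p (fun S => QQ t * ((|Y S| + |Z S - 1|) * HS t (W S))) := by
    apply Ex_mono hp.le hp1.le
    intro S
    have hb := hS_bound ht (W S)
    have y1 : |W S * fS t (W S) + jS t (W S)| ≤ QQ t * HS t (W S) := (abs_add_le _ _).trans hb
    have y2 : |W S * fS t (W S) - jS t (W S)| ≤ QQ t * HS t (W S) := (abs_sub _ _).trans hb
    rw [abs_mul, abs_mul]
    have := mul_le_mul_of_nonneg_left y1 (abs_nonneg (Z S - 1))
    have := mul_le_mul_of_nonneg_left y2 (abs_nonneg (Y S))
    linarith
  refine b2.trans ?_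
  rw [Ex_mul]
  refine mul_le_mul_of_nonneg_left ?_ (QQ_nonneg t)
  have b3 : ∀ u, 0 ≤ u → u ≤ t → Ex p (fun S => (|Y S| + |Z S - 1|) *
      Real.exp (u * W S - u ^ 2 / 2)) ≤ θ * Real.exp (t ^ 2 * θ / 2) := by
    intro u hu hut
    have h1 := hθ u hu hut
    have h2 := Mg_bound M hp hp1 hσ hθ hu hut
    have e : Ex p (fun S => (|Y S| + |Z S - 1|) * Real.exp (u * W S - u ^ 2 / 2)) =
      Real.exp (-(u ^ 2 / 2)) * Ex p (fun S => (|Y S| + |Z S - 1|) * Real.exp (u * W S)) := by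
      rw [← Ex_mul]; congr 1; ext S
      rw [show u * W S - u ^ 2 / 2 = u * W S + -(u ^ 2 / 2) by ring, Real.exp_add]; ring
    rw [e]
    have h3 := h1.trans (mul_le_mul_of_nonneg_left h2 hθ0)
    refine (mul_le_mul_of_nonneg_left h3 (Real.exp_pos _).le).trans ?_
    rw [mul_left_comm, ← Real.exp_add]
    refine mul_le_mul_of_nonneg_left (Real.exp_le_exp.2 ?_) hθ0
    have : u ^ 2 ≤ t ^ 2 := by gcongr
    nlinarith
  have e3 : Ex p (fun S => (|Y S| + |Z S - 1|) * HS t (W S)) =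
      2 * Ex p (fun S => (|Y S| + |Z S - 1|) * Real.exp (0 * W S - 0 ^ 2 / 2)) +
      2 * Real.sqrt (2 * Real.pi) * (1 + t) *
        Ex p (fun S => (|Y S| + |Z S - 1|) * Real.exp (t * W S - t ^ 2 / 2)) +
      Real.sqrt (2 * Real.pi) * Real.exp (1 / 2) * t *
        ∑ j ∈ Finset.range (⌊t⌋₊ + 1),
          Ex p (fun S => (|Y S| + |Z S - 1|) * Real.exp ((j : ℝ) * W S - (j : ℝ) ^ 2 / 2)) := by
    rw [← Ex_sum, ← Ex_mul, ← Ex_mul, ← Ex_mul, ← Ex_add, ← Ex_add]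
    congr 1; ext S
    unfold HS
    rw [← Finset.mul_sum]
    simp
    ring
  rw [e3]
  have s1 : ∑ j ∈ Finset.range (⌊t⌋₊ + 1),
      Ex p (fun S => (|Y S| + |Z S - 1|) * Real.exp ((j : ℝ) * W S - (j : ℝ) ^ 2 / 2)) ≤
      (t + 1) * (θ * Real.exp (t ^ 2 * θ / 2)) := by
    have : ∀ j ∈ Finset.range (⌊t⌋₊ + 1),
      Ex p (fun S => (|Y S| + |Z S - 1|) * Real.exp ((j : ℝ) * W S - (j : ℝ) ^ 2 / 2)) ≤
        θ * Real.exp (t ^ 2 * θ / 2) := by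
      intro j hj
      apply b3 _ (Nat.cast_nonneg j)
      rw [Finset.mem_range] at hj
      exact (Nat.le_floor_iff ht).1 (by omega)
    refine (Finset.sum_le_sum this).trans ?_
    rw [Finset.sum_const, nsmul_eq_mul, Finset.card_range]
    refine mul_le_mul_of_nonneg_right ?_ (by positivity)
    push_cast
    linarith [Nat.floor_le ht]
  have c0 := b3 0 le_rfl ht
  have c1 := b3 t ht le_rfl
  have n1 : 0 ≤ 2 * Real.sqrt (2 * Real.pi) * (1 + t) := by positivity
  have n2 : 0 ≤ Real.sqrt (2 * Real.pi) * Real.exp (1 / 2) * t := by positivity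
  have d1 := mul_le_mul_of_nonneg_left c1 n1
  have d2 := mul_le_mul_of_nonneg_left s1 n2
  calc _ ≤ 2 * (θ * Real.exp (t ^ 2 * θ / 2)) + 2 * Real.sqrt (2 * Real.pi) * (1 + t) *
        (θ * Real.exp (t ^ 2 * θ / 2)) + Real.sqrt (2 * Real.pi) * Real.exp (1 / 2) * t *
        ((t + 1) * (θ * Real.exp (t ^ 2 * θ / 2))) := by linarith
    _ = _ := by ring

end SteinAbstract
end CMD

open MeasureTheory ProbabilityTheory
open scoped Classical
set_option linter.unusedSectionVars false
set_option linter.unusedSimpArgs false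
set_option linter.unusedVariables false

namespace CMD
section Tilt
variable {E : Type*} [Fintype E] [DecidableEq E]

/-- Members of `M` meeting `s`. -/
noncomputable def near (M : Finset (Finset E)) (s : Finset E) : Finset (Finset E) :=
  M.filter (fun γ => (γ ∩ s).Nonempty)

lemma near_union_card (M : Finset (Finset E)) (s t : Finset E) :
    (near M (s ∪ t)).card ≤ (near M s).card + (near M t).card := by
  refine le_trans (Finset.card_le_card ?_) (Finset.card_union_le _ _)
  intro γ hγ
  simp only [near, Finset.mem_filter, Finset.mem_union] at hγ ⊢
  obtain ⟨h1, x, hx⟩ := hγ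
  simp only [Finset.mem_inter, Finset.mem_union] at hx
  rcases hx.2 with h | h
  · exact Or.inl ⟨h1, x, by simp [hx.1, h]⟩
  · exact Or.inr ⟨h1, x, by simp [hx.1, h]⟩

lemma BB_sdiff_disj {γ s : Finset E} (h : ¬ (γ ∩ s).Nonempty) (S : Finset E) :
    BB γ (S \ s) = BB γ S := by
  apply BB_dep γ γ subset_rfl
  ext x
  simp only [Finset.mem_inter, Finset.mem_sdiff]
  constructor
  · rintro ⟨⟨h1, _⟩, h2⟩; exact ⟨h1, h2⟩
  · rintro ⟨h1, h2⟩
    exact ⟨⟨h1, fun h3 => h ⟨x, by simp [h2, h3]⟩⟩, h2⟩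

lemma BB_sdiff_meet {γ s : Finset E} (h : (γ ∩ s).Nonempty) (S : Finset E) :
    BB γ (S \ s) = 0 := by
  unfold BB
  rw [if_neg]
  intro h2
  obtain ⟨x, hx⟩ := h
  simp only [Finset.mem_inter] at hx
  have := h2 hx.1
  simp [hx.2] at this

lemma Wf_sdiff (M : Finset (Finset E)) (p σ : ℝ) (s S : Finset E) :
    Wf M p σ S - Wf M p σ (S \ s) = σ⁻¹ * ∑ γ ∈ near M s, BB γ S := by
  unfold Wf near
  rw [← mul_sub, ← Finset.sum_sub_distrib, Finset.sum_filter]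
  congr 1
  apply Finset.sum_congr rfl
  intro γ _
  split_ifs with h
  · rw [BB_sdiff_meet h]; ring
  · rw [BB_sdiff_disj h]; ring

lemma Wf_sdiff_le (M : Finset (Finset E)) {p σ : ℝ} (hσ : 0 < σ) (s S : Finset E) :
    Wf M p σ (S \ s) ≤ Wf M p σ S := by
  have h := Wf_sdiff M p σ s S
  have : 0 ≤ σ⁻¹ * ∑ γ ∈ near M s, BB γ S :=
    mul_nonneg (inv_pos.2 hσ).le (Finset.sum_nonneg fun _ _ => BB_nonneg _ _)
  linarith

lemma Wf_sdiff_ge (M : Finset (Finset E)) {p σ : ℝ} (hσ : 0 < σ) (s S : Finset E) {N : ℝ}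
    (hN : ((near M s).card : ℝ) ≤ N) :
    Wf M p σ S ≤ Wf M p σ (S \ s) + N / σ := by
  have h := Wf_sdiff M p σ s S
  have h2 : ∑ γ ∈ near M s, BB γ S ≤ N := by
    refine le_trans (Finset.sum_le_sum fun γ _ => BB_le_one γ S) ?_
    simpa using hN
  have := mul_le_mul_of_nonneg_left h2 (inv_pos.2 hσ).le
  rw [div_eq_inv_mul]
  linarith

lemma tilt (M : Finset (Finset E)) {p σ u : ℝ} (hp : 0 < p) (hp1 : p < 1) (hσ : 0 < σ)
    (hu : 0 ≤ u) (s : Finset E) {D : ℝ} (j : ℕ) (hN : ((near M s).card : ℝ) ≤ j * D)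
    (F G : Finset E → ℝ) (hF0 : ∀ S, 0 ≤ F S) (hG0 : ∀ S, 0 ≤ G S)
    (hF : ∀ S T, S ∩ s = T ∩ s → F S = F T) :
    Ex p (fun S => F S * G (S \ s) * Real.exp (u * Wf M p σ S)) ≤
      Real.exp (u * D / σ) ^ j * Ex p F * Ex p (fun S => G (S \ s) * Real.exp (u * Wf M p σ S)) := by
  have h1 : Ex p (fun S => F S * G (S \ s) * Real.exp (u * Wf M p σ S)) ≤
      Ex p (fun S => Real.exp (u * D / σ) ^ j *
        (F S * (G (S \ s) * Real.exp (u * Wf M p σ (S \ s))))) := by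
    apply Ex_mono hp.le hp1.le
    intro S
    have h2 := mul_le_mul_of_nonneg_left (Wf_sdiff_ge M (p := p) hσ s S hN) hu
    have h3 : Real.exp (u * Wf M p σ S) ≤ Real.exp (u * D / σ) ^ j *
        Real.exp (u * Wf M p σ (S \ s)) := by
      rw [← Real.exp_nat_mul, ← Real.exp_add]
      apply Real.exp_le_exp.2
      refine h2.trans (le_of_eq ?_)
      ring
    have := mul_le_mul_of_nonneg_left h3 (mul_nonneg (hF0 S) (hG0 (S \ s)))
    linarith
  refine h1.trans ?_
  rw [Ex_mul, Ex_indep p s F (fun S => G (S \ s) * Real.exp (u * Wf M p σ (S \ s))) hF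
    (by intro S T h; simp only [h]), mul_assoc]
  refine mul_le_mul_of_nonneg_left (mul_le_mul_of_nonneg_left ?_ ?_) (by positivity)
  · apply Ex_mono hp.le hp1.le
    intro S
    refine mul_le_mul_of_nonneg_left (Real.exp_le_exp.2 ?_) (hG0 _)
    exact mul_le_mul_of_nonneg_left (Wf_sdiff_le M hσ s S) hu
  · exact Ex_nonneg hp.le hp1.le hF0

lemma tilt1 (M : Finset (Finset E)) {p σ u : ℝ} (hp : 0 < p) (hp1 : p < 1) (hσ : 0 < σ)
    (hu : 0 ≤ u) (s : Finset E) {D : ℝ} (hD : 0 ≤ D) (j : ℕ) (hj : j ≤ 5)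
    (hN : ((near M s).card : ℝ) ≤ j * D)
    (F : Finset E → ℝ) (hF0 : ∀ S, 0 ≤ F S)
    (hF : ∀ S T, S ∩ s = T ∩ s → F S = F T) :
    Ex p (fun S => F S * Real.exp (u * Wf M p σ S)) ≤
      Real.exp (u * D / σ) ^ j * Ex p F * Mg M p σ u := by
  have := tilt M hp hp1 hσ hu s j hN F (fun _ => 1) hF0 (fun _ => zero_le_one) hF
  simpa [Mg] using this

end Tilt
end CMD

open MeasureTheory ProbabilityTheory
open scoped Classical
set_option linter.unusedSectionVars false
set_option linter.unusedSimpArgs false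
set_option linter.unusedVariables false

namespace CMD
section Tilt2
variable {E : Type*} [Fintype E] [DecidableEq E] {ι : Type*}

/-- A family of centred local functions. -/
structure Fam (M : Finset (Finset E)) (p D : ℝ) (I : Finset ι) (s : ι → Finset E)
    (U V : ι → Finset E → ℝ) : Prop where
  D0 : 0 ≤ D
  nearM : ∀ γ ∈ M, ((near M γ).card : ℝ) ≤ D
  nearS : ∀ α ∈ I, ((near M (s α)).card : ℝ) ≤ 2 * D
  U0 : ∀ α ∈ I, Ex p (U α) = 0
  Ud : ∀ α ∈ I, ∀ S T, S ∩ s α = T ∩ s α → U α S = U α T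
  Vd : ∀ α ∈ I, ∀ S T, S ∩ s α = T ∩ s α → V α S = V α T
  V0 : ∀ α ∈ I, ∀ S, 0 ≤ V α S
  Vm : ∀ α ∈ I, ∀ S T, T ⊆ S → V α T ≤ V α S
  UV : ∀ α ∈ I, ∀ S T, T ⊆ S → |U α S - U α T| ≤ V α S

/-- Indices whose support meets `t`. -/
noncomputable def nb (I : Finset ι) (s : ι → Finset E) (t : Finset E) : Finset ι :=
  I.filter (fun β => (s β ∩ t).Nonempty)

lemma inter_mono_eq {A C S T : Finset E} (h : A ⊆ C) (hST : S ∩ C = T ∩ C) :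
    S ∩ A = T ∩ A := by
  ext x
  have := Finset.ext_iff.1 hST x
  simp only [Finset.mem_inter] at this ⊢
  constructor
  · rintro ⟨h1, h2⟩; exact ⟨(this.1 ⟨h1, h h2⟩).1, h2⟩
  · rintro ⟨h1, h2⟩; exact ⟨(this.2 ⟨h1, h h2⟩).1, h2⟩

variable {M : Finset (Finset E)} {p D : ℝ} {I : Finset ι} {s : ι → Finset E}
    {U V : ι → Finset E → ℝ}

lemma Fam.diff (h : Fam M p D I s U V) (t S : Finset E) :
    |∑ β ∈ I, U β S - ∑ β ∈ I, U β (S \ t)| ≤ ∑ β ∈ nb I s t, V β S := by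
  rw [← Finset.sum_sub_distrib]
  refine (Finset.abs_sum_le_sum_abs _ _).trans ?_
  unfold nb
  rw [Finset.sum_filter]
  refine Finset.sum_le_sum fun β hβ => ?_
  split_ifs with h1
  · exact h.UV β hβ S (S \ t) Finset.sdiff_subset
  · rw [h.Ud β hβ S (S \ t), sub_self, abs_zero]
    ext x
    simp only [Finset.mem_inter, Finset.mem_sdiff]
    constructor
    · rintro ⟨h2, h3⟩; exact ⟨⟨h2, fun h4 => h1 ⟨x, by simp [h3, h4]⟩⟩, h3⟩
    · rintro ⟨⟨h2, _⟩, h3⟩; exact ⟨h2, h3⟩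

lemma nearU (h : Fam M p D I s U V) {α : ι} (hα : α ∈ I) {γ : Finset E} (hγ : γ ∈ M) :
    ((near M (s α ∪ γ)).card : ℝ) ≤ 3 * D := by
  have h1 := h.nearS α hα
  have h2 := h.nearM γ hγ
  have h3 : ((near M (s α ∪ γ)).card : ℝ) ≤ (near M (s α)).card + (near M γ).card := by
    exact_mod_cast near_union_card M (s α) γ
  linarith

lemma nearUU (h : Fam M p D I s U V) {α β : ι} (hα : α ∈ I) (hβ : β ∈ I) :
    ((near M (s α ∪ s β)).card : ℝ) ≤ 4 * D := by
  have h1 := h.nearS α hα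
  have h2 := h.nearS β hβ
  have h3 : ((near M (s α ∪ s β)).card : ℝ) ≤ (near M (s α)).card + (near M (s β)).card := by
    exact_mod_cast near_union_card M (s α) (s β)
  linarith

lemma nearUUU (h : Fam M p D I s U V) {α β : ι} (hα : α ∈ I) (hβ : β ∈ I) {γ : Finset E}
    (hγ : γ ∈ M) :
    ((near M (s α ∪ γ ∪ s β)).card : ℝ) ≤ 5 * D := by
  have h1 := nearU h hα hγ
  have h2 := h.nearS β hβ
  have h3 : ((near M (s α ∪ γ ∪ s β)).card : ℝ) ≤ (near M (s α ∪ γ)).card + (near M (s β)).card := by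
    exact_mod_cast near_union_card M (s α ∪ γ) (s β)
  linarith

lemma fam_third (h : Fam M p D I s U V) {σ u : ℝ} {α : ι} (hα : α ∈ I) (G : Finset E → ℝ) :
    Ex p (fun S => U α S * G (S \ s α)) = 0 := by
  rw [Ex_indep p (s α) (U α) (fun S => G (S \ s α)) (h.Ud α hα) (by intro S T h; simp only [h]),
    h.U0 α hα, zero_mul]

lemma one_le_r {u σ : ℝ} (hu : 0 ≤ u) (hσ : 0 < σ) (hD : 0 ≤ D) : 1 ≤ Real.exp (u * D / σ) := by
  apply Real.one_le_exp; positivity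

lemma Mg_nonneg' (M : Finset (Finset E)) {p : ℝ} (σ u : ℝ) (hp : 0 < p) (hp1 : p < 1) :
    0 ≤ Mg M p σ u := (Mg_pos M σ u hp hp1).le

/-- first piece -/
lemma fam_first (h : Fam M p D I s U V) {σ u : ℝ} (hp : 0 < p) (hp1 : p < 1) (hσ : 0 < σ)
    (hu : 0 ≤ u) {α : ι} (hα : α ∈ I) :
    Ex p (fun S => U α S * (∑ β ∈ I, U β S - ∑ β ∈ I, U β (S \ s α)) *
      Real.exp (u * Wf M p σ S)) ≤
    Real.exp (u * D / σ) ^ 5 * ((∑ β ∈ nb I s (s α), Ex p (fun S => |U α S| * V β S)) *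
      Mg M p σ u) := by
  have h1 : Ex p (fun S => U α S * (∑ β ∈ I, U β S - ∑ β ∈ I, U β (S \ s α)) *
      Real.exp (u * Wf M p σ S)) ≤
      Ex p (fun S => ∑ β ∈ nb I s (s α), |U α S| * V β S * Real.exp (u * Wf M p σ S)) := by
    apply Ex_mono hp.le hp1.le
    intro S
    rw [← Finset.sum_mul, ← Finset.mul_sum]
    refine mul_le_mul_of_nonneg_right ?_ (Real.exp_pos _).le
    refine (le_abs_self _).trans ?_
    rw [abs_mul]
    exact mul_le_mul_of_nonneg_left (h.diff _ _) (abs_nonneg _)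
  refine h1.trans ?_
  rw [Ex_sum, Finset.sum_mul, Finset.mul_sum]
  refine Finset.sum_le_sum fun β hβ => ?_
  have hβI : β ∈ I := (Finset.mem_filter.1 hβ).1
  have h2 := tilt1 M hp hp1 hσ hu (s α ∪ s β) h.D0 4 (by norm_num)
    (by push_cast; exact nearUU h hα hβI)
    (fun S => |U α S| * V β S) (fun S => mul_nonneg (abs_nonneg _) (h.V0 β hβI S))
    (fun S T hST => by
      rw [h.Ud α hα S T (inter_mono_eq Finset.subset_union_left hST),
        h.Vd β hβI S T (inter_mono_eq Finset.subset_union_right hST)])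
  refine h2.trans ?_
  rw [mul_assoc]
  refine mul_le_mul_of_nonneg_right (pow_le_pow_right₀ (one_le_r hu hσ h.D0) (by norm_num)) ?_
  refine mul_nonneg (Ex_nonneg hp.le hp1.le fun S => mul_nonneg (abs_nonneg _) (h.V0 β hβI S))
    (Mg_nonneg' M σ u hp hp1)

/-- coefficient A5 for fixed α, γ -/
noncomputable def a5 (p : ℝ) (I : Finset ι) (s : ι → Finset E) (U V : ι → Finset E → ℝ)
    (α : ι) (γ : Finset E) : ℝ :=
  ∑ β ∈ nb I s (s α ∪ γ), (Ex p (fun S => |U α S| * BB γ S * V β S) +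
    Ex p (fun S => |U α S| * BB γ S) * Ex p (V β))

lemma fam_pair (h : Fam M p D I s U V) {σ u : ℝ} (hp : 0 < p) (hp1 : p < 1) (hσ : 0 < σ)
    (hu : 0 ≤ u) {α : ι} (hα : α ∈ I) {γ : Finset E} (hγ : γ ∈ M) :
    Ex p (fun S => |U α S| * BB γ S * |∑ β ∈ I, U β (S \ s α)| * Real.exp (u * Wf M p σ S)) ≤
    Real.exp (u * D / σ) ^ 5 * (Ex p (fun S => |U α S| * BB γ S) *
        Ex p (fun S => |∑ β ∈ I, U β S| * Real.exp (u * Wf M p σ S)) +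
      a5 p I s U V α γ * Mg M p σ u) := by
  set r := Real.exp (u * D / σ) with hr
  have hr1 : 1 ≤ r := one_le_r hu hσ h.D0
  have hMg := Mg_nonneg' M σ u hp hp1
  set t := s α ∪ γ with ht
  set N := nb I s t with hN
  have hNI : ∀ β ∈ N, β ∈ I := fun β hβ => (Finset.mem_filter.1 hβ).1
  set X := Ex p (fun S => |∑ β ∈ I, U β S| * Real.exp (u * Wf M p σ S)) with hX
  set a := Ex p (fun S => |U α S| * BB γ S) with ha
  have ha0 : 0 ≤ a := Ex_nonneg hp.le hp1.le fun S => mul_nonneg (abs_nonneg _) (BB_nonneg _ _)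
  have hX0 : 0 ≤ X := Ex_nonneg hp.le hp1.le fun S => mul_nonneg (abs_nonneg _) (Real.exp_pos _).le
  -- pointwise split
  have h1 : Ex p (fun S => |U α S| * BB γ S * |∑ β ∈ I, U β (S \ s α)| *
      Real.exp (u * Wf M p σ S)) ≤
      Ex p (fun S => |U α S| * BB γ S * |∑ β ∈ I, U β (S \ t)| * Real.exp (u * Wf M p σ S)) +
      ∑ β ∈ N, Ex p (fun S => |U α S| * BB γ S * V β S * Real.exp (u * Wf M p σ S)) := by
    rw [← Ex_sum, ← Ex_add]
    apply Ex_mono hp.le hp1.le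
    intro S
    rw [← Finset.sum_mul, ← Finset.mul_sum, ← add_mul, ← mul_add]
    refine mul_le_mul_of_nonneg_right (mul_le_mul_of_nonneg_left ?_
      (mul_nonneg (abs_nonneg _) (BB_nonneg _ _))) (Real.exp_pos _).le
    have h2 := h.diff t (S \ s α)
    have h3 : (S \ s α) \ t = S \ t := by
      rw [ht]; ext x; simp only [Finset.mem_sdiff, Finset.mem_union]; tauto
    rw [h3] at h2
    have h4 : ∑ β ∈ N, V β (S \ s α) ≤ ∑ β ∈ N, V β S :=
      Finset.sum_le_sum fun β hβ => h.Vm β (hNI β hβ) S _ Finset.sdiff_subset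
    have h5 := abs_sub_abs_le_abs_sub (∑ β ∈ I, U β (S \ s α)) (∑ β ∈ I, U β (S \ t))
    linarith
  -- |U(S\t)| expectation
  have h2 : Ex p (fun S => |∑ β ∈ I, U β (S \ t)| * Real.exp (u * Wf M p σ S)) ≤
      X + ∑ β ∈ N, r ^ 2 * Ex p (V β) * Mg M p σ u := by
    have h3 : Ex p (fun S => |∑ β ∈ I, U β (S \ t)| * Real.exp (u * Wf M p σ S)) ≤
      X + ∑ β ∈ N, Ex p (fun S => V β S * Real.exp (u * Wf M p σ S)) := by
      rw [← Ex_sum, hX, ← Ex_add]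
      apply Ex_mono hp.le hp1.le
      intro S
      rw [← Finset.sum_mul, ← add_mul]
      refine mul_le_mul_of_nonneg_right ?_ (Real.exp_pos _).le
      have h2 := h.diff t S
      have h5 := abs_sub_abs_le_abs_sub (∑ β ∈ I, U β (S \ t)) (∑ β ∈ I, U β S)
      rw [abs_sub_comm] at h5
      linarith
    refine h3.trans (add_le_add le_rfl (Finset.sum_le_sum fun β hβ => ?_))
    have hβI := hNI β hβ
    exact tilt1 M hp hp1 hσ hu (s β) h.D0 2 (by norm_num)
      (by push_cast; exact h.nearS β hβI) (V β) (h.V0 β hβI) (h.Vd β hβI)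
  have h3 : Ex p (fun S => |U α S| * BB γ S * |∑ β ∈ I, U β (S \ t)| * Real.exp (u * Wf M p σ S)) ≤
      r ^ 3 * a * (X + ∑ β ∈ N, r ^ 2 * Ex p (V β) * Mg M p σ u) := by
    refine (tilt M hp hp1 hσ hu t 3 (by push_cast; exact nearU h hα hγ)
      (fun S => |U α S| * BB γ S) (fun S => |∑ β ∈ I, U β S|)
      (fun S => mul_nonneg (abs_nonneg _) (BB_nonneg _ _)) (fun S => abs_nonneg _)
      (fun S T hST => by
        rw [h.Ud α hα S T (inter_mono_eq Finset.subset_union_left hST),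
          BB_dep γ t Finset.subset_union_right S T hST])).trans ?_
    exact mul_le_mul_of_nonneg_left h2 (by positivity)
  have h4 : ∀ β ∈ N, Ex p (fun S => |U α S| * BB γ S * V β S * Real.exp (u * Wf M p σ S)) ≤
      r ^ 5 * Ex p (fun S => |U α S| * BB γ S * V β S) * Mg M p σ u := by
    intro β hβ
    have hβI := hNI β hβ
    exact tilt1 M hp hp1 hσ hu (t ∪ s β) h.D0 5 (by norm_num)
      (by push_cast; exact nearUUU h hα hβI hγ) _
      (fun S => mul_nonneg (mul_nonneg (abs_nonneg _) (BB_nonneg _ _)) (h.V0 β hβI S))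
      (fun S T hST => by
        rw [h.Ud α hα S T (inter_mono_eq
            (Finset.subset_union_left.trans Finset.subset_union_left) hST),
          BB_dep γ (t ∪ s β) (Finset.subset_union_right.trans Finset.subset_union_left) S T hST,
          h.Vd β hβI S T (inter_mono_eq Finset.subset_union_right hST)])
  refine h1.trans ((add_le_add h3 (Finset.sum_le_sum h4)).trans ?_)
  have h5 : r ^ 3 * a * X ≤ r ^ 5 * (a * X) := by
    rw [mul_assoc]
    exact mul_le_mul_of_nonneg_right (pow_le_pow_right₀ hr1 (by norm_num)) (by positivity)
  have h6 : a5 p I s U V α γ * Mg M p σ u * r ^ 5 = r ^ 3 * a * (∑ β ∈ N, r ^ 2 * Ex p (V β) * Mg M p σ u) +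
      ∑ β ∈ N, r ^ 5 * Ex p (fun S => |U α S| * BB γ S * V β S) * Mg M p σ u := by
    unfold a5
    rw [Finset.mul_sum, ← Finset.sum_add_distrib, Finset.sum_mul, Finset.sum_mul]
    apply Finset.sum_congr rfl
    intro β _
    ring
  nlinarith

lemma exp_diff {u a b : ℝ} (hu : 0 ≤ u) (hab : b ≤ a) :
    |Real.exp (u * a) - Real.exp (u * b)| ≤ u * (a - b) * Real.exp (u * a) := by
  have h1 := Real.add_one_le_exp (u * b - u * a)
  have h2 : Real.exp (u * b) = Real.exp (u * a) * Real.exp (u * b - u * a) := by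
    rw [← Real.exp_add]; ring_nf
  have h3 := Real.exp_pos (u * a)
  rw [abs_of_nonneg (sub_nonneg.2 (Real.exp_le_exp.2 (mul_le_mul_of_nonneg_left hab hu)))]
  rw [h2]
  nlinarith

lemma fam_alpha (h : Fam M p D I s U V) {σ u : ℝ} (hp : 0 < p) (hp1 : p < 1) (hσ : 0 < σ)
    (hu : 0 ≤ u) {α : ι} (hα : α ∈ I) :
    Ex p (fun S => U α S * (∑ β ∈ I, U β S) * Real.exp (u * Wf M p σ S)) ≤
    Real.exp (u * D / σ) ^ 5 * ((∑ β ∈ nb I s (s α), Ex p (fun S => |U α S| * V β S)) *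
      Mg M p σ u) +
    ∑ γ ∈ near M (s α), u * σ⁻¹ * (Real.exp (u * D / σ) ^ 5 * (Ex p (fun S => |U α S| * BB γ S) *
        Ex p (fun S => |∑ β ∈ I, U β S| * Real.exp (u * Wf M p σ S)) +
      a5 p I s U V α γ * Mg M p σ u)) := by
  have h0 := fam_third h (σ := σ) (u := u) hα
    (fun S => (∑ β ∈ I, U β S) * Real.exp (u * Wf M p σ S))
  have h1 := fam_first h hp hp1 hσ hu hα
  have e : Ex p (fun S => U α S * (∑ β ∈ I, U β S) * Real.exp (u * Wf M p σ S)) =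
    Ex p (fun S => U α S * (∑ β ∈ I, U β S - ∑ β ∈ I, U β (S \ s α)) *
      Real.exp (u * Wf M p σ S)) +
    Ex p (fun S => U α S * (∑ β ∈ I, U β (S \ s α)) * (Real.exp (u * Wf M p σ S) -
      Real.exp (u * Wf M p σ (S \ s α)))) := by
    have : ∀ x : ℝ, x = x + Ex p (fun S => U α S * ((∑ β ∈ I, U β (S \ s α)) *
        Real.exp (u * Wf M p σ (S \ s α)))) := fun x => by rw [h0, add_zero]
    rw [this (_ + _), ← Ex_add, ← Ex_add]
    congr 1; ext S; ring
  rw [e]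
  refine add_le_add h1 ?_
  have h2 : Ex p (fun S => U α S * (∑ β ∈ I, U β (S \ s α)) * (Real.exp (u * Wf M p σ S) -
      Real.exp (u * Wf M p σ (S \ s α)))) ≤
      ∑ γ ∈ near M (s α), u * σ⁻¹ * Ex p (fun S => |U α S| * BB γ S *
        |∑ β ∈ I, U β (S \ s α)| * Real.exp (u * Wf M p σ S)) := by
    simp only [← Ex_mul]
    rw [← Ex_sum]
    apply Ex_mono hp.le hp1.le
    intro S
    refine (le_abs_self _).trans ?_
    rw [abs_mul, abs_mul]
    refine (mul_le_mul_of_nonneg_left (exp_diff hu (Wf_sdiff_le M hσ (s α) S))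
      (by positivity)).trans (le_of_eq ?_)
    rw [Wf_sdiff, Finset.mul_sum, Finset.mul_sum, Finset.sum_mul, Finset.mul_sum]
    apply Finset.sum_congr rfl
    intro γ _
    ring
  refine h2.trans (Finset.sum_le_sum fun γ hγ => ?_)
  have hγM : γ ∈ M := (Finset.mem_filter.1 hγ).1
  exact mul_le_mul_of_nonneg_left (fam_pair h hp hp1 hσ hu hα hγM)
    (mul_nonneg hu (inv_pos.2 hσ).le)

theorem fam_main (h : Fam M p D I s U V) {σ u A3 A4 A5 : ℝ} (hp : 0 < p) (hp1 : p < 1) (hσ : 0 < σ)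
    (hu : 0 ≤ u)
    (h3 : σ⁻¹ * ∑ α ∈ I, ∑ γ ∈ near M (s α), Ex p (fun S => |U α S| * BB γ S) ≤ A3)
    (h4 : ∑ α ∈ I, ∑ β ∈ nb I s (s α), Ex p (fun S => |U α S| * V β S) ≤ A4)
    (h5 : σ⁻¹ * ∑ α ∈ I, ∑ γ ∈ near M (s α), a5 p I s U V α γ ≤ A5) (h30 : 0 ≤ A3)
    (h450 : 0 ≤ A4 + u * A5) :
    Ex p (fun S => |∑ β ∈ I, U β S| * Real.exp (u * Wf M p σ S)) ≤
      Real.exp (u * D / σ) ^ 5 * (u * A3 + √(A4 + u * A5)) * Mg M p σ u := by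
  set r := Real.exp (u * D / σ) with hr
  have hr1 : 1 ≤ r := one_le_r hu hσ h.D0
  have hMg := Mg_pos M σ u hp hp1
  set X := Ex p (fun S => |∑ β ∈ I, U β S| * Real.exp (u * Wf M p σ S)) with hX
  have hX0 : 0 ≤ X := Ex_nonneg hp.le hp1.le fun S => mul_nonneg (abs_nonneg _) (Real.exp_pos _).le
  have hq : Ex p (fun S => (∑ β ∈ I, U β S) ^ 2 * Real.exp (u * Wf M p σ S)) ≤
      r ^ 5 * (A4 * Mg M p σ u + u * A3 * X + u * A5 * Mg M p σ u) := by
    have e : Ex p (fun S => (∑ β ∈ I, U β S) ^ 2 * Real.exp (u * Wf M p σ S)) =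
      ∑ α ∈ I, Ex p (fun S => U α S * (∑ β ∈ I, U β S) * Real.exp (u * Wf M p σ S)) := by
      rw [← Ex_sum]; congr 1; ext S
      rw [← Finset.sum_mul, ← Finset.sum_mul, sq]
    rw [e]
    refine (Finset.sum_le_sum fun α hα => fam_alpha h hp hp1 hσ hu hα).trans ?_
    have e2 : ∑ α ∈ I, (r ^ 5 * ((∑ β ∈ nb I s (s α), Ex p (fun S => |U α S| * V β S)) *
      Mg M p σ u) +
      ∑ γ ∈ near M (s α), u * σ⁻¹ * (r ^ 5 * (Ex p (fun S => |U α S| * BB γ S) * X +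
      a5 p I s U V α γ * Mg M p σ u))) =
      r ^ 5 * ((∑ α ∈ I, ∑ β ∈ nb I s (s α), Ex p (fun S => |U α S| * V β S)) * Mg M p σ u +
        u * (σ⁻¹ * ∑ α ∈ I, ∑ γ ∈ near M (s α), Ex p (fun S => |U α S| * BB γ S)) * X +
        u * (σ⁻¹ * ∑ α ∈ I, ∑ γ ∈ near M (s α), a5 p I s U V α γ) * Mg M p σ u) := by
      simp only [Finset.mul_sum, Finset.sum_mul, mul_add, Finset.sum_add_distrib]
      rw [add_assoc]
      refine congrArg₂ _ rfl (congrArg₂ _ ?_ ?_) <;>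
      exact Finset.sum_congr rfl fun _ _ => Finset.sum_congr rfl fun _ _ => by ring
    rw [e2]
    gcongr
  have hcs : X ^ 2 ≤ Ex p (fun S => (∑ β ∈ I, U β S) ^ 2 * Real.exp (u * Wf M p σ S)) *
      Mg M p σ u := by
    have := Ex_CS hp.le hp1.le (fun S => |∑ β ∈ I, U β S| * Real.exp (u * Wf M p σ S / 2))
      (fun S => Real.exp (u * Wf M p σ S / 2))
    have hh : ∀ x : ℝ, Real.exp (x / 2) * Real.exp (x / 2) = Real.exp x := fun x => by
      rw [← Real.exp_add]; ring_nf
    have e1 : ∀ S, |∑ β ∈ I, U β S| * Real.exp (u * Wf M p σ S / 2) * Real.exp (u * Wf M p σ S / 2)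
      = |∑ β ∈ I, U β S| * Real.exp (u * Wf M p σ S) := fun S => by rw [mul_assoc, hh]
    have e2 : ∀ S, (|∑ β ∈ I, U β S| * Real.exp (u * Wf M p σ S / 2)) ^ 2
      = (∑ β ∈ I, U β S) ^ 2 * Real.exp (u * Wf M p σ S) := fun S => by
      rw [mul_pow, sq_abs, sq (Real.exp _), hh]
    have e3 : ∀ S, (Real.exp (u * Wf M p σ S / 2)) ^ 2
      = Real.exp (u * Wf M p σ S) := fun S => by rw [sq, hh]
    simpa only [e1, e2, e3, Mg] using this
  set m := Mg M p σ u with hm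
  have hr5 : 1 ≤ r ^ 5 := one_le_pow₀ hr1
  set R := r ^ 5 with hR
  set q := √(A4 + u * A5) with hqq
  have hq0 : 0 ≤ q := Real.sqrt_nonneg _
  have hq2 : q ^ 2 = A4 + u * A5 := Real.sq_sqrt h450
  have hfin : X ^ 2 ≤ R * (q ^ 2 * m + u * A3 * X) * m := by
    refine hcs.trans (mul_le_mul_of_nonneg_right (hq.trans (le_of_eq ?_)) hMg.le)
    rw [hq2]; ring
  by_contra hcon
  push Not at hcon
  have hb : 0 ≤ u * A3 := by positivity
  set b := u * A3
  -- X > R (b+q) m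
  have hXpos : 0 < X := lt_of_le_of_lt (by positivity) hcon
  have h7 : R * q * m ≤ X := by nlinarith [mul_nonneg (mul_nonneg (zero_le_one.trans hr5) hb) hMg.le]
  have h8 : X * X ≤ R * b * m * X + R * q * m * (q * m) := by nlinarith
  have h9 : q * m ≤ X := by
    refine le_trans ?_ h7
    have : 0 ≤ q * m := by positivity
    nlinarith
  have h10 : R * q * m * (q * m) ≤ R * q * m * X := mul_le_mul_of_nonneg_left h9 (by positivity)
  nlinarith

end Tilt2
end CMD

open MeasureTheory ProbabilityTheory
open scoped Classical
set_option linter.unusedSectionVars false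
set_option linter.unusedSimpArgs false
set_option linter.unusedVariables false

namespace CMD
section Concrete
variable {E : Type*} [Fintype E] [DecidableEq E]

/-- Index set of triples. -/
noncomputable def II (M : Finset (Finset E)) : Finset ((Finset E × Finset E) × E) :=
  ((M ×ˢ M) ×ˢ Finset.univ).filter (fun α => α.2 ∈ α.1.1 ∧ α.2 ∈ α.1.2)

/-- Support. -/
def ss (α : (Finset E × Finset E) × E) : Finset E := α.1.1 ∪ α.1.2

/-- Random part of the monomial. -/
noncomputable def LL (α : (Finset E × Finset E) × E) : Finset E :=
  Kf α.1.1 α.2 ∪ α.1.2.erase α.2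

/-- Monomial. -/
noncomputable def mm (p : ℝ) (α : (Finset E × Finset E) × E) (S : Finset E) : ℝ :=
  p ^ (Jf α.1.1 α.2).card * BB (LL α) S

/-- Family for `Y`. -/
noncomputable def UY (p σ : ℝ) (α : (Finset E × Finset E) × E) (S : Finset E) : ℝ :=
  σ⁻¹ ^ 2 * ((BB {α.2} S - p) * mm p α S)

/-- Family for `Z`. -/
noncomputable def UZ (p σ : ℝ) (α : (Finset E × Finset E) × E) (S : Finset E) : ℝ :=
  σ⁻¹ ^ 2 * (p * (1 - p) * (mm p α S - Ex p (mm p α)))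

/-- Majorant. -/
noncomputable def VV (p σ : ℝ) (α : (Finset E × Finset E) × E) (S : Finset E) : ℝ :=
  σ⁻¹ ^ 2 * (2 * ((BB {α.2} S + p) * mm p α S))

lemma mem_II {M : Finset (Finset E)} {α : (Finset E × Finset E) × E} :
    α ∈ II M ↔ (α.1.1 ∈ M ∧ α.1.2 ∈ M) ∧ α.2 ∈ α.1.1 ∧ α.2 ∈ α.1.2 := by
  simp [II]

lemma LL_notMem {M : Finset (Finset E)} {α : (Finset E × Finset E) × E} (h : α ∈ II M) :
    α.2 ∉ LL α := by
  have h1 := (mem_II.1 h).2.1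
  simp only [LL, Finset.mem_union, not_or]
  exact ⟨notMem_Kf h1, by simp⟩

/-- the whole support is `{k} ∪ J ∪ L` -/
lemma ss_eq {M : Finset (Finset E)} {α : (Finset E × Finset E) × E} (h : α ∈ II M) :
    ss α = insert α.2 (LL α) ∪ Jf α.1.1 α.2 := by
  obtain ⟨_, h1, h2⟩ := mem_II.1 h
  have h3 := JK_union α.1.1 h1
  have h4 : α.1.1 = insert α.2 (Jf α.1.1 α.2 ∪ Kf α.1.1 α.2) := by
    rw [h3, Finset.insert_erase h1]
  have h5 : α.1.2 = insert α.2 (α.1.2.erase α.2) := by rw [Finset.insert_erase h2]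
  unfold ss LL
  ext x
  have e4 := Finset.ext_iff.1 h4 x
  have e5 := Finset.ext_iff.1 h5 x
  simp only [Finset.mem_union, Finset.mem_insert] at e4 e5 ⊢
  tauto

lemma mm_nonneg {p : ℝ} (hp : 0 < p) (α : (Finset E × Finset E) × E) (S : Finset E) :
    0 ≤ mm p α S := mul_nonneg (pow_nonneg hp.le _) (BB_nonneg _ _)

lemma mm_mono {p : ℝ} (hp : 0 < p) (α : (Finset E × Finset E) × E) {S T : Finset E} (h : T ⊆ S) :
    mm p α T ≤ mm p α S := mul_le_mul_of_nonneg_left (BB_mono _ h) (pow_nonneg hp.le _)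

lemma mm_dep {p : ℝ} {M : Finset (Finset E)} {α : (Finset E × Finset E) × E} (h : α ∈ II M)
    (S T : Finset E) (hST : S ∩ ss α = T ∩ ss α) : mm p α S = mm p α T := by
  unfold mm
  rw [BB_dep (LL α) (ss α) _ S T hST]
  rw [ss_eq h]
  exact (Finset.subset_insert _ _).trans Finset.subset_union_left

lemma bk_dep {M : Finset (Finset E)} {α : (Finset E × Finset E) × E} (h : α ∈ II M)
    (S T : Finset E) (hST : S ∩ ss α = T ∩ ss α) : BB {α.2} S = BB {α.2} T := by
  rw [BB_dep {α.2} (ss α) _ S T hST]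
  rw [ss_eq h]
  intro x hx
  simp only [Finset.mem_singleton] at hx
  simp [hx]

lemma UY_sum (M : Finset (Finset E)) (p σ : ℝ) (S : Finset E) :
    Yf M p σ S = ∑ α ∈ II M, UY p σ α S := by
  unfold Yf II Rf Df UY mm LL
  rw [Finset.sum_filter, Finset.sum_product_right]
  apply Finset.sum_congr rfl
  intro k _
  rw [Finset.sum_product, Finset.sum_filter, Finset.sum_filter,
    mul_mul_mul_comm, Finset.sum_mul_sum, Finset.mul_sum, Finset.mul_sum]
  apply Finset.sum_congr rfl
  intro a _
  rw [Finset.mul_sum, Finset.mul_sum]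
  apply Finset.sum_congr rfl
  intro b _
  by_cases h1 : k ∈ a <;> by_cases h2 : k ∈ b <;> simp [h1, h2, ← BB_mul]
  ring

lemma Z_sum (M : Finset (Finset E)) (p σ : ℝ) (S : Finset E) :
    Zf M p σ S = ∑ α ∈ II M, σ⁻¹ ^ 2 * (p * (1 - p) * mm p α S) := by
  unfold Zf II Rf Df mm LL
  rw [Finset.sum_filter, Finset.sum_product_right]
  apply Finset.sum_congr rfl
  intro k _
  rw [Finset.sum_product, Finset.sum_filter, Finset.sum_filter,
    mul_mul_mul_comm σ⁻¹, Finset.sum_mul_sum, Finset.mul_sum, Finset.mul_sum]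
  apply Finset.sum_congr rfl
  intro a _
  rw [Finset.mul_sum, Finset.mul_sum]
  apply Finset.sum_congr rfl
  intro b _
  by_cases h1 : k ∈ a <;> by_cases h2 : k ∈ b <;> simp [h1, h2, ← BB_mul]
  ring

lemma Ex_Zf (M : Finset (Finset E)) (p σ : ℝ) :
    Ex p (Zf M p σ) = Ex p (fun S => Wf M p σ S ^ 2) := by
  have h := stein_id M p σ (fun x => x)
  have h2 := Z_id M p σ (fun _ => 1)
  simp only [Wf_diff, mul_one] at h h2
  have e : ∀ S, Wf M p σ S ^ 2 = Wf M p σ S * Wf M p σ S := fun S => sq _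
  simp only [e]
  rw [h]
  calc Ex p (Zf M p σ) = Ex p (fun S => Zf M p σ S) := rfl
    _ = _ := by
      rw [h2]
      apply Finset.sum_congr rfl
      intro k _
      congr 2; ext S; ring

lemma UZ_sum (M : Finset (Finset E)) (p σ : ℝ) (h1 : Ex p (fun S => Wf M p σ S ^ 2) = 1)
    (S : Finset E) :
    Zf M p σ S - 1 = ∑ α ∈ II M, UZ p σ α S := by
  have h2 : ∑ α ∈ II M, σ⁻¹ ^ 2 * (p * (1 - p) * Ex p (mm p α)) = 1 := by
    refine Eq.trans ?_ ((Ex_Zf M p σ).trans h1)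
    have : Zf M p σ = fun S => ∑ α ∈ II M, σ⁻¹ ^ 2 * (p * (1 - p) * mm p α S) := by
      ext S; exact Z_sum M p σ S
    rw [this, Ex_sum]
    apply Finset.sum_congr rfl
    intro α _
    rw [Ex_mul, Ex_mul]
  rw [Z_sum]
  refine (congrArg₂ _ rfl h2.symm).trans ?_
  rw [← Finset.sum_sub_distrib]
  apply Finset.sum_congr rfl
  intro α _
  unfold UZ; ring

lemma near_ss {M : Finset (Finset E)} {D : ℝ} (hD : ∀ γ ∈ M, ((near M γ).card : ℝ) ≤ D)
    {α : (Finset E × Finset E) × E} (h : α ∈ II M) : ((near M (ss α)).card : ℝ) ≤ 2 * D := by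
  obtain ⟨⟨h1, h2⟩, _⟩ := mem_II.1 h
  have h3 : ((near M (ss α)).card : ℝ) ≤ (near M α.1.1).card + (near M α.1.2).card := by
    exact_mod_cast near_union_card M α.1.1 α.1.2
  linarith [hD _ h1, hD _ h2]

lemma VV_nonneg {p σ : ℝ} (hp : 0 < p) (α : (Finset E × Finset E) × E) (S : Finset E) :
    0 ≤ VV p σ α S := by
  unfold VV
  have := mm_nonneg hp α S
  have := BB_nonneg {α.2} S
  positivity

lemma VV_mono {p σ : ℝ} (hp : 0 < p) (α : (Finset E × Finset E) × E) {S T : Finset E}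
    (h : T ⊆ S) : VV p σ α T ≤ VV p σ α S := by
  unfold VV
  have h1 := mm_nonneg hp α T
  have h2 := BB_nonneg {α.2} S
  have h3 := BB_mono {α.2} h
  have h4 := mm_mono hp α h
  gcongr

lemma VV_dep {p σ : ℝ} {M : Finset (Finset E)} {α : (Finset E × Finset E) × E} (h : α ∈ II M)
    (S T : Finset E) (hST : S ∩ ss α = T ∩ ss α) : VV p σ α S = VV p σ α T := by
  unfold VV
  rw [mm_dep h S T hST, bk_dep h S T hST]

lemma famY {M : Finset (Finset E)} {p σ D : ℝ} (hp : 0 < p) (hp1 : p < 1)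
    (hD0 : 0 ≤ D) (hD : ∀ γ ∈ M, ((near M γ).card : ℝ) ≤ D) :
    Fam M p D (II M) ss (UY p σ) (VV p σ) where
  D0 := hD0
  nearM := hD
  nearS := fun α h => near_ss hD h
  U0 := fun α h => by
    unfold UY
    rw [Ex_mul]
    have := Ex_ibp p α.2 (mm p α) (fun _ => 1) (fun S => by
      unfold mm
      rw [(BB_insert_erase (LL_notMem h) S).1, (BB_insert_erase (LL_notMem h) S).2]
      exact ⟨rfl, rfl⟩)
    simp only [mul_one, sub_self, mul_zero, Ex_zero] at this
    rw [this, mul_zero]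
  Ud := fun α h S T hST => by
    unfold UY
    rw [mm_dep h S T hST, bk_dep h S T hST]
  Vd := fun α h S T hST => VV_dep h S T hST
  V0 := fun α h S => VV_nonneg hp α S
  Vm := fun α h S T hST => VV_mono hp α hST
  UV := fun α h S T hST => by
    unfold UY VV
    rw [← mul_sub, abs_mul, abs_of_nonneg (by positivity : 0 ≤ σ⁻¹ ^ 2)]
    refine mul_le_mul_of_nonneg_left ?_ (by positivity)
    have a1 := mm_nonneg hp α T
    have a2 := mm_mono hp α hST
    have a3 := BB_nonneg {α.2} T
    have a4 := BB_mono {α.2} hST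
    have key : ∀ R, |(BB {α.2} R - p) * mm p α R| ≤ (BB {α.2} R + p) * mm p α R := fun R => by
      rw [abs_mul, abs_of_nonneg (mm_nonneg hp α R)]
      refine mul_le_mul_of_nonneg_right ?_ (mm_nonneg hp α R)
      have := BB_nonneg {α.2} R
      rw [abs_le]; constructor <;> linarith
    have h1 := key S
    have h2 := key T
    have h3 : (BB {α.2} T + p) * mm p α T ≤ (BB {α.2} S + p) * mm p α S := by
      gcongr
      linarith
    refine (abs_sub _ _).trans ?_
    linarith

lemma famZ {M : Finset (Finset E)} {p σ D : ℝ} (hp : 0 < p) (hp1 : p < 1)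
    (hD0 : 0 ≤ D) (hD : ∀ γ ∈ M, ((near M γ).card : ℝ) ≤ D) :
    Fam M p D (II M) ss (UZ p σ) (VV p σ) where
  D0 := hD0
  nearM := hD
  nearS := fun α h => near_ss hD h
  U0 := fun α h => by
    unfold UZ
    rw [Ex_mul, Ex_mul, Ex_sub, Ex_const, sub_self, mul_zero, mul_zero]
  Ud := fun α h S T hST => by
    unfold UZ
    rw [mm_dep h S T hST]
  Vd := fun α h S T hST => VV_dep h S T hST
  V0 := fun α h S => VV_nonneg hp α S
  Vm := fun α h S T hST => VV_mono hp α hST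
  UV := fun α h S T hST => by
    unfold UZ VV
    rw [← mul_sub, abs_mul, abs_of_nonneg (by positivity : 0 ≤ σ⁻¹ ^ 2)]
    refine mul_le_mul_of_nonneg_left ?_ (by positivity)
    have a1 := mm_nonneg hp α T
    have a2 := mm_mono hp α hST
    have a3 := BB_nonneg {α.2} S
    have hpq : 0 ≤ p * (1 - p) := mul_nonneg hp.le (by linarith)
    rw [← mul_sub, abs_mul, abs_of_nonneg hpq,
      abs_of_nonneg (by linarith)]
    have h1 : p * (1 - p) ≤ p := by nlinarith
    have h2 : p * (1 - p) * (mm p α S - Ex p (mm p α) - (mm p α T - Ex p (mm p α))) ≤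
      p * mm p α S := by
      apply mul_le_mul h1 (by linarith) (by linarith) hp.le
    have : 0 ≤ BB {α.2} S * mm p α S := mul_nonneg a3 (mm_nonneg hp α S)
    have : 0 ≤ p * mm p α S := mul_nonneg hp.le (mm_nonneg hp α S)
    linarith

lemma pow_card_le {p : ℝ} (hp : 0 < p) (hp1 : p < 1) {a b : ℕ} (h : a ≤ b) : p ^ b ≤ p ^ a :=
  pow_le_pow_of_le_one hp.le hp1.le h

lemma Ex_absk {p : ℝ} (hp : 0 < p) (hp1 : p < 1) (k : E) (L : Finset E) :
    Ex p (fun S => |BB {k} S - p| * BB L S) ≤ 2 * (1 - p) * p ^ (insert k L).card := by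
  have e : ∀ S : Finset E, |BB {k} S - p| * BB L S =
      (1 - p) * BB (insert k L) S + p * (BB L S - BB (insert k L) S) := by
    intro S
    have : BB (insert k L) S = BB {k} S * BB L S := by rw [BB_mul]; rfl
    rw [this]
    unfold BB
    by_cases h : {k} ⊆ S
    · simp only [h, if_true]
      rw [abs_of_nonneg (by linarith)]; ring
    · simp only [h, if_false]
      rw [abs_of_nonpos (by linarith)]; ring
  have e2 : Ex p (fun S => |BB {k} S - p| * BB L S) =
      (1 - p) * p ^ (insert k L).card + p * (p ^ L.card - p ^ (insert k L).card) := by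
    simp only [e]
    rw [Ex_add, Ex_mul, Ex_mul, Ex_sub]
    congr 1
    · rw [← Ex_BB]
    · rw [← Ex_BB, ← Ex_BB]
  rw [e2]
  have hpow := pow_pos hp (insert k L).card
  by_cases hk : k ∈ L
  · rw [Finset.insert_eq_of_mem hk] at hpow ⊢
    nlinarith
  · rw [Finset.card_insert_of_notMem hk]
    rw [pow_succ]
    have hpow := pow_pos hp L.card
    have : p * (p ^ L.card - p ^ L.card * p) = (1 - p) * (p ^ L.card * p) := by ring
    rw [this]
    linarith

lemma card_aux {α : (Finset E × Finset E) × E} {M : Finset (Finset E)} (h : α ∈ II M)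
    (C : Finset E) : (ss α ∪ C).card ≤ (Jf α.1.1 α.2).card + (insert α.2 (LL α ∪ C)).card := by
  rw [ss_eq h, add_comm]
  refine le_trans (Finset.card_le_card ?_) (Finset.card_union_le _ _)
  intro x
  simp only [Finset.mem_union, Finset.mem_insert]
  tauto

lemma UY_bound {M : Finset (Finset E)} {p σ : ℝ} (hp : 0 < p) (hp1 : p < 1)
    {α : (Finset E × Finset E) × E} (h : α ∈ II M) (C : Finset E) :
    Ex p (fun S => |UY p σ α S| * BB C S) ≤ 2 * (1 - p) * σ⁻¹ ^ 2 * p ^ (ss α ∪ C).card := by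
  have e : ∀ S, |UY p σ α S| * BB C S = σ⁻¹ ^ 2 * p ^ (Jf α.1.1 α.2).card *
      (|BB {α.2} S - p| * BB (LL α ∪ C) S) := by
    intro S
    unfold UY
    rw [abs_mul, abs_mul, abs_of_nonneg (mm_nonneg hp α S),
      abs_of_nonneg (by positivity : 0 ≤ σ⁻¹ ^ 2), mm, ← BB_mul]
    ring
  simp only [e]
  rw [Ex_mul]
  have h1 := Ex_absk hp hp1 α.2 (LL α ∪ C)
  refine (mul_le_mul_of_nonneg_left h1 (by positivity)).trans ?_
  have h2 := pow_card_le hp hp1 (card_aux h C)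
  have h3 : 0 ≤ 2 * (1 - p) * σ⁻¹ ^ 2 := by
    have : 0 ≤ 1 - p := by linarith
    positivity
  refine le_trans (le_of_eq ?_) (mul_le_mul_of_nonneg_left h2 h3)
  rw [pow_add]; ring

lemma card_ins {α : (Finset E × Finset E) × E} (C : Finset E) :
    (insert α.2 (LL α ∪ C)).card ≤ 1 + (LL α ∪ C).card := by
  rw [add_comm]; exact Finset.card_insert_le _ _

lemma UZ_bound {M : Finset (Finset E)} {p σ : ℝ} (hp : 0 < p) (hp1 : p < 1)
    {α : (Finset E × Finset E) × E} (h : α ∈ II M) (C : Finset E) :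
    Ex p (fun S => |UZ p σ α S| * BB C S) ≤ 2 * (1 - p) * σ⁻¹ ^ 2 * p ^ (ss α ∪ C).card := by
  have hq : 0 < 1 - p := by linarith
  have hEm : Ex p (mm p α) = p ^ (Jf α.1.1 α.2).card * p ^ (LL α).card := by
    unfold mm; rw [Ex_mul, ← Ex_BB p (LL α)]
  have h1 : Ex p (fun S => |UZ p σ α S| * BB C S) ≤ Ex p (fun S => σ⁻¹ ^ 2 * (p * (1 - p)) *
      (p ^ (Jf α.1.1 α.2).card * BB (LL α ∪ C) S + p ^ (Jf α.1.1 α.2).card * p ^ (LL α).card *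
        BB C S)) := by
    apply Ex_mono hp.le hp1.le
    intro S
    unfold UZ
    rw [abs_mul, abs_mul, abs_of_nonneg (by positivity : 0 ≤ σ⁻¹ ^ 2),
      abs_of_nonneg (by positivity : 0 ≤ p * (1 - p)), ← hEm, ← BB_mul, ← mul_assoc (p ^ _)]
    have h2 : |mm p α S - Ex p (mm p α)| ≤ mm p α S + Ex p (mm p α) := by
      have a := mm_nonneg hp α S
      have b : 0 ≤ Ex p (mm p α) := Ex_nonneg hp.le hp1.le (mm_nonneg hp α)
      rw [abs_le]; constructor <;> linarith
    have h3 : 0 ≤ σ⁻¹ ^ 2 * (p * (1 - p)) * BB C S := by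
      have := BB_nonneg C S
      positivity
    have h4 := mul_le_mul_of_nonneg_left h2 h3
    unfold mm at h4 ⊢
    linarith
  refine h1.trans ?_
  have e1 : Ex p (fun S => BB (LL α ∪ C) S) = p ^ (LL α ∪ C).card := Ex_BB p _
  have e2 : Ex p (fun S => BB C S) = p ^ C.card := Ex_BB p _
  rw [Ex_mul, Ex_add, Ex_mul, Ex_mul, e1, e2]
  have c1 : (ss α ∪ C).card ≤ 1 + (Jf α.1.1 α.2).card + (LL α ∪ C).card := by
    have := card_aux h C; have := card_ins (α := α) C; omega
  have c2 : (ss α ∪ C).card ≤ 1 + (Jf α.1.1 α.2).card + (LL α).card + C.card := by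
    have := Finset.card_union_le (LL α) C; omega
  have d1 := pow_card_le hp hp1 c1
  have d2 := pow_card_le hp hp1 c2
  simp only [pow_add, pow_one] at d1 d2
  have h3 : 0 ≤ (1 - p) * σ⁻¹ ^ 2 := by positivity
  have d3 := mul_le_mul_of_nonneg_left (add_le_add d1 d2) h3
  linarith

end Concrete
end CMD

open MeasureTheory ProbabilityTheory
open scoped Classical
set_option linter.unusedSectionVars false
set_option linter.unusedSimpArgs false
set_option linter.unusedVariables false

namespace CMD
section Chains
variable {E : Type*} [Fintype E] [DecidableEq E]

/-- Unions of `j` members of `M`. -/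
def cup (M : Finset (Finset E)) : ℕ → Finset E → Prop
  | 0, A => A = ∅
  | j + 1, A => ∃ B γ, cup M j B ∧ γ ∈ M ∧ A = B ∪ γ

lemma cup_one {M : Finset (Finset E)} {γ : Finset E} (h : γ ∈ M) : cup M 1 γ :=
  ⟨∅, γ, rfl, h, by simp⟩

lemma cup_succ {M : Finset (Finset E)} {j : ℕ} {A γ : Finset E} (hA : cup M j A) (h : γ ∈ M) :
    cup M (j + 1) (A ∪ γ) := ⟨A, γ, hA, h, rfl⟩

/-- Numerical hypotheses on chain sums. -/
structure Chain (M : Finset (Finset E)) (p : ℝ) (e : ℕ) (b0 : ℝ) (b : ℕ → ℝ) : Prop where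
  card : ∀ γ ∈ M, γ.card = e
  first : ∑ γ ∈ M, p ^ γ.card ≤ b0
  b00 : 0 ≤ b0
  bnn : ∀ j, 0 ≤ b j
  step : ∀ j A, 1 ≤ j → j ≤ 4 → cup M j A → ∑ γ ∈ near M A, p ^ (A ∪ γ).card ≤ b j * p ^ A.card

lemma sum_II {M : Finset (Finset E)} {e : ℕ} (hc : ∀ γ ∈ M, γ.card = e)
    (f : Finset E → Finset E → ℝ) (hf : ∀ a b, 0 ≤ f a b) :
    ∑ α ∈ II M, f α.1.1 α.1.2 ≤ e * ∑ a ∈ M, ∑ b ∈ near M a, f a b := by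
  unfold II near
  rw [Finset.sum_filter, Finset.sum_product, Finset.sum_product, Finset.mul_sum]
  refine Finset.sum_le_sum fun a ha => ?_
  rw [Finset.sum_filter, Finset.mul_sum]
  refine Finset.sum_le_sum fun b hb => ?_
  simp only
  rw [← Finset.sum_filter, Finset.sum_const, nsmul_eq_mul]
  have e1 : (Finset.univ.filter (fun k => k ∈ a ∧ k ∈ b)) = b ∩ a := by
    ext x; simp [and_comm]
  rw [e1]
  split_ifs with h
  · refine mul_le_mul_of_nonneg_right ?_ (hf _ _)
    rw [← hc b hb]
    exact_mod_cast Finset.card_le_card Finset.inter_subset_left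
  · rw [Finset.not_nonempty_iff_eq_empty.1 h]; simp

lemma sum_nb {M : Finset (Finset E)} {e : ℕ} (hc : ∀ γ ∈ M, γ.card = e) (t : Finset E)
    (f : Finset E → ℝ) (hf : ∀ a, 0 ≤ f a) :
    ∑ β ∈ nb (II M) ss t, f (t ∪ ss β) ≤
      2 * e * ∑ a ∈ near M t, ∑ b ∈ near M (t ∪ a), f (t ∪ a ∪ b) := by
  have h1 : ∑ β ∈ nb (II M) ss t, f (t ∪ ss β) ≤
      e * ∑ a ∈ M, ∑ b ∈ near M a, if ((a ∪ b) ∩ t).Nonempty then f (t ∪ (a ∪ b)) else 0 := by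
    unfold nb
    rw [Finset.sum_filter]
    exact sum_II hc (fun a b => if ((a ∪ b) ∩ t).Nonempty then f (t ∪ (a ∪ b)) else 0)
      (fun a b => by split_ifs; exacts [hf _, le_rfl])
  have h2 : ∑ a ∈ M, ∑ b ∈ near M a, (if ((a ∪ b) ∩ t).Nonempty then f (t ∪ (a ∪ b)) else 0) ≤
      ∑ a ∈ M, ∑ b ∈ M, ((if (a ∩ t).Nonempty ∧ (b ∩ (t ∪ a)).Nonempty then f (t ∪ a ∪ b) else 0) +
        (if (b ∩ t).Nonempty ∧ (a ∩ (t ∪ b)).Nonempty then f (t ∪ b ∪ a) else 0)) := by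
    refine Finset.sum_le_sum fun a _ => ?_
    unfold near
    rw [Finset.sum_filter]
    refine Finset.sum_le_sum fun b _ => ?_
    have e1 : t ∪ (a ∪ b) = t ∪ a ∪ b := by rw [Finset.union_assoc]
    have e2 : t ∪ (a ∪ b) = t ∪ b ∪ a := by rw [Finset.union_assoc, Finset.union_comm b a]
    have n1 : 0 ≤ (if (a ∩ t).Nonempty ∧ (b ∩ (t ∪ a)).Nonempty then f (t ∪ a ∪ b) else 0) := by
      split_ifs; exacts [hf _, le_rfl]
    have n2 : 0 ≤ (if (b ∩ t).Nonempty ∧ (a ∩ (t ∪ b)).Nonempty then f (t ∪ b ∪ a) else 0) := by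
      split_ifs; exacts [hf _, le_rfl]
    by_cases hab : (b ∩ a).Nonempty
    · by_cases ht : ((a ∪ b) ∩ t).Nonempty
      · rw [if_pos hab, if_pos ht]
        obtain ⟨x, hx⟩ := ht
        obtain ⟨y, hy⟩ := hab
        simp only [Finset.mem_inter, Finset.mem_union] at hx hy
        rcases hx.1 with h | h
        · have : (a ∩ t).Nonempty ∧ (b ∩ (t ∪ a)).Nonempty :=
            ⟨⟨x, by simp [h, hx.2]⟩, ⟨y, by simp [hy.1, hy.2]⟩⟩
          rw [if_pos this, e1]; linarith
        · have : (b ∩ t).Nonempty ∧ (a ∩ (t ∪ b)).Nonempty :=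
            ⟨⟨x, by simp [h, hx.2]⟩, ⟨y, by simp [hy.1, hy.2]⟩⟩
          rw [if_pos this, e2]; linarith
      · rw [if_pos hab, if_neg ht]; linarith
    · rw [if_neg hab]; linarith
  refine h1.trans ((mul_le_mul_of_nonneg_left h2 (by positivity)).trans (le_of_eq ?_))
  simp only [Finset.sum_add_distrib]
  rw [Finset.sum_comm (f := fun a b => if (b ∩ t).Nonempty ∧ (a ∩ (t ∪ b)).Nonempty
    then f (t ∪ b ∪ a) else 0)]
  have e3 : ∑ a ∈ near M t, ∑ b ∈ near M (t ∪ a), f (t ∪ a ∪ b) =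
    ∑ a ∈ M, ∑ b ∈ M, (if (a ∩ t).Nonempty ∧ (b ∩ (t ∪ a)).Nonempty then f (t ∪ a ∪ b) else 0) := by
    unfold near
    rw [Finset.sum_filter]
    refine Finset.sum_congr rfl fun a _ => ?_
    rw [Finset.sum_filter]
    by_cases h : (a ∩ t).Nonempty <;> simp [h]
  rw [e3]; ring

variable {M : Finset (Finset E)} {p b0 : ℝ} {e : ℕ} {b : ℕ → ℝ}

lemma chain_two (h : Chain M p e b0 b) (hp : 0 < p) {j : ℕ} (h1 : 1 ≤ j) (h2 : j ≤ 3) {A : Finset E}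
    (hA : cup M j A) :
    ∑ a ∈ near M A, ∑ c ∈ near M (A ∪ a), p ^ (A ∪ a ∪ c).card ≤ b j * b (j + 1) * p ^ A.card := by
  have : ∀ a ∈ near M A, ∑ c ∈ near M (A ∪ a), p ^ (A ∪ a ∪ c).card ≤
      b (j + 1) * p ^ (A ∪ a).card := fun a ha =>
    h.step (j + 1) _ (by omega) (by omega) (cup_succ hA (Finset.mem_filter.1 ha).1)
  refine (Finset.sum_le_sum this).trans ?_
  rw [← Finset.mul_sum]
  refine (mul_le_mul_of_nonneg_left (h.step j A h1 (by omega) hA) (h.bnn _)).trans (le_of_eq ?_)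
  ring

lemma chain_II (h : Chain M p e b0 b) (hp : 0 < p) :
    ∑ α ∈ II M, p ^ (ss α).card ≤ e * (b0 * b 1) := by
  refine (sum_II h.card (fun a c => p ^ (a ∪ c).card) (fun a c => by positivity)).trans ?_
  refine mul_le_mul_of_nonneg_left ?_ (by positivity)
  have : ∀ a ∈ M, ∑ c ∈ near M a, p ^ (a ∪ c).card ≤ b 1 * p ^ a.card := fun a ha =>
    h.step 1 _ le_rfl (by norm_num) (cup_one ha)
  refine (Finset.sum_le_sum this).trans ?_
  rw [← Finset.mul_sum]
  refine (mul_le_mul_of_nonneg_left h.first (h.bnn _)).trans (le_of_eq ?_)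
  ring

lemma cup_ss {α : (Finset E × Finset E) × E} (hα : α ∈ II M) : cup M 2 (ss α) := by
  obtain ⟨⟨h1, h2⟩, _⟩ := mem_II.1 hα
  exact cup_succ (cup_one h1) h2

lemma Ex_UV {U : ((Finset E × Finset E) × E) → Finset E → ℝ} {σ κ : ℝ} (hp : 0 < p) (hp1 : p < 1)
    (hκ : 0 ≤ κ)
    {α β : (Finset E × Finset E) × E} (hβ : β ∈ II M)
    (hU : ∀ C, Ex p (fun S => |U α S| * BB C S) ≤ κ * p ^ (ss α ∪ C).card) (C : Finset E) :
    Ex p (fun S => |U α S| * BB C S * VV p σ β S) ≤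
      4 * σ⁻¹ ^ 2 * κ * p ^ (ss α ∪ C ∪ ss β).card := by
  have e1 : ∀ S, |U α S| * BB C S * VV p σ β S = 2 * σ⁻¹ ^ 2 * p ^ (Jf β.1.1 β.2).card *
      (|U α S| * BB (C ∪ insert β.2 (LL β)) S + p * (|U α S| * BB (C ∪ LL β) S)) := by
    intro S
    have : BB (insert β.2 (LL β)) S = BB {β.2} S * BB (LL β) S := by rw [BB_mul]; rfl
    rw [← BB_mul, ← BB_mul, this]
    unfold VV mm; ring
  simp only [e1]
  rw [Ex_mul, Ex_add, Ex_mul]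
  have h1 := hU (C ∪ insert β.2 (LL β))
  have h2 := hU (C ∪ LL β)
  have c1 : (ss α ∪ C ∪ ss β).card ≤
      (Jf β.1.1 β.2).card + (ss α ∪ (C ∪ insert β.2 (LL β))).card := by
    rw [ss_eq hβ, add_comm]
    refine le_trans (Finset.card_le_card ?_) (Finset.card_union_le _ _)
    intro x
    simp only [Finset.mem_union, Finset.mem_insert]
    tauto
  have c2 : (ss α ∪ (C ∪ insert β.2 (LL β))).card ≤ 1 + (ss α ∪ (C ∪ LL β)).card := by
    rw [add_comm]
    refine le_trans (Finset.card_le_card ?_) (Finset.card_insert_le β.2 _)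
    intro x
    simp only [Finset.mem_union, Finset.mem_insert]
    tauto
  have d1 := pow_card_le hp hp1 c1
  have d2 := pow_card_le hp hp1 (c1.trans (add_le_add le_rfl c2))
  simp only [pow_add, pow_one] at d1 d2
  have h4 : 0 ≤ 2 * σ⁻¹ ^ 2 * p ^ (Jf β.1.1 β.2).card := by positivity
  have h5 := mul_le_mul_of_nonneg_left (add_le_add h1 (mul_le_mul_of_nonneg_left h2 hp.le)) h4
  refine h5.trans ?_
  have h6 : 0 ≤ 2 * σ⁻¹ ^ 2 * κ := by positivity
  have := mul_le_mul_of_nonneg_left (add_le_add d1 d2) h6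
  linarith

lemma Ex_VV {σ : ℝ} (hp : 0 < p) (hp1 : p < 1)
    {β : (Finset E × Finset E) × E} (hβ : β ∈ II M) :
    Ex p (VV p σ β) ≤ 4 * σ⁻¹ ^ 2 * p ^ (ss β).card := by
  have e1 : VV p σ β = fun S => 2 * σ⁻¹ ^ 2 * p ^ (Jf β.1.1 β.2).card *
      (BB (insert β.2 (LL β)) S + p * BB (LL β) S) := by
    ext S
    have : BB (insert β.2 (LL β)) S = BB {β.2} S * BB (LL β) S := by rw [BB_mul]; rfl
    rw [this]
    unfold VV mm; ring
  have f1 : Ex p (fun S => BB (insert β.2 (LL β)) S) = p ^ (insert β.2 (LL β)).card := Ex_BB p _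
  have f2 : Ex p (fun S => BB (LL β) S) = p ^ (LL β).card := Ex_BB p _
  rw [e1, Ex_mul, Ex_add, Ex_mul, f1, f2]
  have c1 : (ss β).card ≤ (Jf β.1.1 β.2).card + (insert β.2 (LL β)).card := by
    rw [ss_eq hβ, add_comm]
    exact Finset.card_union_le _ _
  have c2 : (insert β.2 (LL β)).card ≤ 1 + (LL β).card := by
    rw [add_comm]; exact Finset.card_insert_le _ _
  have d1 := pow_card_le hp hp1 c1
  have d2 := pow_card_le hp hp1 (c1.trans (add_le_add le_rfl c2))
  simp only [pow_add, pow_one] at d1 d2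
  have h6 : 0 ≤ 2 * σ⁻¹ ^ 2 := by positivity
  have := mul_le_mul_of_nonneg_left (add_le_add d1 d2) h6
  linarith

lemma A3_le (h : Chain M p e b0 b) {U : ((Finset E × Finset E) × E) → Finset E → ℝ} {σ κ : ℝ}
    (hp : 0 < p) (hp1 : p < 1) (hκ : 0 ≤ κ) (hσ : 0 < σ)
    (hU : ∀ α ∈ II M, ∀ C, Ex p (fun S => |U α S| * BB C S) ≤ κ * p ^ (ss α ∪ C).card) :
    σ⁻¹ * ∑ α ∈ II M, ∑ γ ∈ near M (ss α), Ex p (fun S => |U α S| * BB γ S) ≤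
      σ⁻¹ * (κ * e * (b0 * b 1 * b 2)) := by
  refine mul_le_mul_of_nonneg_left ?_ (inv_pos.2 hσ).le
  have h1 : ∀ α ∈ II M, ∑ γ ∈ near M (ss α), Ex p (fun S => |U α S| * BB γ S) ≤
      κ * b 2 * p ^ (ss α).card := by
    intro α hα
    refine (Finset.sum_le_sum fun γ _ => hU α hα γ).trans ?_
    rw [← Finset.mul_sum, mul_assoc]
    exact mul_le_mul_of_nonneg_left (h.step 2 _ (by norm_num) (by norm_num) (cup_ss hα)) hκ
  refine (Finset.sum_le_sum h1).trans ?_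
  rw [← Finset.mul_sum]
  refine (mul_le_mul_of_nonneg_left (chain_II h hp) (mul_nonneg hκ (h.bnn _))).trans (le_of_eq ?_)
  ring

lemma A4_le (h : Chain M p e b0 b) {U : ((Finset E × Finset E) × E) → Finset E → ℝ} {σ κ : ℝ}
    (hp : 0 < p) (hp1 : p < 1) (hκ : 0 ≤ κ) (hσ : 0 < σ)
    (hU : ∀ α ∈ II M, ∀ C, Ex p (fun S => |U α S| * BB C S) ≤ κ * p ^ (ss α ∪ C).card) :
    ∑ α ∈ II M, ∑ β ∈ nb (II M) ss (ss α), Ex p (fun S => |U α S| * VV p σ β S) ≤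
      8 * σ⁻¹ ^ 2 * κ * e ^ 2 * (b0 * b 1 * b 2 * b 3) := by
  have h1 : ∀ α ∈ II M, ∑ β ∈ nb (II M) ss (ss α), Ex p (fun S => |U α S| * VV p σ β S) ≤
      8 * σ⁻¹ ^ 2 * κ * e * (b 2 * b 3) * p ^ (ss α).card := by
    intro α hα
    have h2 : ∀ β ∈ nb (II M) ss (ss α), Ex p (fun S => |U α S| * VV p σ β S) ≤
        4 * σ⁻¹ ^ 2 * κ * p ^ (ss α ∪ ss β).card := by
      intro β hβ
      have := Ex_UV (σ := σ) hp hp1 hκ (Finset.mem_filter.1 hβ).1 (hU α hα) ∅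
      simpa [BB] using this
    refine (Finset.sum_le_sum h2).trans ?_
    rw [← Finset.mul_sum]
    have h3 := sum_nb h.card (ss α) (fun A => p ^ A.card) (fun A => by positivity)
    have h4 := chain_two h hp (by norm_num : 1 ≤ 2) (by norm_num) (cup_ss hα)
    have h5 := h3.trans (mul_le_mul_of_nonneg_left h4 (by positivity))
    refine (mul_le_mul_of_nonneg_left h5 (by positivity)).trans (le_of_eq ?_)
    ring
  refine (Finset.sum_le_sum h1).trans ?_
  rw [← Finset.mul_sum]
  have := h.bnn 2
  have := h.bnn 3
  refine (mul_le_mul_of_nonneg_left (chain_II h hp) (by positivity)).trans (le_of_eq ?_)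
  ring

lemma A5_le (h : Chain M p e b0 b) {U : ((Finset E × Finset E) × E) → Finset E → ℝ} {σ κ : ℝ}
    (hp : 0 < p) (hp1 : p < 1) (hκ : 0 ≤ κ) (hσ : 0 < σ)
    (hU : ∀ α ∈ II M, ∀ C, Ex p (fun S => |U α S| * BB C S) ≤ κ * p ^ (ss α ∪ C).card) :
    σ⁻¹ * ∑ α ∈ II M, ∑ γ ∈ near M (ss α), a5 p (II M) ss U (VV p σ) α γ ≤
      σ⁻¹ * (16 * σ⁻¹ ^ 2 * κ * e ^ 2 * (b0 * b 1 * b 2 * b 3 * b 4)) := by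
  refine mul_le_mul_of_nonneg_left ?_ (inv_pos.2 hσ).le
  have b2 := h.bnn 2
  have b3 := h.bnn 3
  have b4 := h.bnn 4
  have h1 : ∀ α ∈ II M, ∑ γ ∈ near M (ss α), a5 p (II M) ss U (VV p σ) α γ ≤
      16 * σ⁻¹ ^ 2 * κ * e * (b 2 * b 3 * b 4) * p ^ (ss α).card := by
    intro α hα
    have h6 : ∀ γ ∈ near M (ss α), a5 p (II M) ss U (VV p σ) α γ ≤
        16 * σ⁻¹ ^ 2 * κ * e * (b 3 * b 4) * p ^ (ss α ∪ γ).card := by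
      intro γ hγ
      have hγM : γ ∈ M := (Finset.mem_filter.1 hγ).1
      unfold a5
      have h2 : ∀ β ∈ nb (II M) ss (ss α ∪ γ), (Ex p (fun S => |U α S| * BB γ S * VV p σ β S) +
          Ex p (fun S => |U α S| * BB γ S) * Ex p (VV p σ β)) ≤
          8 * σ⁻¹ ^ 2 * κ * p ^ (ss α ∪ γ ∪ ss β).card := by
        intro β hβ
        have hβI := (Finset.mem_filter.1 hβ).1
        have g1 := Ex_UV (σ := σ) hp hp1 hκ hβI (hU α hα) γ
        have g2 := Ex_VV (σ := σ) hp hp1 hβI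
        have g3 := hU α hα γ
        have g4 : Ex p (fun S => |U α S| * BB γ S) * Ex p (VV p σ β) ≤
            (κ * p ^ (ss α ∪ γ).card) * (4 * σ⁻¹ ^ 2 * p ^ (ss β).card) :=
          mul_le_mul g3 g2 (Ex_nonneg hp.le hp1.le (VV_nonneg hp β)) (by positivity)
        have g5 := pow_card_le hp hp1 (Finset.card_union_le (ss α ∪ γ) (ss β))
        rw [pow_add] at g5
        have g6 : 0 ≤ 4 * σ⁻¹ ^ 2 * κ := by positivity
        have g7 := mul_le_mul_of_nonneg_left g5 g6
        linarith
      refine (Finset.sum_le_sum h2).trans ?_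
      rw [← Finset.mul_sum]
      have h3 := sum_nb h.card (ss α ∪ γ) (fun A => p ^ A.card) (fun A => by positivity)
      have h4 := chain_two h hp (by norm_num : 1 ≤ 3) (by norm_num) (cup_succ (cup_ss hα) hγM)
      have h5 := h3.trans (mul_le_mul_of_nonneg_left h4 (by positivity))
      refine (mul_le_mul_of_nonneg_left h5 (by positivity)).trans (le_of_eq ?_)
      ring
    refine (Finset.sum_le_sum h6).trans ?_
    rw [← Finset.mul_sum]
    refine (mul_le_mul_of_nonneg_left (h.step 2 _ (by norm_num) (by norm_num) (cup_ss hα))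
      (by positivity)).trans (le_of_eq ?_)
    ring
  refine (Finset.sum_le_sum h1).trans ?_
  rw [← Finset.mul_sum]
  refine (mul_le_mul_of_nonneg_left (chain_II h hp) (by positivity)).trans (le_of_eq ?_)
  ring

/-- Final abstract bound on theta. -/
theorem theta_abstract (h : Chain M p e b0 b) {σ D u : ℝ}
    (hp : 0 < p) (hp1 : p < 1) (hσ : 0 < σ) (hu : 0 ≤ u)
    (hD0 : 0 ≤ D) (hD : ∀ γ ∈ M, ((near M γ).card : ℝ) ≤ D)
    (hvar : Ex p (fun S => Wf M p σ S ^ 2) = 1) :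
    Ex p (fun S => (|Yf M p σ S| + |Zf M p σ S - 1|) * Real.exp (u * Wf M p σ S)) ≤
      2 * (Real.exp (u * D / σ) ^ 5 * (u * (2 * (1 - p) * e * (b0 * b 1 * b 2) / σ ^ 3) +
        √(16 * (1 - p) * e ^ 2 * (b0 * b 1 * b 2 * b 3) / σ ^ 4 +
          u * (32 * (1 - p) * e ^ 2 * (b0 * b 1 * b 2 * b 3 * b 4) / σ ^ 5)))) * Mg M p σ u := by
  have hq : 0 < 1 - p := by linarith
  have hκ : 0 ≤ 2 * (1 - p) * σ⁻¹ ^ 2 := by positivity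
  have b0n := h.b00
  have b1 := h.bnn 1
  have b2 := h.bnn 2
  have b3 := h.bnn 3
  have b4 := h.bnn 4
  have e3 : σ⁻¹ * (2 * (1 - p) * σ⁻¹ ^ 2 * e * (b0 * b 1 * b 2)) =
    2 * (1 - p) * e * (b0 * b 1 * b 2) / σ ^ 3 := by field_simp
  have e4 : 8 * σ⁻¹ ^ 2 * (2 * (1 - p) * σ⁻¹ ^ 2) * e ^ 2 * (b0 * b 1 * b 2 * b 3) =
    16 * (1 - p) * e ^ 2 * (b0 * b 1 * b 2 * b 3) / σ ^ 4 := by field_simp; ring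
  have e5 : σ⁻¹ * (16 * σ⁻¹ ^ 2 * (2 * (1 - p) * σ⁻¹ ^ 2) * e ^ 2 * (b0 * b 1 * b 2 * b 3 * b 4)) =
    32 * (1 - p) * e ^ 2 * (b0 * b 1 * b 2 * b 3 * b 4) / σ ^ 5 := by field_simp; ring
  have Y := fam_main (famY (σ := σ) hp hp1 hD0 hD) hp hp1 hσ hu
    ((A3_le h hp hp1 hκ hσ (fun α hα C => UY_bound hp hp1 hα C)).trans e3.le)
    ((A4_le h hp hp1 hκ hσ (fun α hα C => UY_bound hp hp1 hα C)).trans e4.le)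
    ((A5_le h hp hp1 hκ hσ (fun α hα C => UY_bound hp hp1 hα C)).trans e5.le)
    (by positivity) (by positivity)
  have Z := fam_main (famZ (σ := σ) hp hp1 hD0 hD) hp hp1 hσ hu
    ((A3_le h hp hp1 hκ hσ (fun α hα C => UZ_bound hp hp1 hα C)).trans e3.le)
    ((A4_le h hp hp1 hκ hσ (fun α hα C => UZ_bound hp hp1 hα C)).trans e4.le)
    ((A5_le h hp hp1 hκ hσ (fun α hα C => UZ_bound hp hp1 hα C)).trans e5.le)
    (by positivity) (by positivity)
  simp only [← UY_sum] at Y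
  simp only [← UZ_sum M p σ hvar] at Z
  simp only [add_mul, Ex_add]
  linarith

end Chains
end CMD

open MeasureTheory ProbabilityTheory
open scoped Classical
set_option linter.unusedSectionVars false
set_option linter.unusedSimpArgs false
set_option linter.unusedVariables false

namespace CMD
section Emb
variable {V₀ : Type*} [Fintype V₀] [DecidableEq V₀] (G₀ : SimpleGraph V₀) [DecidableRel G₀.Adj]
  {n : ℕ}

/-- Image of the edge set. -/
noncomputable def im (f : V₀ ↪ Fin n) : Finset (Sym2 (Fin n)) :=
  G₀.edgeFinset.image (Sym2.map ⇑f)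

lemma mem_copy {Γ : Finset (Sym2 (Fin n))} : Γ ∈ copyFinset G₀ n ↔ ∃ f : V₀ ↪ Fin n, Γ = im G₀ f := by
  simp [copyFinset, im]

lemma im_mem (f : V₀ ↪ Fin n) : im G₀ f ∈ copyFinset G₀ n := (mem_copy G₀).2 ⟨f, rfl⟩

lemma map_inj (f : V₀ ↪ Fin n) : Function.Injective (Sym2.map ⇑f) := Sym2.map.injective f.injective

lemma im_card (f : V₀ ↪ Fin n) : (im G₀ f).card = G₀.edgeFinset.card :=
  Finset.card_image_of_injective _ (map_inj f)

lemma mem_im (f : V₀ ↪ Fin n) (x y : V₀) : s(f x, f y) ∈ im G₀ f ↔ G₀.Adj x y := by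
  unfold im
  rw [show s(f x, f y) = Sym2.map (⇑f) s(x, y) from rfl, (map_inj f).mem_finset_image]
  simp

instance finAut : Finite (G₀ ≃g G₀) :=
  Finite.of_injective (fun φ : G₀ ≃g G₀ => φ.toEquiv) (fun a b h => by
    ext x; exact congrArg (fun e : V₀ ≃ V₀ => e x) h)

lemma aut_pos : 0 < Nat.card (G₀ ≃g G₀) := by
  have : Nonempty (G₀ ≃g G₀) := ⟨RelIso.refl _⟩
  exact Nat.card_pos

lemma aut_le : Nat.card (G₀ ≃g G₀) ≤ (Fintype.card V₀).factorial := by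
  have := Nat.card_le_card_of_injective (fun φ : G₀ ≃g G₀ => φ.toEquiv) (fun a b h => by
    ext x; exact congrArg (fun e : V₀ ≃ V₀ => e x) h)
  rwa [Nat.card_eq_fintype_card (α := V₀ ≃ V₀), Fintype.card_equiv (Equiv.refl V₀)] at this

lemma fiber_ge (f₀ : V₀ ↪ Fin n) :
    Nat.card (G₀ ≃g G₀) ≤ (Finset.univ.filter (fun f : V₀ ↪ Fin n => im G₀ f = im G₀ f₀)).card := by
  have h : ∀ φ : G₀ ≃g G₀, im G₀ (φ.toEquiv.toEmbedding.trans f₀) = im G₀ f₀ := by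
    intro φ
    ext k
    induction k using Sym2.ind with
    | _ i j =>
    simp only [im, Finset.mem_image, SimpleGraph.mem_edgeFinset]
    constructor
    · rintro ⟨ed, h1, h2⟩
      induction ed using Sym2.ind with
      | _ x y =>
      exact ⟨s(φ x, φ y), by
        rw [SimpleGraph.mem_edgeSet] at h1 ⊢
        exact φ.map_rel_iff.2 h1, h2⟩
    · rintro ⟨ed, h1, h2⟩
      induction ed using Sym2.ind with
      | _ x y =>
      refine ⟨s(φ.symm x, φ.symm y), by
        rw [SimpleGraph.mem_edgeSet] at h1 ⊢
        exact φ.symm.map_rel_iff.2 h1, ?_⟩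
      rw [← h2]
      simp
  have := Nat.card_le_card_of_injective
    (β := {f : V₀ ↪ Fin n // im G₀ f = im G₀ f₀})
    (fun φ : G₀ ≃g G₀ => ⟨φ.toEquiv.toEmbedding.trans f₀, h φ⟩) (fun a b hab => by
      ext x
      have h2 := congrArg (fun f : {f : V₀ ↪ Fin n // im G₀ f = im G₀ f₀} => f.1 x) hab
      exact f₀.injective h2)
  rwa [Nat.card_eq_fintype_card (α := {f : V₀ ↪ Fin n // im G₀ f = im G₀ f₀}),
    Fintype.card_subtype] at this

lemma fiber_le (hniso : ∀ v : V₀, ∃ w, G₀.Adj v w) (f₀ : V₀ ↪ Fin n) :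
    (Finset.univ.filter (fun f : V₀ ↪ Fin n => im G₀ f = im G₀ f₀)).card ≤ Nat.card (G₀ ≃g G₀) := by
  have hr : ∀ f : V₀ ↪ Fin n, im G₀ f = im G₀ f₀ → ∀ x, ∃ y, f₀ y = f x := by
    intro f hf x
    obtain ⟨w, hw⟩ := hniso x
    have h1 := (mem_im G₀ f x w).2 hw
    rw [hf] at h1
    simp only [im, Finset.mem_image] at h1
    obtain ⟨ed, _, h2⟩ := h1
    induction ed using Sym2.ind with
    | _ a b =>
    rw [Sym2.map_mk] at h2
    rcases Sym2.eq_iff.1 h2 with h | h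
    · exact ⟨a, h.1⟩
    · exact ⟨b, h.2⟩
  choose! g hg using hr
  have hinj : ∀ f : V₀ ↪ Fin n, im G₀ f = im G₀ f₀ → Function.Bijective (g f) := by
    intro f hf
    refine Finite.injective_iff_bijective.1 fun x y hxy => f.injective ?_
    rw [← hg f hf x, ← hg f hf y, hxy]
  let F : {f : V₀ ↪ Fin n // im G₀ f = im G₀ f₀} → (G₀ ≃g G₀) := fun f =>
    { toEquiv := Equiv.ofBijective (g f.1) (hinj f.1 f.2)
      map_rel_iff' := by
        intro x y
        simp only [Equiv.ofBijective_apply]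
        obtain ⟨f, hf⟩ := f
        simp only
        rw [← mem_im G₀ f₀, hg f hf, hg f hf, ← mem_im G₀ f x y, hf] }
  have := Nat.card_le_card_of_injective F (fun a b hab => by
    ext x
    have h2 : g a.1 x = g b.1 x := congrArg (fun φ : G₀ ≃g G₀ => φ x) hab
    rw [← hg a.1 a.2 x, ← hg b.1 b.2 x, h2])
  rwa [Nat.card_eq_fintype_card (α := {f : V₀ ↪ Fin n // im G₀ f = im G₀ f₀}),
    Fintype.card_subtype] at this

lemma sum_copy (hniso : ∀ v : V₀, ∃ w, G₀.Adj v w) (h : Finset (Sym2 (Fin n)) → ℝ) :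
    ∑ f : V₀ ↪ Fin n, h (im G₀ f) = Nat.card (G₀ ≃g G₀) * ∑ Γ ∈ copyFinset G₀ n, h Γ := by
  rw [← Finset.sum_fiberwise_of_maps_to (s := Finset.univ) (t := copyFinset G₀ n)
    (g := fun f : V₀ ↪ Fin n => im G₀ f) (fun f _ => im_mem G₀ f), Finset.mul_sum]
  apply Finset.sum_congr rfl
  intro Γ hΓ
  obtain ⟨f₀, rfl⟩ := (mem_copy G₀).1 hΓ
  have e1 : ∑ f ∈ Finset.univ.filter (fun f : V₀ ↪ Fin n => im G₀ f = im G₀ f₀), h (im G₀ f) =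
    ∑ f ∈ Finset.univ.filter (fun f : V₀ ↪ Fin n => im G₀ f = im G₀ f₀), h (im G₀ f₀) :=
    Finset.sum_congr rfl fun f hf => by rw [(Finset.mem_filter.1 hf).2]
  rw [e1, Finset.sum_const, nsmul_eq_mul,
    le_antisymm (fiber_le G₀ hniso f₀) (fiber_ge G₀ f₀)]

/-- vertices of an edge set -/
noncomputable def vert {W : Type*} [Fintype W] (A : Finset (Sym2 W)) : Finset W :=
  Finset.univ.filter (fun v => ∃ e ∈ A, v ∈ e)

lemma mem_vert {W : Type*} [Fintype W] {A : Finset (Sym2 W)} {v : W} :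
    v ∈ vert A ↔ ∃ e ∈ A, v ∈ e := by simp [vert]

lemma vert_im (f : V₀ ↪ Fin n) : (vert (im G₀ f)).card ≤ Fintype.card V₀ := by
  have : vert (im G₀ f) ⊆ Finset.univ.image f := by
    intro v hv
    obtain ⟨k, hk, hvk⟩ := mem_vert.1 hv
    simp only [im, Finset.mem_image] at hk
    obtain ⟨ed, _, rfl⟩ := hk
    rw [Sym2.mem_map] at hvk
    obtain ⟨x, _, rfl⟩ := hvk
    simp
  exact (Finset.card_le_card this).trans (Finset.card_image_le)

lemma vert_union {W : Type*} [Fintype W] [DecidableEq W] (A B : Finset (Sym2 W)) :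
    (vert (A ∪ B)).card ≤ (vert A).card + (vert B).card := by
  refine le_trans (Finset.card_le_card ?_) (Finset.card_union_le _ _)
  intro v hv
  obtain ⟨k, hk, hvk⟩ := mem_vert.1 hv
  rcases Finset.mem_union.1 hk with h | h
  · exact Finset.mem_union_left _ (mem_vert.2 ⟨k, h, hvk⟩)
  · exact Finset.mem_union_right _ (mem_vert.2 ⟨k, h, hvk⟩)

lemma vert_cup : ∀ (j : ℕ) (A : Finset (Sym2 (Fin n))), cup (copyFinset G₀ n) j A →
    (vert A).card ≤ j * Fintype.card V₀ := by
  intro j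
  induction j with
  | zero =>
    intro A hA
    have : A = ∅ := hA
    subst this
    simp [vert]
  | succ j ih =>
    rintro A ⟨B, γ, hB, hγ, rfl⟩
    obtain ⟨f, rfl⟩ := (mem_copy G₀).1 hγ
    have h1 := vert_union B (im G₀ f)
    have h2 := ih B hB
    have h3 := vert_im G₀ f
    nlinarith

lemma count_emb (U : Finset V₀) (A : Finset (Fin n)) :
    (Finset.univ.filter (fun f : V₀ ↪ Fin n => ∀ v ∈ U, f v ∈ A)).card ≤
      A.card.descFactorial U.card * n ^ (Fintype.card V₀ - U.card) := by
  rw [← Fintype.card_subtype]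
  let F : {f : V₀ ↪ Fin n // ∀ v ∈ U, f v ∈ A} → (U ↪ A) × ((Uᶜ : Finset V₀) → Fin n) := fun f =>
    (⟨fun v => ⟨f.1 v, f.2 v v.2⟩, fun x y h => by
      have := congrArg Subtype.val h
      exact Subtype.ext (f.1.injective this)⟩, fun v => f.1 v)
  have hF : Function.Injective F := by
    intro a b hab
    ext1; ext1 x
    by_cases hx : x ∈ U
    · have h1 := congrArg (fun z => ((z.1 ⟨x, hx⟩ : A) : Fin n)) hab
      exact h1
    · have h1 := congrArg (fun z => z.2 ⟨x, by simpa using hx⟩) hab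
      exact h1
  refine (Fintype.card_le_of_injective F hF).trans (le_of_eq ?_)
  rw [Fintype.card_prod, Fintype.card_embedding_eq, Fintype.card_fun, Fintype.card_coe,
    Fintype.card_coe, Fintype.card_fin, Fintype.card_coe, Finset.card_compl]

end Emb
end CMD

open MeasureTheory ProbabilityTheory
open scoped Classical
set_option linter.unusedSectionVars false
set_option linter.unusedSimpArgs false
set_option linter.unusedVariables false

namespace CMD
section Cnt
variable {V₀ : Type*} [Fintype V₀] [DecidableEq V₀] (G₀ : SimpleGraph V₀) [DecidableRel G₀.Adj]
  {n : ℕ}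

lemma psi_set (p : ℝ) : {x : ℝ | ∃ S ⊆ G₀.edgeFinset, S.Nonempty ∧
    x = (n : ℝ) ^ (Finset.univ.filter (fun v : V₀ => ∃ e ∈ S, v ∈ e)).card * p ^ S.card} =
    ↑((G₀.edgeFinset.powerset.filter (fun S => S.Nonempty)).image
      (fun S => (n : ℝ) ^ (vert S).card * p ^ S.card)) := by
  ext x
  simp only [Set.mem_ofPred_eq, Finset.coe_image, Set.mem_image, Finset.mem_coe, Finset.mem_filter,
    Finset.mem_powerset]
  constructor
  · rintro ⟨S, h1, h2, h3⟩
    refine ⟨S, ⟨h1, h2⟩, ?_⟩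
    rw [h3]; unfold vert; congr!
  · rintro ⟨S, ⟨h1, h2⟩, h3⟩
    refine ⟨S, h1, h2, ?_⟩
    rw [← h3]; unfold vert; congr!

lemma psi_le (p : ℝ) {S : Finset (Sym2 V₀)} (hS : S ⊆ G₀.edgeFinset) (hne : S.Nonempty) :
    PsiMin G₀ n p ≤ (n : ℝ) ^ (vert S).card * p ^ S.card := by
  unfold PsiMin
  rw [psi_set]
  apply csInf_le (Finset.bddBelow _)
  simp only [Finset.coe_image, Set.mem_image, Finset.mem_coe, Finset.mem_filter,
    Finset.mem_powerset]
  exact ⟨S, ⟨hS, hne⟩, rfl⟩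

lemma psi_att (hedge : G₀.edgeFinset.Nonempty) (p : ℝ) : ∃ S ⊆ G₀.edgeFinset, S.Nonempty ∧
    PsiMin G₀ n p = (n : ℝ) ^ (vert S).card * p ^ S.card := by
  have h : PsiMin G₀ n p ∈ (↑((G₀.edgeFinset.powerset.filter (fun S => S.Nonempty)).image
      (fun S => (n : ℝ) ^ (vert S).card * p ^ S.card)) : Set ℝ) := by
    unfold PsiMin
    rw [psi_set]
    apply Set.Nonempty.csInf_mem
    · refine ⟨_, Finset.mem_coe.2 (Finset.mem_image_of_mem _ (a := G₀.edgeFinset) ?_)⟩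
      simp [hedge]
    · exact Finset.finite_toSet _
  simp only [Finset.coe_image, Set.mem_image, Finset.mem_coe, Finset.mem_filter,
    Finset.mem_powerset] at h
  obtain ⟨S, ⟨h1, h2⟩, h3⟩ := h
  exact ⟨S, h1, h2, h3.symm⟩

lemma psi_pos (hedge : G₀.edgeFinset.Nonempty) {p : ℝ} (hp : 0 < p) (hn : 0 < n) :
    0 < PsiMin G₀ n p := by
  obtain ⟨S, _, _, h⟩ := psi_att G₀ (n := n) hedge p
  rw [h]
  have : (0 : ℝ) < n := by exact_mod_cast hn
  positivity

/-- edges mapped into `A` -/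
noncomputable def Sf (A : Finset (Sym2 (Fin n))) (f : V₀ ↪ Fin n) : Finset (Sym2 V₀) :=
  G₀.edgeFinset.filter (fun ed => Sym2.map (⇑f) ed ∈ A)

lemma Sf_card (A : Finset (Sym2 (Fin n))) (f : V₀ ↪ Fin n) :
    (im G₀ f ∩ A).card = (Sf G₀ A f).card := by
  have : im G₀ f ∩ A = (Sf G₀ A f).image (Sym2.map (⇑f)) := by
    ext k
    simp only [im, Sf, Finset.mem_inter, Finset.mem_image, Finset.mem_filter]
    constructor
    · rintro ⟨⟨ed, h1, rfl⟩, h2⟩; exact ⟨ed, ⟨h1, h2⟩, rfl⟩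
    · rintro ⟨ed, ⟨h1, h2⟩, rfl⟩; exact ⟨⟨ed, h1, rfl⟩, h2⟩
  rw [this, Finset.card_image_of_injective _ (map_inj f)]

lemma Sf_vert (A : Finset (Sym2 (Fin n))) (f : V₀ ↪ Fin n) : ∀ v ∈ vert (Sf G₀ A f), f v ∈ vert A := by
  intro v hv
  obtain ⟨ed, h1, h2⟩ := mem_vert.1 hv
  simp only [Sf, Finset.mem_filter] at h1
  exact mem_vert.2 ⟨_, h1.2, Sym2.mem_map.2 ⟨v, h2, rfl⟩⟩

lemma step_bound (hniso : ∀ v : V₀, ∃ w, G₀.Adj v w) (hedge : G₀.edgeFinset.Nonempty)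
    {p : ℝ} (hp : 0 < p) (hn : 0 < n) (A : Finset (Sym2 (Fin n))) {C : ℝ}
    (hC : ∀ k, k ≤ Fintype.card V₀ → ((vert A).card.descFactorial k : ℝ) ≤ C) :
    ∑ γ ∈ near (copyFinset G₀ n) A, p ^ (A ∪ γ).card ≤
      2 ^ G₀.edgeFinset.card * C * ((n : ℝ) ^ Fintype.card V₀ * p ^ G₀.edgeFinset.card /
        (Nat.card (G₀ ≃g G₀) * PsiMin G₀ n p)) * p ^ A.card := by
  have hn' : (0 : ℝ) < n := by exact_mod_cast hn
  have hΨ := psi_pos G₀ (n := n) hedge hp hn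
  have ha : (0 : ℝ) < Nat.card (G₀ ≃g G₀) := by exact_mod_cast aut_pos G₀
  have hC0 : 0 ≤ C := le_trans (by positivity) (hC 0 (Nat.zero_le _))
  set Ψ := PsiMin G₀ n p
  set e := G₀.edgeFinset.card
  set v := Fintype.card V₀
  have h1 := sum_copy G₀ (n := n) hniso
    (fun γ => if (γ ∩ A).Nonempty then p ^ (A ∪ γ).card else 0)
  have hR : ∑ Γ ∈ copyFinset G₀ n, (if (Γ ∩ A).Nonempty then p ^ (A ∪ Γ).card else 0) =
      ∑ γ ∈ copyFinset G₀ n with (γ ∩ A).Nonempty, p ^ (A ∪ γ).card :=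
    (Finset.sum_filter _ _).symm
  rw [hR] at h1
  have hm : ∀ f ∈ (Finset.univ : Finset (V₀ ↪ Fin n)), Sf G₀ A f ∈ G₀.edgeFinset.powerset :=
    fun f _ => Finset.mem_powerset.2 (Finset.filter_subset _ _)
  rw [← Finset.sum_fiberwise_of_maps_to hm] at h1
  have h2 : ∀ S ∈ G₀.edgeFinset.powerset, ∑ f ∈ Finset.univ.filter (fun f => Sf G₀ A f = S),
      (if (im G₀ f ∩ A).Nonempty then p ^ (A ∪ im G₀ f).card else 0) ≤
      C * (n ^ v * p ^ e / Ψ) * p ^ A.card := by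
    intro S hS
    rw [Finset.mem_powerset] at hS
    rcases S.eq_empty_or_nonempty with h0 | hne
    · rw [Finset.sum_eq_zero]
      · positivity
      · intro f hf
        have h3 := (Finset.mem_filter.1 hf).2
        rw [if_neg]
        rw [← Finset.card_pos, Sf_card, h3, h0]
        simp
    · have hSe : S.card ≤ e := Finset.card_le_card hS
      have hSv : (vert S).card ≤ v := Finset.card_le_univ _
      have h4 : ∀ f ∈ Finset.univ.filter (fun f : V₀ ↪ Fin n => Sf G₀ A f = S),
          (if (im G₀ f ∩ A).Nonempty then p ^ (A ∪ im G₀ f).card else 0) ≤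
            p ^ A.card * p ^ (e - S.card) := by
        intro f hf
        have h3 := (Finset.mem_filter.1 hf).2
        have h5 : (A ∪ im G₀ f).card = A.card + (e - S.card) := by
          have h6 := Finset.card_union_add_card_inter A (im G₀ f)
          rw [Finset.inter_comm, Sf_card, h3, im_card] at h6
          omega
        split_ifs
        · rw [h5, pow_add]
        · positivity
      refine (Finset.sum_le_sum h4).trans ?_
      rw [Finset.sum_const, nsmul_eq_mul]
      have h7 : ((Finset.univ.filter (fun f : V₀ ↪ Fin n => Sf G₀ A f = S)).card : ℝ) ≤
          C * (n : ℝ) ^ (v - (vert S).card) := by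
        have h8 : (Finset.univ.filter (fun f : V₀ ↪ Fin n => Sf G₀ A f = S)).card ≤
          (vert A).card.descFactorial (vert S).card * n ^ (v - (vert S).card) := by
          refine le_trans (Finset.card_le_card ?_) (count_emb (vert S) (vert A))
          intro f hf
          have h3 := (Finset.mem_filter.1 hf).2
          rw [Finset.mem_filter]
          refine ⟨Finset.mem_univ _, ?_⟩
          rw [← h3]
          exact Sf_vert G₀ A f
        have h9 : ((Finset.univ.filter (fun f : V₀ ↪ Fin n => Sf G₀ A f = S)).card : ℝ) ≤
          (vert A).card.descFactorial (vert S).card * (n : ℝ) ^ (v - (vert S).card) := by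
          exact_mod_cast h8
        exact h9.trans (mul_le_mul_of_nonneg_right (hC _ hSv) (by positivity))
      have h10 : (n : ℝ) ^ (v - (vert S).card) * p ^ (e - S.card) ≤ n ^ v * p ^ e / Ψ := by
        rw [le_div_iff₀ hΨ]
        refine (mul_le_mul_of_nonneg_left (psi_le G₀ (n := n) p hS hne) (by positivity)).trans
          (le_of_eq ?_)
        rw [mul_mul_mul_comm, ← pow_add, ← pow_add, Nat.sub_add_cancel hSv, Nat.sub_add_cancel hSe]
      calc _ ≤ C * (n : ℝ) ^ (v - (vert S).card) * (p ^ A.card * p ^ (e - S.card)) :=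
            mul_le_mul_of_nonneg_right h7 (by positivity)
        _ = C * p ^ A.card * ((n : ℝ) ^ (v - (vert S).card) * p ^ (e - S.card)) := by ring
        _ ≤ C * p ^ A.card * (n ^ v * p ^ e / Ψ) := mul_le_mul_of_nonneg_left h10 (by positivity)
        _ = _ := by ring
  have h3 := Finset.sum_le_sum h2
  rw [h1, Finset.sum_const, Finset.card_powerset, nsmul_eq_mul] at h3
  have h4 : ∑ γ ∈ near (copyFinset G₀ n) A, p ^ (A ∪ γ).card =
    (Nat.card (G₀ ≃g G₀) * ∑ γ ∈ copyFinset G₀ n with (γ ∩ A).Nonempty, p ^ (A ∪ γ).card) /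
      Nat.card (G₀ ≃g G₀) := by
    unfold near; field_simp
  rw [h4, div_le_iff₀ ha]
  refine h3.trans (le_of_eq ?_)
  push_cast
  field_simp
  exact mul_comm _ _

lemma first_bound (hniso : ∀ v : V₀, ∃ w, G₀.Adj v w) {p : ℝ} (hp : 0 < p) :
    ∑ γ ∈ copyFinset G₀ n, p ^ γ.card ≤
      (n : ℝ) ^ Fintype.card V₀ * p ^ G₀.edgeFinset.card / Nat.card (G₀ ≃g G₀) := by
  have ha : (0 : ℝ) < Nat.card (G₀ ≃g G₀) := by exact_mod_cast aut_pos G₀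
  rw [le_div_iff₀ ha, mul_comm, ← sum_copy G₀ hniso]
  simp only [im_card]
  rw [Finset.sum_const, nsmul_eq_mul]
  refine mul_le_mul_of_nonneg_right ?_ (by positivity)
  have := count_emb (∅ : Finset V₀) (∅ : Finset (Fin n))
  have h2 : (Finset.univ : Finset (V₀ ↪ Fin n)).card ≤ n ^ Fintype.card V₀ := by simpa using this
  exact_mod_cast h2

lemma vert_edge (x y : V₀) (h : x ≠ y) : (vert ({s(x, y)} : Finset (Sym2 V₀))).card = 2 := by
  have : vert ({s(x, y)} : Finset (Sym2 V₀)) = {x, y} := by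
    ext z; simp [mem_vert]
  rw [this, Finset.card_pair h]

lemma vert_edge_le (k : Sym2 (Fin n)) : (vert ({k} : Finset (Sym2 (Fin n)))).card ≤ 2 := by
  induction k using Sym2.ind with
  | _ x y =>
  have : vert ({s(x, y)} : Finset (Sym2 (Fin n))) = {x, y} := by
    ext z; simp [mem_vert]
  rw [this]; exact Finset.card_le_two

lemma near_bound (hniso : ∀ v : V₀, ∃ w, G₀.Adj v w) {Γ : Finset (Sym2 (Fin n))}
    (hΓ : Γ ∈ copyFinset G₀ n) :
    (Nat.card (G₀ ≃g G₀) : ℝ) * (near (copyFinset G₀ n) Γ).card ≤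
      2 * (G₀.edgeFinset.card : ℝ) ^ 2 * (n : ℝ) ^ (Fintype.card V₀ - 2) := by
  have h1 := sum_copy G₀ (n := n) hniso (fun γ => if (γ ∩ Γ).Nonempty then 1 else 0)
  rw [← Finset.sum_filter, ← Finset.sum_filter, Finset.sum_const, Finset.sum_const, nsmul_eq_mul, nsmul_eq_mul,
    mul_one, mul_one] at h1
  unfold near
  rw [← h1]
  have h2 : (Finset.univ.filter (fun f : V₀ ↪ Fin n => (im G₀ f ∩ Γ).Nonempty)).card ≤
      ∑ x ∈ G₀.edgeFinset ×ˢ Γ, 2 * n ^ (Fintype.card V₀ - 2) := by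
    have h3 : (Finset.univ.filter (fun f : V₀ ↪ Fin n => (im G₀ f ∩ Γ).Nonempty)) ⊆
      (G₀.edgeFinset ×ˢ Γ).biUnion (fun x => Finset.univ.filter (fun f : V₀ ↪ Fin n =>
        ∀ v ∈ vert {x.1}, f v ∈ vert {x.2})) := by
      intro f hf
      obtain ⟨k, hk⟩ := (Finset.mem_filter.1 hf).2
      simp only [im, Finset.mem_inter, Finset.mem_image] at hk
      obtain ⟨⟨ed, h4, rfl⟩, h5⟩ := hk
      rw [Finset.mem_biUnion]
      refine ⟨(ed, Sym2.map (⇑f) ed), Finset.mem_product.2 ⟨h4, h5⟩, ?_⟩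
      simp only [Finset.mem_filter, Finset.mem_univ, true_and, mem_vert, Finset.mem_singleton,
        exists_eq_left]
      intro v hv
      exact Sym2.mem_map.2 ⟨v, hv, rfl⟩
    refine (Finset.card_le_card h3).trans (Finset.card_biUnion_le.trans ?_)
    refine Finset.sum_le_sum fun x hx => ?_
    refine (count_emb _ _).trans ?_
    have hx1 := (Finset.mem_product.1 hx).1
    have e2 : (vert {x.1}).card = 2 := by
      obtain ⟨ed, k⟩ := x
      simp only at hx1 ⊢
      induction ed using Sym2.ind with
      | _ a b =>
      exact vert_edge a b (by
        rw [SimpleGraph.mem_edgeFinset, SimpleGraph.mem_edgeSet] at hx1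
        exact hx1.ne)
    rw [e2]
    refine Nat.mul_le_mul_right _ ?_
    exact (Nat.descFactorial_le 2 (vert_edge_le x.2)).trans (le_of_eq rfl)
  rw [Finset.sum_const, Finset.card_product, smul_eq_mul] at h2
  obtain ⟨f₀, rfl⟩ := (mem_copy G₀).1 hΓ
  rw [im_card] at h2
  have h3 : ((Finset.univ.filter (fun f : V₀ ↪ Fin n => (im G₀ f ∩ im G₀ f₀).Nonempty)).card : ℝ) ≤
    (G₀.edgeFinset.card * G₀.edgeFinset.card) * (2 * n ^ (Fintype.card V₀ - 2)) := by exact_mod_cast h2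
  refine h3.trans (le_of_eq ?_)
  ring

end Cnt
end CMD

open MeasureTheory ProbabilityTheory
open scoped Classical
set_option linter.unusedSectionVars false
set_option linter.unusedSimpArgs false
set_option linter.unusedVariables false

namespace CMD
section Ch
variable {V₀ : Type*} [Fintype V₀] [DecidableEq V₀] (G₀ : SimpleGraph V₀) [DecidableRel G₀.Adj]
  {n : ℕ}

lemma v_le (hniso : ∀ v : V₀, ∃ w, G₀.Adj v w) : Fintype.card V₀ ≤ 2 * G₀.edgeFinset.card := by
  rw [← G₀.sum_degrees_eq_twice_card_edges]
  calc Fintype.card V₀ = ∑ v : V₀, 1 := by simp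
    _ ≤ _ := Finset.sum_le_sum fun v _ => by
      obtain ⟨w, hw⟩ := hniso v
      exact Nat.succ_le_of_lt ((G₀.degree_pos_iff_exists_adj v).2 ⟨w, hw⟩)

lemma e_le : 2 * G₀.edgeFinset.card ≤ Fintype.card V₀ ^ 2 := by
  rw [← G₀.sum_degrees_eq_twice_card_edges]
  calc _ ≤ ∑ v : V₀, Fintype.card V₀ := Finset.sum_le_sum fun v _ => (G₀.degree_lt_card_verts v).le
    _ = _ := by simp [sq]

lemma v_ge (hedge : G₀.edgeFinset.Nonempty) : 2 ≤ Fintype.card V₀ := by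
  have h1 := e_le G₀
  have h2 := hedge.card_pos
  by_contra h
  have : Fintype.card V₀ ≤ 1 := by omega
  have : Fintype.card V₀ ^ 2 ≤ 1 := by
    calc _ ≤ 1 ^ 2 := Nat.pow_le_pow_left this 2
      _ = 1 := by norm_num
  omega

/-- step constants -/
noncomputable def bb (e v j : ℕ) (X : ℝ) : ℝ :=
  if j = 1 then 2 ^ e * (v.factorial : ℝ) * X else 2 ^ e * (2 ^ (j * v) * (v.factorial : ℝ)) * X

lemma bb_nonneg (e v j : ℕ) {X : ℝ} (hX : 0 ≤ X) : 0 ≤ bb e v j X := by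
  unfold bb; split_ifs <;> positivity

lemma chain_inst (hniso : ∀ v : V₀, ∃ w, G₀.Adj v w) (hedge : G₀.edgeFinset.Nonempty)
    {p : ℝ} (hp : 0 < p) (hn : 0 < n) :
    Chain (copyFinset G₀ n) p G₀.edgeFinset.card
      ((n : ℝ) ^ Fintype.card V₀ * p ^ G₀.edgeFinset.card / Nat.card (G₀ ≃g G₀))
      (fun j => bb G₀.edgeFinset.card (Fintype.card V₀) j
        ((n : ℝ) ^ Fintype.card V₀ * p ^ G₀.edgeFinset.card /
          (Nat.card (G₀ ≃g G₀) * PsiMin G₀ n p))) where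
  card := by
    intro γ hγ
    obtain ⟨f, rfl⟩ := (mem_copy G₀).1 hγ
    exact im_card G₀ f
  first := first_bound G₀ hniso hp
  b00 := by positivity
  bnn := by
    intro j
    have := psi_pos G₀ (n := n) hedge hp hn
    exact bb_nonneg _ _ _ (by positivity)
  step := by
    intro j A h1 h4 hA
    have hv := vert_cup G₀ j A hA
    unfold bb
    split_ifs with hj
    · subst hj
      apply step_bound G₀ hniso hedge hp hn A
      intro k hk
      rw [one_mul] at hv
      have : (vert A).card.descFactorial k ≤ (Fintype.card V₀).factorial := by
        refine (Nat.descFactorial_le k hv).trans ?_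
        have := Nat.factorial_mul_descFactorial hk
        rw [← this]
        exact Nat.le_mul_of_pos_left _ (Nat.factorial_pos _)
      exact_mod_cast this
    · apply step_bound G₀ hniso hedge hp hn A
      intro k hk
      have : (vert A).card.descFactorial k ≤ 2 ^ (j * Fintype.card V₀) * (Fintype.card V₀).factorial := by
        refine (Nat.descFactorial_le k hv).trans ?_
        rw [Nat.descFactorial_eq_factorial_mul_choose, mul_comm]
        exact Nat.mul_le_mul (Nat.choose_le_two_pow _ _) (Nat.factorial_le hk)
      exact_mod_cast this

lemma desc_lower {v n : ℕ} (hn : 4 * v ^ 2 ≤ n) (hn0 : 0 < n) :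
    (3 / 4 : ℝ) * (n : ℝ) ^ v ≤ (n.descFactorial v : ℝ) := by
  have hn' : (0 : ℝ) < n := by exact_mod_cast hn0
  have hvn : v ≤ n := by nlinarith [sq_nonneg v]
  have h1 : ((n : ℝ) - v) ^ v ≤ (n.descFactorial v : ℝ) := by
    have := Nat.pow_sub_le_descFactorial n v
    have h2 : ((n - v : ℕ) : ℝ) ^ v ≤ ((n + 1 - v : ℕ) : ℝ) ^ v := by
      gcongr; omega
    rw [Nat.cast_sub hvn] at h2
    exact h2.trans (by exact_mod_cast this)
  refine le_trans ?_ h1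
  have h3 : (n : ℝ) - v = n * (1 + (-(v / n : ℝ))) := by field_simp; ring
  rw [h3, mul_pow, mul_comm]
  refine mul_le_mul_of_nonneg_left ?_ (by positivity)
  have h4 : (v / n : ℝ) ≤ 1 := by
    rw [div_le_one hn']; exact_mod_cast hvn
  refine le_trans ?_ (one_add_mul_le_pow (by linarith) v)
  have h5 : (v : ℝ) * (v / n) ≤ 1 / 4 := by
    rw [← mul_div_assoc, div_le_iff₀ hn']
    have : (4 : ℝ) * v ^ 2 ≤ n := by exact_mod_cast hn
    nlinarith
  linarith

/-- pairs agreeing on U -/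
lemma pair_count (U : Finset V₀) :
    ((n.descFactorial (Fintype.card V₀) : ℝ)) ^ 2 ≤ (n : ℝ) ^ U.card *
      ∑ f : V₀ ↪ Fin n, ∑ f' : V₀ ↪ Fin n, (if ∀ v ∈ U, f v = f' v then (1 : ℝ) else 0) := by
  let R : (V₀ ↪ Fin n) → (U → Fin n) := fun f v => f v
  let N : (U → Fin n) → ℝ := fun g => ∑ f : V₀ ↪ Fin n, if R f = g then 1 else 0
  have h1 : ∑ g, N g = (n.descFactorial (Fintype.card V₀) : ℝ) := by
    simp only [N]
    rw [Finset.sum_comm]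
    simp
  have h2 : ∑ f : V₀ ↪ Fin n, ∑ f' : V₀ ↪ Fin n, (if ∀ v ∈ U, f v = f' v then (1 : ℝ) else 0) =
      ∑ g, N g ^ 2 := by
    have : ∀ g, N g ^ 2 = ∑ f : V₀ ↪ Fin n, ∑ f' : V₀ ↪ Fin n,
        (if R f = g then (if R f' = R f then (1:ℝ) else 0) else 0) := by
      intro g
      rw [sq]
      simp only [N]
      rw [Finset.sum_mul]
      refine Finset.sum_congr rfl fun f _ => ?_
      rw [Finset.mul_sum]
      refine Finset.sum_congr rfl fun f' _ => ?_
      by_cases h : R f = g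
      · simp [h]
      · simp [h]
    simp only [this]
    conv_rhs => rw [Finset.sum_comm]
    refine Finset.sum_congr rfl fun f _ => ?_
    conv_rhs => rw [Finset.sum_comm]
    refine Finset.sum_congr rfl fun f' _ => ?_
    rw [Finset.sum_ite_eq]
    simp only [Finset.mem_univ, if_true]
    have : (∀ v ∈ U, f v = f' v) ↔ R f' = R f := by
      constructor
      · intro h; funext v; exact (h v v.2).symm
      · intro h v hv; exact (congrFun h ⟨v, hv⟩).symm
    simp only [this]
  rw [h2, ← h1]
  have := sq_sum_le_card_mul_sum_sq (s := (Finset.univ : Finset (U → Fin n))) (f := N)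
  refine this.trans (le_of_eq ?_)
  congr 1
  simp

/-- Variance lower bound. -/
lemma var_lower (hniso : ∀ v : V₀, ∃ w, G₀.Adj v w) (hedge : G₀.edgeFinset.Nonempty)
    {p : ℝ} (hp : 0 < p) (hp1 : p < 1) (hn : 4 * Fintype.card V₀ ^ 2 ≤ n) (hn0 : 0 < n) :
    (1 / 2 : ℝ) * (1 - p) * ((n : ℝ) ^ Fintype.card V₀ * p ^ G₀.edgeFinset.card /
        Nat.card (G₀ ≃g G₀)) ^ 2 / PsiMin G₀ n p ≤
      ∑ Γ ∈ copyFinset G₀ n, ∑ Γ' ∈ copyFinset G₀ n,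
        (p ^ (Γ ∪ Γ').card - p ^ Γ.card * p ^ Γ'.card) := by
  have ha : (0 : ℝ) < Nat.card (G₀ ≃g G₀) := by exact_mod_cast aut_pos G₀
  have hn' : (0 : ℝ) < n := by exact_mod_cast hn0
  have hΨ := psi_pos G₀ (n := n) hedge hp hn0
  obtain ⟨S, hS, hSne, hΨe⟩ := psi_att G₀ (n := n) hedge p
  set a : ℝ := (Nat.card (G₀ ≃g G₀) : ℝ) with hadef
  set e := G₀.edgeFinset.card with he
  set v := Fintype.card V₀ with hv
  have hSe : S.card ≤ e := Finset.card_le_card hS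
  -- transfer
  have h1 : a * (a * ∑ Γ ∈ copyFinset G₀ n, ∑ Γ' ∈ copyFinset G₀ n,
        (p ^ (Γ ∪ Γ').card - p ^ Γ.card * p ^ Γ'.card)) =
      ∑ f : V₀ ↪ Fin n, ∑ f' : V₀ ↪ Fin n,
        (p ^ (im G₀ f ∪ im G₀ f').card - p ^ (im G₀ f).card * p ^ (im G₀ f').card) := by
    rw [Finset.mul_sum]
    rw [hadef, ← sum_copy G₀ hniso (fun Γ => (Nat.card (G₀ ≃g G₀) : ℝ) * ∑ Γ' ∈ copyFinset G₀ n,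
        (p ^ (Γ ∪ Γ').card - p ^ Γ.card * p ^ Γ'.card))]
    refine Finset.sum_congr rfl fun f _ => ?_
    exact (sum_copy G₀ hniso (fun Γ' => p ^ (im G₀ f ∪ Γ').card - p ^ (im G₀ f).card * p ^ Γ'.card)).symm
  have h2 : ∀ f f' : V₀ ↪ Fin n, (if ∀ x ∈ vert S, f x = f' x then (1 : ℝ) else 0) *
      ((1 - p) * (p ^ e * p ^ e / p ^ S.card)) ≤
      (p ^ (im G₀ f ∪ im G₀ f').card - p ^ (im G₀ f).card * p ^ (im G₀ f').card) := by
    intro f f'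
    have hu := Finset.card_union_add_card_inter (im G₀ f) (im G₀ f')
    rw [im_card, im_card, ← he] at hu
    set I := (im G₀ f ∩ im G₀ f').card with hI
    set L := (im G₀ f ∪ im G₀ f').card with hL
    have h3 : p ^ e * p ^ e = p ^ L * p ^ I := by rw [← pow_add, ← pow_add, hu]
    rw [im_card, im_card, ← he, h3]
    have hI1 : p ^ I ≤ 1 := pow_le_one₀ hp.le hp1.le
    split_ifs with hag
    · have hSI : S.card ≤ I := by
        rw [hI, ← Finset.card_image_of_injective S (map_inj f)]
        apply Finset.card_le_card
        intro k hk
        obtain ⟨ed, hed, rfl⟩ := Finset.mem_image.1 hk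
        rw [Finset.mem_inter]
        refine ⟨Finset.mem_image_of_mem _ (hS hed), ?_⟩
        have : Sym2.map (⇑f) ed = Sym2.map (⇑f') ed := by
          apply Sym2.map_congr
          intro x hx
          exact hag x (mem_vert.2 ⟨ed, hed, hx⟩)
        rw [this]
        exact Finset.mem_image_of_mem _ (hS hed)
      have hSpos : 1 ≤ S.card := hSne.card_pos
      have h5 : p ^ I ≤ p ^ S.card := pow_le_pow_of_le_one hp.le hp1.le hSI
      have h6 : p ^ S.card ≤ p := by
        calc p ^ S.card ≤ p ^ 1 := pow_le_pow_of_le_one hp.le hp1.le hSpos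
          _ = p := pow_one p
      have h7 : p ^ L * p ^ I / p ^ S.card ≤ p ^ L := by
        rw [div_le_iff₀ (by positivity)]
        exact mul_le_mul_of_nonneg_left h5 (by positivity)
      have h8 : (1 - p) * (p ^ L * p ^ I / p ^ S.card) ≤ (1 - p) * p ^ L :=
        mul_le_mul_of_nonneg_left h7 (by linarith)
      have h9 : p ^ L * p ^ I ≤ p ^ L * p :=
        mul_le_mul_of_nonneg_left (h5.trans h6) (by positivity)
      linarith
    · have : p ^ L * p ^ I ≤ p ^ L * 1 := mul_le_mul_of_nonneg_left hI1 (by positivity)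
      linarith
  have h3 : (∑ f : V₀ ↪ Fin n, ∑ f' : V₀ ↪ Fin n, (if ∀ x ∈ vert S, f x = f' x then (1 : ℝ) else 0)) *
      ((1 - p) * (p ^ e * p ^ e / p ^ S.card)) ≤ a * (a * ∑ Γ ∈ copyFinset G₀ n, ∑ Γ' ∈ copyFinset G₀ n,
        (p ^ (Γ ∪ Γ').card - p ^ Γ.card * p ^ Γ'.card)) := by
    rw [h1, Finset.sum_mul]
    refine Finset.sum_le_sum fun f _ => ?_
    rw [Finset.sum_mul]
    exact Finset.sum_le_sum fun f' _ => h2 f f'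
  have h4 := pair_count (n := n) (vert S)
  have h5 := desc_lower hn hn0
  set Nn := ∑ f : V₀ ↪ Fin n, ∑ f' : V₀ ↪ Fin n, (if ∀ x ∈ vert S, f x = f' x then (1 : ℝ) else 0)
  set V := ∑ Γ ∈ copyFinset G₀ n, ∑ Γ' ∈ copyFinset G₀ n,
        (p ^ (Γ ∪ Γ').card - p ^ Γ.card * p ^ Γ'.card)
  have h6 : (1 / 2) * ((n : ℝ) ^ v) ^ 2 ≤ (n : ℝ) ^ (vert S).card * Nn := by
    refine le_trans ?_ h4
    have h7 : ((3 / 4 : ℝ) * (n : ℝ) ^ v) ^ 2 ≤ (n.descFactorial v : ℝ) ^ 2 := by gcongr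
    have : (0:ℝ) ≤ ((n : ℝ) ^ v) ^ 2 := by positivity
    nlinarith
  have h7 : (1 / 2) * ((n : ℝ) ^ v) ^ 2 / (n : ℝ) ^ (vert S).card ≤ Nn := by
    rw [div_le_iff₀ (by positivity)]; linarith
  have h8 : 0 ≤ ((1 - p) * (p ^ e * p ^ e / p ^ S.card)) :=
    mul_nonneg (by linarith) (by positivity)
  have h9 := (mul_le_mul_of_nonneg_right h7 h8).trans h3
  have h10 : (1 / 2 : ℝ) * (1 - p) * ((n : ℝ) ^ v * p ^ e / a) ^ 2 / PsiMin G₀ n p =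
    (1 / 2) * ((n : ℝ) ^ v) ^ 2 / (n : ℝ) ^ (vert S).card * ((1 - p) * (p ^ e * p ^ e / p ^ S.card)) / (a * a) := by
    rw [hΨe]
    field_simp
  rw [h10, div_le_iff₀ (by positivity)]
  linarith

end Ch
end CMD

open MeasureTheory ProbabilityTheory
open scoped Classical
set_option linter.unusedSectionVars false
set_option linter.unusedSimpArgs false
set_option linter.unusedVariables false

namespace CMD

lemma cConst_lower {V₀ : Type*} [Fintype V₀] [DecidableEq V₀] (G₀ : SimpleGraph V₀)
    [DecidableRel G₀.Adj] :
    22 * ((Real.sqrt 2) ^ G₀.edgeFinset.card) ^ 15 * ((Fintype.card V₀).factorial : ℝ) ^ 2 *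
      (G₀.edgeFinset.card : ℝ) ≤ cConst G₀ := by
  have ha1 : (1 : ℝ) ≤ Nat.card (G₀ ≃g G₀) := by exact_mod_cast aut_pos G₀
  have haF : (Nat.card (G₀ ≃g G₀) : ℝ) ≤ (Fintype.card V₀).factorial := by exact_mod_cast aut_le G₀
  unfold cConst
  generalize (Nat.card (G₀ ≃g G₀) : ℝ) = a at *
  generalize ((Fintype.card V₀).factorial : ℝ) = F at *
  generalize G₀.edgeFinset.card = e at *
  have h1 : a ^ ((3 : ℝ) / 2) ≤ F ^ 2 := by
    calc a ^ ((3 : ℝ) / 2) ≤ a ^ (2 : ℝ) := Real.rpow_le_rpow_of_exponent_le ha1 (by norm_num)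
      _ = a ^ 2 := by norm_cast
      _ ≤ F ^ 2 := by gcongr
  have h2 : (2 : ℝ) ^ ((9 : ℝ) / 2 + 15 / 2 * (e : ℝ)) = Real.sqrt 2 ^ 9 * ((Real.sqrt 2) ^ e) ^ 15 := by
    rw [← pow_mul, ← pow_add, Real.sqrt_eq_rpow, ← Real.rpow_natCast, ← Real.rpow_mul (by norm_num)]
    congr 1
    push_cast
    ring
  have h3 : (22 : ℝ) ≤ Real.sqrt 2 ^ 9 := by
    have h4 : Real.sqrt 2 ^ 9 = 16 * Real.sqrt 2 := by
      have : Real.sqrt 2 ^ 2 = 2 := Real.sq_sqrt (by norm_num)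
      calc Real.sqrt 2 ^ 9 = (Real.sqrt 2 ^ 2) ^ 4 * Real.sqrt 2 := by ring
        _ = _ := by rw [this]; norm_num
    have h5 : (1.4 : ℝ) ≤ Real.sqrt 2 := Real.le_sqrt_of_sq_le (by norm_num)
    linarith
  have hF : 0 < F := by linarith
  rw [h2, le_div_iff₀ (by positivity)]
  calc _ ≤ 22 * ((Real.sqrt 2) ^ e) ^ 15 * F ^ 2 * (e : ℝ) * F ^ 2 := by gcongr
    _ ≤ Real.sqrt 2 ^ 9 * ((Real.sqrt 2) ^ e) ^ 15 * F ^ 2 * (e : ℝ) * F ^ 2 := by gcongr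
    _ = _ := by ring

lemma bb_le {e v : ℕ} (hve : v ≤ 2 * e) (j : ℕ) {X r : ℝ} (hX : 0 ≤ X) (hr : r = Real.sqrt 2 ^ e) :
    bb e v 1 X = r ^ 2 * (v.factorial : ℝ) * X ∧
    bb e v 2 X ≤ r ^ 10 * (v.factorial : ℝ) * X ∧ bb e v 3 X ≤ r ^ 14 * (v.factorial : ℝ) * X ∧
    bb e v 4 X ≤ r ^ 18 * (v.factorial : ℝ) * X := by
  have hr2 : (2 : ℝ) ^ e = r ^ 2 := by
    rw [hr, ← pow_mul, mul_comm e 2, pow_mul, Real.sq_sqrt (by norm_num)]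
  have hv : (2 : ℝ) ^ v ≤ r ^ 4 := by
    calc (2 : ℝ) ^ v ≤ 2 ^ (2 * e) := pow_le_pow_right₀ (by norm_num) hve
      _ = (2 ^ e) ^ 2 := by rw [mul_comm, pow_mul]
      _ = _ := by rw [hr2]; ring
  have hk : ∀ k : ℕ, (2 : ℝ) ^ (k * v) ≤ r ^ (4 * k) := by
    intro k
    rw [mul_comm k v, pow_mul, pow_mul]
    gcongr
  unfold bb
  refine ⟨by simp [hr2], ?_, ?_, ?_⟩
  · rw [if_neg (by norm_num), hr2]
    calc _ ≤ r ^ 2 * (r ^ (4 * 2) * (v.factorial : ℝ)) * X := by gcongr; exact hk 2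
      _ = _ := by ring
  · rw [if_neg (by norm_num), hr2]
    calc _ ≤ r ^ 2 * (r ^ (4 * 3) * (v.factorial : ℝ)) * X := by gcongr; exact hk 3
      _ = _ := by ring
  · rw [if_neg (by norm_num), hr2]
    calc _ ≤ r ^ 2 * (r ^ (4 * 4) * (v.factorial : ℝ)) * X := by gcongr; exact hk 4
      _ = _ := by ring

set_option maxHeartbeats 2000000 in
lemma numer {e v : ℕ} (he : 1 ≤ e) (hve : v ≤ 2 * e) {P Ψ q σ u c : ℝ} (hP : 0 < P) (hΨ : 0 < Ψ)
    (hq : 0 < q) (hσ : 0 < σ) (hu : 0 ≤ u) (hvar : (1 / 2) * q * P ^ 2 / Ψ ≤ σ ^ 2)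
    (hc : 22 * ((Real.sqrt 2) ^ e) ^ 15 * (v.factorial : ℝ) ^ 2 * (e : ℝ) ≤ c)
    (hρ : 1 / Real.sqrt (q * Ψ) ≤ 1 / (2 * c)) :
    u * (2 * q * e * (P * bb e v 1 (P / Ψ) * bb e v 2 (P / Ψ)) / σ ^ 3) +
      Real.sqrt (16 * q * e ^ 2 * (P * bb e v 1 (P / Ψ) * bb e v 2 (P / Ψ) * bb e v 3 (P / Ψ)) / σ ^ 4 +
        u * (32 * q * e ^ 2 * (P * bb e v 1 (P / Ψ) * bb e v 2 (P / Ψ) * bb e v 3 (P / Ψ) *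
          bb e v 4 (P / Ψ)) / σ ^ 5)) ≤ c * (1 + u) * (1 / Real.sqrt (q * Ψ)) := by
  have hX : 0 < P / Ψ := by positivity
  obtain ⟨b1, b2, b3, b4⟩ := bb_le hve 0 hX.le (rfl : Real.sqrt 2 ^ e = _)
  have n2 := bb_nonneg e v 2 hX.le
  have n3 := bb_nonneg e v 3 hX.le
  have n4 := bb_nonneg e v 4 hX.le
  rw [b1]
  generalize bb e v 2 (P / Ψ) = B2 at *
  generalize bb e v 3 (P / Ψ) = B3 at *
  generalize bb e v 4 (P / Ψ) = B4 at *
  have hr1 : 1 ≤ Real.sqrt 2 ^ e := one_le_pow₀ (Real.one_le_sqrt.2 (by norm_num))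
  have hF1 : (1 : ℝ) ≤ v.factorial := by exact_mod_cast Nat.factorial_pos v
  have he1 : (1 : ℝ) ≤ e := by exact_mod_cast he
  generalize Real.sqrt 2 ^ e = r at *
  generalize (v.factorial : ℝ) = F at *
  generalize (e : ℝ) = ε at *
  set ρ := 1 / Real.sqrt (q * Ψ) with hρd
  have hρ0 : 0 < ρ := by positivity
  have hρ2 : ρ ^ 2 = 1 / (q * Ψ) := by rw [hρd, div_pow, Real.sq_sqrt (by positivity), one_pow]
  have hr0 : 0 < r := by linarith
  have hF0 : 0 < F := by linarith
  have he0 : 0 < ε := by linarith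
  have hc0 : 0 < c := lt_of_lt_of_le (by positivity) hc
  set w := P / Ψ / σ with hw
  have hw0 : 0 < w := by positivity
  set g := q * P * (P / Ψ) / σ ^ 2 with hg
  have hg0 : 0 < g := by positivity
  have hg2 : g ≤ 2 := by
    rw [hg, div_le_iff₀ (by positivity)]
    have : (1 / 2) * q * P ^ 2 / Ψ = (1 / 2) * (q * P * (P / Ψ)) := by ring
    rw [this] at hvar; linarith
  have hw2 : w ^ 2 = g * ρ ^ 2 := by
    rw [hρ2, hw, hg]; field_simp
  have hw1 : w ≤ 1.42 * ρ := by
    have h5 : w ^ 2 ≤ (1.42 * ρ) ^ 2 := by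
      have : g * ρ ^ 2 ≤ 2 * ρ ^ 2 := mul_le_mul_of_nonneg_right hg2 (sq_nonneg ρ)
      rw [hw2]; nlinarith [sq_nonneg ρ]
    exact (sq_le_sq₀ hw0.le (by positivity)).1 h5
  have hA3 : 2 * q * ε * (P * (r ^ 2 * F * (P / Ψ)) * B2) / σ ^ 3 ≤ c * ρ / 3 := by
    calc 2 * q * ε * (P * (r ^ 2 * F * (P / Ψ)) * B2) / σ ^ 3
        ≤ 2 * q * ε * (P * (r ^ 2 * F * (P / Ψ)) * (r ^ 10 * F * (P / Ψ))) / σ ^ 3 := by gcongr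
      _ = 2 * ε * r ^ 12 * F ^ 2 * (g * w) := by rw [hg, hw]; field_simp
      _ ≤ 2 * ε * r ^ 12 * F ^ 2 * (2 * (1.42 * ρ)) := by gcongr
      _ ≤ 2 * ε * r ^ 15 * F ^ 2 * (2 * (1.42 * ρ)) := by gcongr <;> norm_num
      _ = (2 * 2 * 1.42) * (r ^ 15 * F ^ 2 * ε) * ρ := by ring
      _ ≤ (22 / 3) * (r ^ 15 * F ^ 2 * ε) * ρ := by gcongr; norm_num
      _ = (22 * r ^ 15 * F ^ 2 * ε) * ρ / 3 := by ring
      _ ≤ _ := by gcongr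
  have hA4 : 16 * q * ε ^ 2 * (P * (r ^ 2 * F * (P / Ψ)) * B2 * B3) / σ ^ 4 ≤ 4 / 9 * (c * ρ) ^ 2 := by
    calc 16 * q * ε ^ 2 * (P * (r ^ 2 * F * (P / Ψ)) * B2 * B3) / σ ^ 4
        ≤ 16 * q * ε ^ 2 * (P * (r ^ 2 * F * (P / Ψ)) * (r ^ 10 * F * (P / Ψ)) * (r ^ 14 * F * (P / Ψ))) / σ ^ 4 := by
          gcongr
      _ = 16 * ε ^ 2 * r ^ 26 * F ^ 3 * (g * w * w) := by rw [hg, hw]; field_simp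
      _ ≤ 16 * ε ^ 2 * r ^ 26 * F ^ 3 * (2 * (1.42 * ρ) * (1.42 * ρ)) := by gcongr
      _ ≤ 16 * ε ^ 2 * r ^ 30 * F ^ 4 * (2 * (1.42 * ρ) * (1.42 * ρ)) := by gcongr <;> norm_num
      _ = (16 * 2 * 1.42 * 1.42) * ((r ^ 15 * F ^ 2 * ε) * ρ) ^ 2 := by ring
      _ ≤ (4 / 9 * 22 ^ 2) * ((r ^ 15 * F ^ 2 * ε) * ρ) ^ 2 :=
          mul_le_mul_of_nonneg_right (by norm_num) (by positivity)
      _ = 4 / 9 * ((22 * r ^ 15 * F ^ 2 * ε) * ρ) ^ 2 := by ring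
      _ ≤ _ := by gcongr
  have hcρ : 2 * (22 * r ^ 15 * F ^ 2 * ε) * ρ ≤ 1 := by
    have h1 : ρ * (2 * c) ≤ 1 := by rwa [le_div_iff₀ (by positivity)] at hρ
    have h2 : (22 * r ^ 15 * F ^ 2 * ε) * ρ ≤ c * ρ := by gcongr
    linarith
  have hA5 : 32 * q * ε ^ 2 * (P * (r ^ 2 * F * (P / Ψ)) * B2 * B3 * B4) / σ ^ 5 ≤ 4 / 9 * (c * ρ) ^ 2 := by
    calc 32 * q * ε ^ 2 * (P * (r ^ 2 * F * (P / Ψ)) * B2 * B3 * B4) / σ ^ 5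
        ≤ 32 * q * ε ^ 2 * (P * (r ^ 2 * F * (P / Ψ)) * (r ^ 10 * F * (P / Ψ)) * (r ^ 14 * F * (P / Ψ))
            * (r ^ 18 * F * (P / Ψ))) / σ ^ 5 := by
          gcongr
      _ = 32 * ε ^ 2 * r ^ 44 * F ^ 4 * (g * w * w * w) := by rw [hg, hw]; field_simp
      _ ≤ 32 * ε ^ 2 * r ^ 44 * F ^ 4 * (2 * (1.42 * ρ) * (1.42 * ρ) * (1.42 * ρ)) := by gcongr
      _ ≤ 32 * ε ^ 3 * r ^ 45 * F ^ 6 * (2 * (1.42 * ρ) * (1.42 * ρ) * (1.42 * ρ)) := by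
          gcongr <;> norm_num
      _ = (32 * 2 * 1.42 * 1.42 * 1.42) / 44 * ((r ^ 15 * F ^ 2 * ε) * ρ) ^ 2 *
            (2 * (22 * r ^ 15 * F ^ 2 * ε) * ρ) := by ring
      _ ≤ (32 * 2 * 1.42 * 1.42 * 1.42) / 44 * ((r ^ 15 * F ^ 2 * ε) * ρ) ^ 2 * 1 := by gcongr
      _ ≤ (4 / 9 * 22 ^ 2) * ((r ^ 15 * F ^ 2 * ε) * ρ) ^ 2 * 1 :=
          mul_le_mul_of_nonneg_right (mul_le_mul_of_nonneg_right (by norm_num) (by positivity)) (by norm_num)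
      _ = 4 / 9 * ((22 * r ^ 15 * F ^ 2 * ε) * ρ) ^ 2 := by ring
      _ ≤ _ := by gcongr
  have h1 : u * (2 * q * ε * (P * (r ^ 2 * F * (P / Ψ)) * B2) / σ ^ 3) ≤ u * (c * ρ / 3) :=
    mul_le_mul_of_nonneg_left hA3 hu
  have h2 : u * (32 * q * ε ^ 2 * (P * (r ^ 2 * F * (P / Ψ)) * B2 * B3 * B4) / σ ^ 5) ≤
    u * (4 / 9 * (c * ρ) ^ 2) := mul_le_mul_of_nonneg_left hA5 hu
  have h3 : Real.sqrt (16 * q * ε ^ 2 * (P * (r ^ 2 * F * (P / Ψ)) * B2 * B3) / σ ^ 4 +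
        u * (32 * q * ε ^ 2 * (P * (r ^ 2 * F * (P / Ψ)) * B2 * B3 * B4) / σ ^ 5)) ≤
      2 / 3 * (c * ρ) * (1 + u) := by
    apply Real.sqrt_le_iff.2
    refine ⟨by positivity, ?_⟩
    have h4 : 0 ≤ (c * ρ) ^ 2 := by positivity
    nlinarith [mul_nonneg h4 hu, mul_nonneg h4 (mul_nonneg hu hu)]
  have h4 : 0 ≤ c * ρ := by positivity
  nlinarith [mul_nonneg h4 hu]

end CMD

open MeasureTheory ProbabilityTheory
open scoped Classical
set_option linter.unusedSectionVars false
set_option linter.unusedSimpArgs false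
set_option linter.unusedVariables false

namespace CMD

lemma var_formula {E : Type*} [Fintype E] [DecidableEq E] (M : Finset (Finset E)) (p : ℝ) :
    Ex p (fun S => (∑ Γ ∈ M, (BB Γ S - p ^ Γ.card)) ^ 2) =
      ∑ Γ ∈ M, ∑ Γ' ∈ M, (p ^ (Γ ∪ Γ').card - p ^ Γ.card * p ^ Γ'.card) := by
  have h1 : (fun S : Finset E => (∑ Γ ∈ M, (BB Γ S - p ^ Γ.card)) ^ 2) =
      fun S => ∑ Γ ∈ M, ∑ Γ' ∈ M, (BB Γ S - p ^ Γ.card) * (BB Γ' S - p ^ Γ'.card) := by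
    funext S; rw [sq, Finset.sum_mul_sum]
  rw [h1, Ex_sum]
  refine Finset.sum_congr rfl fun Γ _ => ?_
  rw [Ex_sum]
  refine Finset.sum_congr rfl fun Γ' _ => ?_
  have h2 : (fun S : Finset E => (BB Γ S - p ^ Γ.card) * (BB Γ' S - p ^ Γ'.card)) =
      fun S => BB (Γ ∪ Γ') S - p ^ Γ.card * BB Γ' S - (p ^ Γ'.card * BB Γ S - p ^ Γ.card * p ^ Γ'.card) := by
    funext S; rw [← BB_mul]; ring
  rw [h2, Ex_sub, Ex_sub, Ex_sub, Ex_mul, Ex_mul, Ex_const]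
  have h3 := fun A : Finset E => Ex_BB p A
  rw [h3, h3, h3]
  ring

lemma var_W {E : Type*} [Fintype E] [DecidableEq E] (M : Finset (Finset E)) {p σ : ℝ} (hσ : 0 < σ)
    (h : σ ^ 2 = Ex p (fun S => (∑ Γ ∈ M, (BB Γ S - p ^ Γ.card)) ^ 2)) :
    Ex p (fun S => Wf M p σ S ^ 2) = 1 := by
  have : (fun S => Wf M p σ S ^ 2) = fun S => σ⁻¹ ^ 2 * (∑ Γ ∈ M, (BB Γ S - p ^ Γ.card)) ^ 2 := by
    funext S; unfold Wf; ring
  rw [this, Ex_mul, ← h]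
  field_simp

lemma sqrt2pi_le : Real.sqrt (2 * Real.pi) ≤ 2.52 := by
  rw [Real.sqrt_le_iff]
  refine ⟨by norm_num, ?_⟩
  have := Real.pi_lt_d2
  norm_num at this ⊢
  linarith

lemma exp_half_le : Real.exp (1 / 2) ≤ 1.7 := by
  have h1 : Real.exp (1 / 2) ^ 2 = Real.exp 1 := by rw [← Real.exp_nat_mul]; norm_num
  have h2 := Real.exp_one_lt_d9
  have h3 := Real.exp_pos (1 / 2)
  by_contra h
  push Not at h
  nlinarith

lemma poly_bound {t : ℝ} (ht : 0 ≤ t) :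
    (1 + t) * (2 + 2 * Real.sqrt (2 * Real.pi) * (1 + t) +
        Real.sqrt (2 * Real.pi) * Real.exp (1 / 2) * t * (t + 1)) ≤ 50 * (1 + t ^ 3) := by
  have h1 := sqrt2pi_le
  have h2 := exp_half_le
  calc _ ≤ (1 + t) * (2 + 2 * 2.52 * (1 + t) + 2.52 * 1.7 * t * (t + 1)) := by gcongr
    _ ≤ _ := by nlinarith [pow_nonneg ht 3, mul_nonneg ht (sq_nonneg (t - 1)), sq_nonneg (t - 1)]

lemma ratio_trivial {x Q : ℝ} (hx0 : 0 ≤ x) (hx1 : x ≤ 1) (hQ : 0 < Q) (hQ1 : Q ≤ 1) :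
    |(1 - x) / Q - 1| ≤ 1 / Q := by
  have h1 : 1 ≤ 1 / Q := by rw [le_div_iff₀ hQ]; linarith
  have h2 : (1 - x) / Q ≤ 1 / Q := by gcongr; linarith
  have h3 : 0 ≤ (1 - x) / Q := div_nonneg (by linarith) hQ.le
  rw [abs_le]; constructor <;> linarith

lemma one_div_QQ_le {t : ℝ} (ht : 0 ≤ t) :
    1 / QQ t ≤ (1 + t) * (Real.sqrt (2 * Real.pi) * Real.exp (t ^ 2 / 2)) := by
  have h1 := QQ_lower2 ht
  rw [← inv_phi, mul_one_div, div_le_div_iff₀ (QQ_pos ht) (phi_pos t)]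
  linarith

section Main
variable {V₀ : Type*} [Fintype V₀] [DecidableEq V₀] (G₀ : SimpleGraph V₀) [DecidableRel G₀.Adj]
  {n : ℕ}

lemma sqrt_aut_ge : Real.sqrt 2 * ((Fintype.card V₀ : ℝ)) ^ 2 * (G₀.edgeFinset.card : ℝ) ≤ cHatConst G₀ := by
  have ha : (0 : ℝ) < Nat.card (G₀ ≃g G₀) := by exact_mod_cast aut_pos G₀
  have haF : (Nat.card (G₀ ≃g G₀) : ℝ) ≤ (Fintype.card V₀).factorial := by exact_mod_cast aut_le G₀
  unfold cHatConst
  rw [le_div_iff₀ (by positivity)]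
  have := Real.sqrt_le_sqrt haF
  calc _ ≤ Real.sqrt 2 * ((Fintype.card V₀ : ℝ)) ^ 2 * (G₀.edgeFinset.card : ℝ) *
        Real.sqrt ((Fintype.card V₀).factorial : ℝ) := by gcongr
    _ = _ := by ring

lemma tD_bound (hedge : G₀.edgeFinset.Nonempty) {p Ψ σ D c₁ t a : ℝ} (hp : 0 < p) (hp1 : p < 1)
    (hn0 : 0 < n) (hΨ : 0 < Ψ) (hσ : 0 < σ) (hD0 : 0 ≤ D) (ha : 0 < a) (hc₁ : 0 < c₁)
    (hvar : (1 / 2 : ℝ) * (1 - p) * ((n : ℝ) ^ Fintype.card V₀ * p ^ G₀.edgeFinset.card / a) ^ 2 / Ψ ≤ σ ^ 2)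
    (hD : a * D ≤ 2 * (G₀.edgeFinset.card : ℝ) ^ 2 * (n : ℝ) ^ (Fintype.card V₀ - 2))
    (htle : t ≤ c₁ * (n : ℝ) ^ 2 * p ^ G₀.edgeFinset.card * Real.sqrt (1 - p) / Real.sqrt Ψ) :
    D * t / σ ≤ c₁ * cHatConst G₀ := by
  have hv2 := v_ge G₀ hedge
  have hn' : (0 : ℝ) < n := by exact_mod_cast hn0
  have hq : 0 < 1 - p := by linarith
  have hev : (2 : ℝ) * G₀.edgeFinset.card ≤ (Fintype.card V₀ : ℝ) ^ 2 := by exact_mod_cast e_le G₀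
  have hch := sqrt_aut_ge G₀
  generalize cHatConst G₀ = ĉ at *
  generalize G₀.edgeFinset.card = e at *
  generalize Fintype.card V₀ = v at *
  set P := (n : ℝ) ^ v * p ^ e / a with hP
  have hP0 : 0 < P := by positivity
  have hs2 : 0 < Real.sqrt 2 := by positivity
  have h1 : Real.sqrt (1 - p) / Real.sqrt Ψ * P ≤ Real.sqrt 2 * σ := by
    apply (sq_le_sq₀ (by positivity) (by positivity)).1
    rw [mul_pow, div_pow, Real.sq_sqrt hq.le, Real.sq_sqrt hΨ.le, mul_pow, Real.sq_sqrt (by norm_num)]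
    have : (1 - p) / Ψ * P ^ 2 = 2 * (1 / 2 * (1 - p) * P ^ 2 / Ψ) := by ring
    linarith
  have h2 : (n : ℝ) ^ v = n ^ (v - 2) * n ^ 2 := by rw [← pow_add, Nat.sub_add_cancel hv2]
  rw [div_le_iff₀ hσ]
  have hD' : D ≤ 2 * (e : ℝ) ^ 2 * (n : ℝ) ^ (v - 2) / a := by rw [le_div_iff₀ ha]; linarith
  calc D * t ≤ D * (c₁ * (n : ℝ) ^ 2 * p ^ e * Real.sqrt (1 - p) / Real.sqrt Ψ) := by gcongr
    _ ≤ (2 * (e : ℝ) ^ 2 * (n : ℝ) ^ (v - 2) / a) * (c₁ * (n : ℝ) ^ 2 * p ^ e * Real.sqrt (1 - p) / Real.sqrt Ψ) := by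
        gcongr
    _ = c₁ * (2 * e ^ 2) * (Real.sqrt (1 - p) / Real.sqrt Ψ * P) := by rw [hP, h2]; ring
    _ ≤ c₁ * (2 * e ^ 2) * (Real.sqrt 2 * σ) := by gcongr
    _ = c₁ * (Real.sqrt 2 * (2 * e) * e) * σ := by ring
    _ ≤ c₁ * (Real.sqrt 2 * (v : ℝ) ^ 2 * e) * σ := by gcongr
    _ ≤ c₁ * ĉ * σ := by gcongr

set_option maxHeartbeats 2000000 in
theorem main_Ex (hedge : G₀.edgeFinset.Nonempty) (hniso : ∀ v : V₀, ∃ w, G₀.Adj v w)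
    (hn : 4 * (Fintype.card V₀) ^ 2 ≤ n) {p σ : ℝ} (hp : 0 < p) (hp1 : p < 1) (hσ : 0 < σ)
    (hσ2 : σ ^ 2 = Ex p (fun S => (∑ Γ ∈ copyFinset G₀ n, (BB Γ S - p ^ Γ.card)) ^ 2))
    (D : ℕ) (hD : ∀ Γ ∈ copyFinset G₀ n, (near (copyFinset G₀ n) Γ).card = D)
    (c₁ c₂ : ℝ) (hc₁ : 0 < c₁) (hc₂ : 0 < c₂) (t : ℝ) (ht : 0 ≤ t)
    (htle : t ≤ c₁ * (n : ℝ) ^ 2 * p ^ G₀.edgeFinset.card * Real.sqrt (1 - p) /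
      Real.sqrt (PsiMin G₀ n p))
    (hts : t ^ 2 * sFun (PsiMin G₀ n p) σ (1 - p) D t ≤ c₂) :
    |(1 - Ex p (fun S => if Wf (copyFinset G₀ n) p σ S ≤ t then 1 else 0)) / QQ t - 1| ≤
      100 * (1 + c₁) * cConst G₀ *
        Real.exp (5 * c₁ * cHatConst G₀ + c₂ * cConst G₀) *
        ((1 + t ^ 3) / Real.sqrt ((1 - p) * PsiMin G₀ n p)) := by
  have hv2 := v_ge G₀ hedge
  have hn0 : 0 < n := by nlinarith
  have hq : 0 < 1 - p := by linarith
  have hΨ := psi_pos G₀ (n := n) hedge hp hn0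
  have he1 : 1 ≤ G₀.edgeFinset.card := hedge.card_pos
  have ha : (0 : ℝ) < Nat.card (G₀ ≃g G₀) := by exact_mod_cast aut_pos G₀
  have hn' : (0 : ℝ) < n := by exact_mod_cast hn0
  have hQ := QQ_pos ht
  have hcl := cConst_lower G₀
  have hc1 : 1 ≤ cConst G₀ := by
    refine le_trans ?_ hcl
    have hr1 : 1 ≤ (Real.sqrt 2 ^ G₀.edgeFinset.card) ^ 15 :=
      one_le_pow₀ (one_le_pow₀ (Real.one_le_sqrt.2 (by norm_num)))
    have hF1 : (1 : ℝ) ≤ ((Fintype.card V₀).factorial : ℝ) ^ 2 :=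
      one_le_pow₀ (by exact_mod_cast Nat.factorial_pos _)
    have he1' : (1 : ℝ) ≤ G₀.edgeFinset.card := by exact_mod_cast he1
    calc (1 : ℝ) ≤ 22 * 1 * 1 * 1 := by norm_num
      _ ≤ _ := by gcongr
  have hchat : 0 ≤ cHatConst G₀ := by unfold cHatConst; positivity
  set Ψ := PsiMin G₀ n p with hΨd
  set cG := cConst G₀ with hcG
  set ĉ := cHatConst G₀ with hĉ
  have hcG0 : 0 < cG := by linarith
  set x := Ex p (fun S => if Wf (copyFinset G₀ n) p σ S ≤ t then (1 : ℝ) else 0) with hx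
  have hx0 : 0 ≤ x := Ex_nonneg hp.le hp1.le (fun S => by split_ifs <;> norm_num)
  have hx1 : x ≤ 1 := by
    have := Ex_mono hp.le hp1.le (F := fun S => if Wf (copyFinset G₀ n) p σ S ≤ t then (1 : ℝ) else 0)
      (G := fun _ => 1) (fun S => by split_ifs <;> norm_num)
    rwa [Ex_const] at this
  have hsq : 0 < Real.sqrt ((1 - p) * Ψ) := by positivity
  have hmin : 0 < min (Real.sqrt Ψ) 1 := lt_min (by positivity) one_pos
  have hE1 : 1 ≤ Real.exp (5 * (D : ℝ) * t / σ) := Real.one_le_exp (by positivity)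
  by_cases hcase : Real.sqrt ((1 - p) * Ψ) ≤ 2 * cG
  · -- trivial case
    have hQ1 : QQ t ≤ 1 := by
      have := cdf_nonneg' t
      unfold QQ; linarith
    refine (ratio_trivial hx0 hx1 hQ hQ1).trans ((one_div_QQ_le ht).trans ?_)
    have hρ : 1 / (2 * cG) ≤ 1 / Real.sqrt ((1 - p) * Ψ) := one_div_le_one_div_of_le hsq hcase
    have hs : 1 / (2 * cG) ≤ sFun Ψ σ (1 - p) D t := by
      unfold sFun
      have h1 : 1 ≤ 1 + t / min (Real.sqrt Ψ) 1 := by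
        have : 0 ≤ t / min (Real.sqrt Ψ) 1 := by positivity
        linarith
      calc 1 / (2 * cG) ≤ 1 / Real.sqrt ((1 - p) * Ψ) := hρ
        _ = 1 * (1 / Real.sqrt ((1 - p) * Ψ)) * 1 := by ring
        _ ≤ _ := by gcongr
    have ht2 : t ^ 2 / 2 ≤ c₂ * cG := by
      have h1 : t ^ 2 * (1 / (2 * cG)) ≤ c₂ := (mul_le_mul_of_nonneg_left hs (sq_nonneg t)).trans hts
      rw [mul_one_div, div_le_iff₀ (by positivity)] at h1
      linarith
    have hexp : Real.exp (t ^ 2 / 2) ≤ Real.exp (5 * c₁ * ĉ + c₂ * cG) := by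
      apply Real.exp_le_exp.2
      have : 0 ≤ 5 * c₁ * ĉ := by positivity
      linarith
    have h3 := sqrt2pi_le
    have h4 : (1 + t) * 2.52 ≤ 50 * (1 + t ^ 3) := by
      nlinarith [pow_nonneg ht 3, mul_nonneg ht (sq_nonneg (t - 1)), sq_nonneg (t - 1)]
    have h5 : 1 ≤ 2 * cG * (1 / Real.sqrt ((1 - p) * Ψ)) := by
      rw [mul_one_div, le_div_iff₀ hsq]; linarith
    set Ee := Real.exp (5 * c₁ * ĉ + c₂ * cG)
    have hEe : 0 < Ee := Real.exp_pos _
    calc (1 + t) * (Real.sqrt (2 * Real.pi) * Real.exp (t ^ 2 / 2))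
        ≤ (1 + t) * (2.52 * Ee) := by gcongr
      _ = (1 + t) * 2.52 * Ee * 1 * 1 := by ring
      _ ≤ 50 * (1 + t ^ 3) * Ee * (2 * cG * (1 / Real.sqrt ((1 - p) * Ψ))) * (1 + c₁) := by
          gcongr; linarith
      _ = _ := by ring
  · push Not at hcase
    have hρ : 1 / Real.sqrt ((1 - p) * Ψ) ≤ 1 / (2 * cG) :=
      one_div_le_one_div_of_le (by positivity) hcase.le
    have hΨ1 : 1 ≤ Ψ := by
      have h1 : 1 ≤ Real.sqrt ((1 - p) * Ψ) := by linarith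
      rw [Real.one_le_sqrt] at h1
      nlinarith
    have hm1 : min (Real.sqrt Ψ) 1 = 1 := min_eq_right (Real.one_le_sqrt.2 hΨ1)
    have hvar := var_lower G₀ hniso hedge hp hp1 hn hn0
    rw [← var_formula, ← hσ2, ← hΨd] at hvar
    have hW := var_W (copyFinset G₀ n) hσ hσ2
    have hch := chain_inst G₀ (n := n) hniso hedge hp hn0
    have hDD : ∀ γ ∈ copyFinset G₀ n, ((near (copyFinset G₀ n) γ).card : ℝ) ≤ (D : ℝ) := by
      intro γ hγ; rw [hD γ hγ]
    have hMne : (copyFinset G₀ n).Nonempty := by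
      by_contra hne
      rw [Finset.not_nonempty_iff_eq_empty] at hne
      rw [hne] at hσ2
      simp [Ex_zero] at hσ2
      linarith
    obtain ⟨Γ₀, hΓ₀⟩ := hMne
    have hnb := near_bound G₀ hniso hΓ₀
    rw [hD Γ₀ hΓ₀] at hnb
    have htD := tD_bound G₀ hedge hp hp1 hn0 hΨ hσ (Nat.cast_nonneg D) ha hc₁ hvar hnb htle
    have hE2 : Real.exp (5 * (D : ℝ) * t / σ) ≤ Real.exp (5 * c₁ * ĉ) := by
      apply Real.exp_le_exp.2
      have : 5 * (D : ℝ) * t / σ = 5 * ((D : ℝ) * t / σ) := by ring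
      rw [this]; linarith
    set ρ := 1 / Real.sqrt ((1 - p) * Ψ) with hρd
    have hρ0 : 0 < ρ := by positivity
    set θ := 2 * (cG * (1 + t) * ρ) * Real.exp (5 * (D : ℝ) * t / σ) with hθ
    have hθ0 : 0 ≤ θ := by positivity
    have key := cmd_abstract (copyFinset G₀ n) hp hp1 hσ ht hθ0 (by
      intro u hu hut
      refine (theta_abstract hch hp hp1 hσ hu (Nat.cast_nonneg D) hDD hW).trans ?_
      refine mul_le_mul_of_nonneg_right ?_ (Mg_pos _ σ u hp hp1).le
      have hnum := numer (e := G₀.edgeFinset.card) (v := Fintype.card V₀) he1 (v_le G₀ hniso)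
        (P := (n : ℝ) ^ Fintype.card V₀ * p ^ G₀.edgeFinset.card / Nat.card (G₀ ≃g G₀)) (by positivity)
        hΨ hq hσ hu hvar hcl hρ
      rw [div_div] at hnum
      have hexp : Real.exp (u * D / σ) ^ 5 ≤ Real.exp (5 * (D : ℝ) * t / σ) := by
        rw [← Real.exp_nat_mul]
        apply Real.exp_le_exp.2
        push_cast
        calc 5 * (u * D / σ) = 5 * D * u / σ := by ring
          _ ≤ _ := by gcongr
      have hcu : cG * (1 + u) * (1 / Real.sqrt ((1 - p) * Ψ)) ≤ cG * (1 + t) * ρ := by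
        rw [← hρd]; gcongr
      have h7 := mul_le_mul hexp (hnum.trans hcu) (by
        have h8 := bb_nonneg G₀.edgeFinset.card (Fintype.card V₀)
        have h9 : 0 ≤ (n : ℝ) ^ Fintype.card V₀ * p ^ G₀.edgeFinset.card /
          (Nat.card (G₀ ≃g G₀) * Ψ) := by positivity
        have h81 := h8 1 h9
        have h82 := h8 2 h9
        positivity) (Real.exp_pos _).le
      calc _ ≤ 2 * (Real.exp (5 * (D : ℝ) * t / σ) * (cG * (1 + t) * ρ)) :=
            mul_le_mul_of_nonneg_left h7 (by norm_num)
        _ = θ := by rw [hθ]; ring)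
    rw [← hx] at key
    have hs : t ^ 2 * θ / 2 ≤ c₂ * cG := by
      unfold sFun at hts
      rw [hm1, div_one, ← hρd] at hts
      have : t ^ 2 * θ / 2 = (t ^ 2 * ((1 + t) * ρ * Real.exp (5 * (D : ℝ) * t / σ))) * cG := by
        rw [hθ]; ring
      rw [this]
      gcongr
    have e1 : (1 - x) / QQ t - 1 = -((x - stdNormalCDF t) / QQ t) := by
      have : 1 - x = QQ t - (x - stdNormalCDF t) := by unfold QQ; ring
      rw [this, sub_div, div_self hQ.ne']; ring
    rw [e1, abs_neg, abs_div, abs_of_pos hQ, div_le_iff₀ hQ]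
    refine key.trans ?_
    rw [mul_comm]
    refine mul_le_mul_of_nonneg_right ?_ hQ.le
    have hpoly := poly_bound ht
    set L := (2 + 2 * Real.sqrt (2 * Real.pi) * (1 + t) +
        Real.sqrt (2 * Real.pi) * Real.exp (1 / 2) * t * (t + 1)) with hL
    have hL0 : 0 ≤ L := by positivity
    calc θ * Real.exp (t ^ 2 * θ / 2) * L ≤ θ * Real.exp (c₂ * cG) * L := by gcongr
      _ = 2 * cG * ρ * Real.exp (5 * (D : ℝ) * t / σ) * Real.exp (c₂ * cG) * ((1 + t) * L) := by
          rw [hθ]; ring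
      _ ≤ 2 * cG * ρ * Real.exp (5 * c₁ * ĉ) * Real.exp (c₂ * cG) * (50 * (1 + t ^ 3)) := by gcongr
      _ = 100 * 1 * cG * Real.exp (5 * c₁ * ĉ + c₂ * cG) * ((1 + t ^ 3) * ρ) := by
          rw [Real.exp_add]; ring
      _ ≤ 100 * (1 + c₁) * cG * Real.exp (5 * c₁ * ĉ + c₂ * cG) * ((1 + t ^ 3) * ρ) := by
          gcongr; linarith
      _ = _ := by rw [hρd]; ring
end Main
end CMD

open MeasureTheory ProbabilityTheory
open scoped Classical
set_option linter.unusedSectionVars false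
set_option linter.unusedSimpArgs false
set_option linter.unusedVariables false

namespace CMD
section Tr
variable {E : Type*} [Fintype E] [DecidableEq E] {Ω : Type*} [MeasurableSpace Ω] (μ : Measure Ω)
  [IsProbabilityMeasure μ] (B : E → Ω → ℝ)

/-- The random edge set. -/
noncomputable def SS (ω : Ω) : Finset E := Finset.univ.filter (fun k => B k ω = 1)

lemma SS_pre (hBval : ∀ k ω, B k ω = 0 ∨ B k ω = 1) (T : Finset E) :
    {ω | SS B ω = T} = ⋂ k ∈ (Finset.univ : Finset E), B k ⁻¹' (if k ∈ T then {1} else {0}) := by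
  ext ω
  simp only [Set.mem_ofPred_eq, Set.mem_iInter, Finset.mem_univ, true_implies, Set.mem_preimage]
  constructor
  · intro h k
    split_ifs with hk
    · rw [← h] at hk; exact (Finset.mem_filter.1 hk).2
    · rcases hBval k ω with h0 | h1
      · exact h0
      · exact absurd (h ▸ Finset.mem_filter.2 ⟨Finset.mem_univ _, h1⟩) hk
  · intro h
    ext k
    have := h k
    simp only [SS, Finset.mem_filter, Finset.mem_univ, true_and]
    split_ifs at this with hk
    · simp only [Set.mem_singleton_iff] at this
      simp [this, hk]
    · simp only [Set.mem_singleton_iff] at this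
      simp [this, hk]

lemma SS_meas (hBmeas : ∀ k, Measurable (B k)) (hBval : ∀ k ω, B k ω = 0 ∨ B k ω = 1) (T : Finset E) :
    MeasurableSet {ω | SS B ω = T} := by
  rw [SS_pre B hBval]
  refine Finset.measurableSet_biInter _ fun k _ => hBmeas k ?_
  split_ifs <;> exact measurableSet_singleton _

lemma SS_prob {p : ℝ} (hp : 0 < p) (hp1 : p < 1) (hBmeas : ∀ k, Measurable (B k))
    (hBval : ∀ k ω, B k ω = 0 ∨ B k ω = 1) (hind : iIndepFun B μ)
    (hmarg : ∀ k, μ {ω | B k ω = 1} = ENNReal.ofReal p) (T : Finset E) :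
    μ.real {ω | SS B ω = T} = p ^ T.card * (1 - p) ^ Tᶜ.card := by
  have h1 : ∀ k, μ.real (B k ⁻¹' {1}) = p := by
    intro k
    have := hmarg k
    rw [Measure.real, show B k ⁻¹' {1} = {ω | B k ω = 1} from rfl, this, ENNReal.toReal_ofReal hp.le]
  have h0 : ∀ k, μ.real (B k ⁻¹' {0}) = 1 - p := by
    intro k
    have : B k ⁻¹' {0} = (B k ⁻¹' {1})ᶜ := by
      ext ω
      simp only [Set.mem_preimage, Set.mem_singleton_iff, Set.mem_compl_iff]
      rcases hBval k ω with h | h <;> simp [h]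
    rw [this, probReal_compl_eq_one_sub (hBmeas k (measurableSet_singleton _)), h1]
  rw [SS_pre B hBval, Measure.real, hind.measure_inter_preimage_eq_mul Finset.univ
    (sets := fun k => if k ∈ T then {1} else {0})
    (fun k _ => by split_ifs <;> exact measurableSet_singleton _), ENNReal.toReal_prod]
  have h2 : ∀ k, (μ (B k ⁻¹' (if k ∈ T then {1} else {0}))).toReal = if k ∈ T then p else 1 - p := by
    intro k
    split_ifs
    · exact h1 k
    · exact h0 k
  rw [Finset.prod_congr rfl (fun k _ => h2 k), Finset.prod_ite, Finset.prod_const, Finset.prod_const]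
  congr 3
  · ext k; simp
  · ext k; simp

lemma SS_integral {p : ℝ} (hp : 0 < p) (hp1 : p < 1) (hBmeas : ∀ k, Measurable (B k))
    (hBval : ∀ k ω, B k ω = 0 ∨ B k ω = 1) (hind : iIndepFun B μ)
    (hmarg : ∀ k, μ {ω | B k ω = 1} = ENNReal.ofReal p) (F : Finset E → ℝ) :
    ∫ ω, F (SS B ω) ∂μ = Ex p F := by
  have h1 : ∀ ω, F (SS B ω) = ∑ T : Finset E, {ω | SS B ω = T}.indicator (fun _ => F T) ω := by
    intro ω
    simp only [Set.indicator_apply, Set.mem_ofPred_eq]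
    rw [Finset.sum_ite_eq]; simp
  simp only [h1]
  rw [integral_finsetSum]
  · unfold Ex
    refine Finset.sum_congr rfl fun T _ => ?_
    rw [integral_indicator_const _ (SS_meas B hBmeas hBval T), SS_prob μ B hp hp1 hBmeas hBval hind hmarg,
      smul_eq_mul]
  · intro T _
    exact (integrable_const _).indicator (SS_meas B hBmeas hBval T)

lemma SS_event {p : ℝ} (hp : 0 < p) (hp1 : p < 1) (hBmeas : ∀ k, Measurable (B k))
    (hBval : ∀ k ω, B k ω = 0 ∨ B k ω = 1) (hind : iIndepFun B μ)
    (hmarg : ∀ k, μ {ω | B k ω = 1} = ENNReal.ofReal p) (W : Finset E → ℝ) (t : ℝ) :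
    (μ {ω | W (SS B ω) > t}).toReal = 1 - Ex p (fun S => if W S ≤ t then 1 else 0) := by
  have hm : MeasurableSet {ω | W (SS B ω) ≤ t} := by
    have : {ω | W (SS B ω) ≤ t} = ⋃ T ∈ (Finset.univ.filter (fun T => W T ≤ t)), {ω | SS B ω = T} := by
      ext ω
      simp
    rw [this]
    exact Finset.measurableSet_biUnion _ fun T _ => SS_meas B hBmeas hBval T
  have h1 : {ω | W (SS B ω) > t} = {ω | W (SS B ω) ≤ t}ᶜ := by
    ext ω; simp
  have h2 : Ex p (fun S => if W S ≤ t then (1 : ℝ) else 0) = μ.real {ω | W (SS B ω) ≤ t} := by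
    rw [← SS_integral μ B hp hp1 hBmeas hBval hind hmarg]
    have : (fun ω => if W (SS B ω) ≤ t then (1 : ℝ) else 0) =
        {ω | W (SS B ω) ≤ t}.indicator (fun _ => 1) := by
      funext ω; simp [Set.indicator_apply]
    rw [this, integral_indicator_const _ hm, smul_eq_mul, mul_one]
  rw [h1, h2]
  exact probReal_compl_eq_one_sub hm

end Tr

lemma prodB_eq {Ω : Type*} {n : ℕ} (B : Sym2 (Fin n) → Ω → ℝ) (hBval : ∀ k ω, B k ω = 0 ∨ B k ω = 1)
    (Γ : Finset (Sym2 (Fin n))) (ω : Ω) : prodB B Γ ω = BB Γ (SS B ω) := by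
  unfold prodB BB
  split_ifs with h
  · apply Finset.prod_eq_one
    intro k hk
    exact (Finset.mem_filter.1 (h hk)).2
  · rw [Finset.not_subset] at h
    obtain ⟨k, hk, hk2⟩ := h
    apply Finset.prod_eq_zero hk
    rcases hBval k ω with h0 | h1
    · exact h0
    · exact absurd (by unfold SS; exact Finset.mem_filter.2 ⟨Finset.mem_univ k, h1⟩) hk2

end CMD

theorem stmt_2 {V₀ : Type*} [Fintype V₀] [DecidableEq V₀]
    (G₀ : SimpleGraph V₀) [DecidableRel G₀.Adj]
    (hedge : G₀.edgeFinset.Nonempty)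
    (hniso : ∀ v : V₀, ∃ w, G₀.Adj v w)
    (n : ℕ) (hn : 4 * (Fintype.card V₀) ^ 2 ≤ n)
    (p : ℝ) (hp : 0 < p) (hp1 : p < 1)
    {Ω : Type*} [MeasurableSpace Ω] (μ : Measure Ω) [IsProbabilityMeasure μ]
    (B : Sym2 (Fin n) → Ω → ℝ) (hBmeas : ∀ k, Measurable (B k))
    (hBval : ∀ k ω, B k ω = 0 ∨ B k ω = 1)
    (hind : iIndepFun B μ)
    (hmarg : ∀ k, μ {ω | B k ω = 1} = ENNReal.ofReal p)
    (hσ : 0 < subgraphSigma G₀ n μ B)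
    (D : ℕ)
    (hD : ∀ Γ ∈ copyFinset G₀ n,
      ((copyFinset G₀ n).filter (fun Γ' => (Γ' ∩ Γ).Nonempty)).card = D)
    (c₁ c₂ : ℝ) (hc₁ : 0 < c₁) (hc₂ : 0 < c₂)
    (t : ℝ) (ht : 0 ≤ t)
    (htle : t ≤ c₁ * (n : ℝ) ^ 2 * p ^ G₀.edgeFinset.card * Real.sqrt (1 - p) /
      Real.sqrt (PsiMin G₀ n p))
    (hts : t ^ 2 * sFun (PsiMin G₀ n p) (subgraphSigma G₀ n μ B) (1 - p) D t ≤ c₂) :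
    |(μ {ω | subgraphW G₀ n μ B ω > t}).toReal / (1 - stdNormalCDF t) - 1| ≤
      100 * (1 + c₁) * cConst G₀ *
        Real.exp (5 * c₁ * cHatConst G₀ + c₂ * cConst G₀) *
        ((1 + t ^ 3) / Real.sqrt ((1 - p) * PsiMin G₀ n p)) := by
  have hpB := CMD.prodB_eq B hBval
  have hI := fun F => CMD.SS_integral μ B hp hp1 hBmeas hBval hind hmarg F
  have hEP : ∀ Γ, ∫ ω, prodB B Γ ω ∂μ = p ^ Γ.card := by
    intro Γ
    simp only [hpB]
    rw [hI (CMD.BB Γ), CMD.Ex_BB]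
  have hW : ∀ ω, subgraphW G₀ n μ B ω =
      CMD.Wf (copyFinset G₀ n) p (subgraphSigma G₀ n μ B) (CMD.SS B ω) := by
    intro ω
    unfold subgraphW CMD.Wf
    simp only [hEP]
    simp only [hpB]
  have hσ2 : subgraphSigma G₀ n μ B ^ 2 =
      CMD.Ex p (fun S => (∑ Γ ∈ copyFinset G₀ n, (CMD.BB Γ S - p ^ Γ.card)) ^ 2) := by
    have h1 : subgraphSigma G₀ n μ B ^ 2 = (∫ ω, (∑ Γ ∈ copyFinset G₀ n, prodB B Γ ω) ^ 2 ∂μ) -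
        (∫ ω, ∑ Γ ∈ copyFinset G₀ n, prodB B Γ ω ∂μ) ^ 2 := by
      unfold subgraphSigma at hσ ⊢
      exact Real.sq_sqrt (Real.sqrt_pos.1 hσ).le
    rw [h1]
    simp only [hpB]
    rw [hI (fun S => (∑ Γ ∈ copyFinset G₀ n, CMD.BB Γ S) ^ 2),
      hI (fun S => ∑ Γ ∈ copyFinset G₀ n, CMD.BB Γ S), CMD.Ex_sum]
    simp only [CMD.Ex_BB]
    set m := ∑ Γ ∈ copyFinset G₀ n, p ^ Γ.card with hm
    have h2 : (fun S : Finset (Sym2 (Fin n)) =>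
        (∑ Γ ∈ copyFinset G₀ n, (CMD.BB Γ S - p ^ Γ.card)) ^ 2) =
        fun S => (∑ Γ ∈ copyFinset G₀ n, CMD.BB Γ S) ^ 2 -
          (2 * m * (∑ Γ ∈ copyFinset G₀ n, CMD.BB Γ S) - m ^ 2) := by
      funext S
      rw [Finset.sum_sub_distrib, ← hm]; ring
    rw [h2, CMD.Ex_sub, CMD.Ex_sub, CMD.Ex_mul, CMD.Ex_const, CMD.Ex_sum]
    simp only [CMD.Ex_BB]
    rw [← hm]; ring
  have hset : {ω | subgraphW G₀ n μ B ω > t} =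
      {ω | CMD.Wf (copyFinset G₀ n) p (subgraphSigma G₀ n μ B) (CMD.SS B ω) > t} := by
    simp only [hW]
  rw [hset, CMD.SS_event μ B hp hp1 hBmeas hBval hind hmarg]
  refine CMD.main_Ex G₀ hedge hniso hn hp hp1 hσ hσ2 D ?_ c₁ c₂ hc₁ hc₂ t ht htle hts
  intro Γ hΓ
  rw [← hD Γ hΓ]
  unfold CMD.near
  congr!
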